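/- Let n ≥ 5. There exists ε₁ > 0 such that for every p on the critical hyperbola with |p − 1| ≤ ε₁ and q = q(p), the following holds: every smooth function φ on ℝⁿ with φ(x) → 0 as |x| → ∞ and ∫_{ℝⁿ} |Δφ|² < ∞ that solves the linearized scalar equation (−Δ)((−ΔU_p)^{1/p − 1} (−Δφ)) = p q U_p^{q−1} φ on ℝⁿ is a linear combination of the n+1 functions ∂U_p/∂x_1, …, ∂U_p/∂x_n and x·∇U_p + (n−2 − n/(p+1)) U_p. -/

import Mathlib

open Filter MeasureTheory Topology

noncomputable def lap {n : ℕ} (f : EuclideanSpace ℝ (Fin n) → ℝ)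
    (x : EuclideanSpace ℝ (Fin n)) : ℝ :=
  ∑ i, fderiv ℝ (fderiv ℝ f) x (EuclideanSpace.single i 1) (EuclideanSpace.single i 1)

def IsGroundState (n : ℕ) (p q : ℝ) (U V : EuclideanSpace ℝ (Fin n) → ℝ) : Prop :=
  ContDiff ℝ 2 U ∧ ContDiff ℝ 2 V ∧
  (∀ x, 0 < U x) ∧ (∀ x, 0 < V x) ∧
  (∀ x, -lap U x = V x ^ p) ∧ (∀ x, -lap V x = U x ^ q) ∧
  (∀ x y, ‖x‖ ≤ ‖y‖ → U y ≤ U x) ∧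
  (∀ x y, ‖x‖ ≤ ‖y‖ → V y ≤ V x) ∧
  Tendsto U (cocompact _) (nhds 0) ∧
  Tendsto V (cocompact _) (nhds 0) ∧
  U 0 = 1

theorem lap_eq_laplacian {n : ℕ} (f : EuclideanSpace ℝ (Fin n) → ℝ) :
    lap f = Laplacian.laplacian f := by
  rw [InnerProductSpace.laplacian_eq_iteratedFDeriv_orthonormalBasis f
    (EuclideanSpace.basisFun (Fin n) ℝ)]
  funext x
  simp [lap, iteratedFDeriv_two_apply]

theorem lap_congr {n : ℕ} {f g : EuclideanSpace ℝ (Fin n) → ℝ} {x : EuclideanSpace ℝ (Fin n)}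
    (h : f =ᶠ[𝓝 x] g) : lap f x = lap g x := by
  unfold lap
  rw [(h.fderiv).fderiv_eq]

theorem lap_add {n : ℕ} {f g : EuclideanSpace ℝ (Fin n) → ℝ} {x : EuclideanSpace ℝ (Fin n)}
    (hf : ContDiffAt ℝ 2 f x) (hg : ContDiffAt ℝ 2 g x) :
    lap (fun y => f y + g y) x = lap f x + lap g x := by
  simp only [lap_eq_laplacian]
  exact hf.laplacian_add hg

theorem lap_const_mul {n : ℕ} {f : EuclideanSpace ℝ (Fin n) → ℝ} {x : EuclideanSpace ℝ (Fin n)}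
    (c : ℝ) (hf : ContDiffAt ℝ 2 f x) :
    lap (fun y => c * f y) x = c * lap f x := by
  simp only [lap_eq_laplacian]
  exact InnerProductSpace.laplacian_smul c hf

theorem lap_neg {n : ℕ} {f : EuclideanSpace ℝ (Fin n) → ℝ} {x : EuclideanSpace ℝ (Fin n)}
    (hf : ContDiffAt ℝ 2 f x) :
    lap (fun y => - f y) x = - lap f x := by
  simpa using lap_const_mul (-1) hf

theorem lap_sub {n : ℕ} {f g : EuclideanSpace ℝ (Fin n) → ℝ} {x : EuclideanSpace ℝ (Fin n)}
    (hf : ContDiffAt ℝ 2 f x) (hg : ContDiffAt ℝ 2 g x) :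
    lap (fun y => f y - g y) x = lap f x - lap g x := by
  simp only [sub_eq_add_neg]
  rw [lap_add hf hg.neg, lap_neg hg]

theorem ContDiffAt.eventually_hasFDerivAt {F : Type*} [NormedAddCommGroup F] [NormedSpace ℝ F]
    {f : F → ℝ} {x : F} (hf : ContDiffAt ℝ 2 f x) :
    ∀ᶠ y in 𝓝 x, HasFDerivAt f (fderiv ℝ f y) y := by
  filter_upwards [hf.eventually (by simp)] with y hy
  exact (hy.differentiableAt (by simp)).hasFDerivAt

theorem ContDiffAt.differentiableAt_fderiv_of_two {F : Type*} [NormedAddCommGroup F]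
    [NormedSpace ℝ F]
    {f : F → ℝ} {x : F} (hf : ContDiffAt ℝ 2 f x) :
    DifferentiableAt ℝ (fderiv ℝ f) x :=
  (hf.fderiv_right (m := 1) (by norm_num)).differentiableAt (by simp)

theorem lap_mul {n : ℕ} {f g : EuclideanSpace ℝ (Fin n) → ℝ} {x : EuclideanSpace ℝ (Fin n)}
    (hf : ContDiffAt ℝ 2 f x) (hg : ContDiffAt ℝ 2 g x) :
    lap (fun y => f y * g y) x = f x * lap g x + g x * lap f x +
      2 * ∑ i, fderiv ℝ f x (EuclideanSpace.single i 1) *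
        fderiv ℝ g x (EuclideanSpace.single i 1) := by
  have h1 : fderiv ℝ (fun y => f y * g y) =ᶠ[𝓝 x]
      fun y => f y • fderiv ℝ g y + g y • fderiv ℝ f y := by
    filter_upwards [hf.eventually_hasFDerivAt, hg.eventually_hasFDerivAt] with y h1 h2
    exact (h1.mul h2).fderiv
  have h2 := ((hf.differentiableAt (by simp)).hasFDerivAt.smul
      hg.differentiableAt_fderiv_of_two.hasFDerivAt).add
    ((hg.differentiableAt (by simp)).hasFDerivAt.smul hf.differentiableAt_fderiv_of_two.hasFDerivAt)
  have h3 := h1.fderiv_eq.trans h2.fderiv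
  unfold lap
  rw [h3]
  simp only [add_apply, ContinuousLinearMap.smulRight_apply,
    smul_apply, smul_eq_mul, Finset.sum_add_distrib, Finset.mul_sum]
  rw [show ∀ a b c d e : ℝ, (a + b + (c + d) = a + c + e) ↔ (b + d = e) from
    fun a b c d e => by constructor <;> intro h <;> linarith]
  rw [← Finset.sum_add_distrib]
  exact Finset.sum_congr rfl fun i _ => by ring

theorem lap_comp_linearIsometryEquiv {n : ℕ} {f : EuclideanSpace ℝ (Fin n) → ℝ}
    (hf : ContDiff ℝ 2 f)
    (σ : EuclideanSpace ℝ (Fin n) ≃ₗᵢ[ℝ] EuclideanSpace ℝ (Fin n))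
    {x : EuclideanSpace ℝ (Fin n)} :
    lap (fun y => f (σ y)) x = lap f (σ x) := by
  simp only [lap_eq_laplacian]
  have := InnerProductSpace.laplacian_eq_iteratedFDeriv_orthonormalBasis (fun y => f (σ y))
    (EuclideanSpace.basisFun (Fin n) ℝ)
  rw [this, InnerProductSpace.laplacian_eq_iteratedFDeriv_orthonormalBasis f
    ((EuclideanSpace.basisFun (Fin n) ℝ).map σ)]
  refine Finset.sum_congr rfl fun i _ => ?_
  have h := (σ.toContinuousLinearEquiv : EuclideanSpace ℝ (Fin n) →L[ℝ]
    EuclideanSpace ℝ (Fin n)).iteratedFDeriv_comp_right hf x (i := 2) le_rfl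
  have h' := congrArg (fun T => T ![EuclideanSpace.basisFun (Fin n) ℝ i,
    EuclideanSpace.basisFun (Fin n) ℝ i]) h
  simp only [ContinuousMultilinearMap.compContinuousLinearMap_apply] at h'
  refine h'.trans ?_
  congr 1
  funext j
  fin_cases j <;> rfl

theorem isLocalMax_deriv_deriv_nonpos {g : ℝ → ℝ} (hg : ContDiffAt ℝ 2 g 0)
    (h : IsLocalMax g 0) : deriv (deriv g) 0 ≤ 0 := by
  by_contra! hc
  have h0 := isLocalMin_of_deriv_deriv_pos hc h.deriv_eq_zero hg.continuousAt
  have heq : ∀ᶠ t in 𝓝 (0:ℝ), g t = g 0 := by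
    filter_upwards [h, h0] with t h1 h2 using le_antisymm h1 h2
  have h1 : g =ᶠ[𝓝 0] fun _ => g 0 := heq
  have h2 := h1.deriv.deriv_eq
  rw [h2] at hc
  simp at hc

theorem deriv_deriv_comp_line {F : Type*} [NormedAddCommGroup F] [NormedSpace ℝ F]
    {f : F → ℝ} {x : F} (hf : ContDiffAt ℝ 2 f x) (e : F) :
    deriv (deriv (fun t : ℝ => f (x + t • e))) 0 = fderiv ℝ (fderiv ℝ f) x e e := by
  have hl : ∀ t : ℝ, HasDerivAt (fun t : ℝ => x + t • e) e t := fun t => by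
    simpa using ((hasDerivAt_id t).smul_const e).const_add x
  have hcont : Tendsto (fun t : ℝ => x + t • e) (𝓝 0) (𝓝 x) := by
    have := (hl 0).continuousAt.tendsto
    simpa using this
  have h1 : deriv (fun t : ℝ => f (x + t • e)) =ᶠ[𝓝 0] fun t => fderiv ℝ f (x + t • e) e := by
    filter_upwards [hcont.eventually hf.eventually_hasFDerivAt] with t ht
    exact (ht.comp_hasDerivAt t (hl t)).deriv
  rw [h1.deriv_eq]
  have h2 : HasFDerivAt (fderiv ℝ f) (fderiv ℝ (fderiv ℝ f) x) (x + (0:ℝ) • e) := by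
    simpa using hf.differentiableAt_fderiv_of_two.hasFDerivAt
  have h3 := h2.comp_hasDerivAt (0:ℝ) (hl 0)
  have h4 := h3.clm_apply (hasDerivAt_const (0:ℝ) e)
  simpa using h4.deriv

theorem lap_nonpos_of_isLocalMax {n : ℕ} {f : EuclideanSpace ℝ (Fin n) → ℝ}
    {x : EuclideanSpace ℝ (Fin n)} (hf : ContDiffAt ℝ 2 f x) (h : IsLocalMax f x) :
    lap f x ≤ 0 := by
  refine Finset.sum_nonpos fun i _ => ?_
  rw [← deriv_deriv_comp_line hf]
  have hc : ContinuousAt (fun t : ℝ => x + t • (EuclideanSpace.single i (1:ℝ))) 0 := by fun_prop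
  refine isLocalMax_deriv_deriv_nonpos ?_ ?_
  · refine ContDiffAt.comp (0:ℝ) (g := f) (by simpa using hf) (by fun_prop)
  · have : Tendsto (fun t : ℝ => x + t • (EuclideanSpace.single i (1:ℝ))) (𝓝 0) (𝓝 x) := by
      simpa using hc.tendsto
    have h' := this.eventually h
    simpa [IsLocalMax, IsMaxFilter] using h'

theorem hasFDerivAt_norm_comp {F : Type*} [NormedAddCommGroup F] [InnerProductSpace ℝ F]
    {H : ℝ → ℝ} {H' : ℝ} {y : F} (hy : y ≠ 0)
    (h : HasDerivAt H H' ‖y‖) :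
    HasFDerivAt (fun z : F => H ‖z‖) ((H' / ‖y‖) • innerSL ℝ y) y := by
  have h1 : HasFDerivAt (fun z : F => ‖z‖) (‖y‖⁻¹ • innerSL ℝ y) y := by
    have h2 : HasFDerivAt (fun z : F => ‖z‖ ^ 2) (2 • innerSL ℝ y) y :=
      (hasStrictFDerivAt_norm_sq y).hasFDerivAt
    have hpos : 0 < ‖y‖ := norm_pos_iff.2 hy
    have h3 := h2.sqrt (by positivity)
    have h4 : (fun z : F => √(‖z‖ ^ 2)) = fun z => ‖z‖ := by
      funext z; rw [Real.sqrt_sq (norm_nonneg z)]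
    rw [h4, Real.sqrt_sq hpos.le] at h3
    convert h3 using 1
    ext z
    simp
    field_simp
  have h5 := h.comp_hasFDerivAt y h1
  rw [smul_smul] at h5
  exact h5

theorem contDiffAt_norm_comp {F : Type*} [NormedAddCommGroup F] [InnerProductSpace ℝ F]
    {H : ℝ → ℝ} {y : F} (hy : y ≠ 0) (h : ContDiffAt ℝ 2 H ‖y‖) :
    ContDiffAt ℝ 2 (fun z : F => H ‖z‖) y :=
  ContDiffAt.comp y h (contDiffAt_norm ℝ hy)

theorem lap_radial {n : ℕ} {H H1 : ℝ → ℝ} {H2 : ℝ} {x : EuclideanSpace ℝ (Fin n)} (hx : x ≠ 0)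
    (h1 : ∀ᶠ r in 𝓝 ‖x‖, HasDerivAt H (H1 r) r) (h2 : HasDerivAt H1 H2 ‖x‖) :
    lap (fun y => H ‖y‖) x = H2 + (n - 1) / ‖x‖ * H1 ‖x‖ := by
  have hpos : 0 < ‖x‖ := norm_pos_iff.2 hx
  have e1 : fderiv ℝ (fun y : EuclideanSpace ℝ (Fin n) => H ‖y‖) =ᶠ[𝓝 x]
      fun y => (H1 ‖y‖ / ‖y‖) • innerSL ℝ y := by
    have := (continuous_norm.tendsto x).eventually h1
    filter_upwards [this, eventually_ne_nhds hx] with y hy hy0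
    exact (hasFDerivAt_norm_comp hy0 hy).fderiv
  have hk : HasDerivAt (fun r => H1 r / r) ((H2 * ‖x‖ - H1 ‖x‖ * 1) / ‖x‖ ^ 2) ‖x‖ :=
    h2.div (hasDerivAt_id _) hpos.ne'
  have e2 := (hasFDerivAt_norm_comp hx hk).smul ((innerSL ℝ :
    EuclideanSpace ℝ (Fin n) →L[ℝ] EuclideanSpace ℝ (Fin n) →L[ℝ] ℝ).hasFDerivAt (x := x))
  have e3 := e1.fderiv_eq.trans e2.fderiv
  unfold lap
  rw [e3]
  simp only [add_apply, ContinuousLinearMap.smulRight_apply,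
    smul_apply, smul_eq_mul, Finset.sum_add_distrib, innerSL_apply_apply]
  have hs : ∑ i, x i ^ 2 = ‖x‖ ^ 2 := by
    rw [EuclideanSpace.norm_sq_eq]; simp
  have hi : ∀ (y : EuclideanSpace ℝ (Fin n)) i,
      innerSL ℝ y (EuclideanSpace.single i (1:ℝ)) = y i := fun y i => by
    rw [innerSL_apply_apply, EuclideanSpace.inner_single_right]; simp
  simp only [← innerSL_apply_apply ℝ, hi]
  simp
  rw [show (∑ i : Fin n, (H2 * ‖x‖ - H1 ‖x‖) / ‖x‖ ^ 2 / ‖x‖ * x i * x i)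
    = (H2 * ‖x‖ - H1 ‖x‖) / ‖x‖ ^ 2 / ‖x‖ * ∑ i, x i ^ 2 by
      rw [Finset.mul_sum]; exact Finset.sum_congr rfl fun i _ => by ring, hs]
  field_simp
  ring

theorem lap_mul_radial {n : ℕ} {P : EuclideanSpace ℝ (Fin n) → ℝ} {l : ℝ} {H H1 : ℝ → ℝ} {H2 : ℝ}
    {x : EuclideanSpace ℝ (Fin n)} (hx : x ≠ 0)
    (hP : ContDiffAt ℝ 2 P x) (hP0 : lap P x = 0) (hPl : fderiv ℝ P x x = l * P x)
    (hH : ContDiffAt ℝ 2 H ‖x‖)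
    (h1 : ∀ᶠ r in 𝓝 ‖x‖, HasDerivAt H (H1 r) r) (h2 : HasDerivAt H1 H2 ‖x‖) :
    lap (fun y => P y * H ‖y‖) x = P x * (H2 + (n - 1 + 2 * l) / ‖x‖ * H1 ‖x‖) := by
  have hpos : 0 < ‖x‖ := norm_pos_iff.2 hx
  rw [lap_mul hP (contDiffAt_norm_comp hx hH), lap_radial hx h1 h2, hP0,
    (hasFDerivAt_norm_comp hx h1.self_of_nhds).fderiv]
  have hi : ∀ i, innerSL ℝ x (EuclideanSpace.single i (1:ℝ)) = x i := fun i => by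
    rw [innerSL_apply_apply, EuclideanSpace.inner_single_right]; simp
  have hs : ∑ i, fderiv ℝ P x (EuclideanSpace.single i 1) * x i = l * P x := by
    rw [← hPl]
    generalize fderiv ℝ P x = L
    conv_rhs => rw [← (EuclideanSpace.basisFun (Fin n) ℝ).sum_repr x]
    rw [map_sum]
    refine Finset.sum_congr rfl fun i _ => ?_
    simp [mul_comm]
  have hs' : ∑ i, fderiv ℝ P x (EuclideanSpace.single i 1) *
      ((H1 ‖x‖ / ‖x‖) • innerSL ℝ x) (EuclideanSpace.single i 1)
      = H1 ‖x‖ / ‖x‖ * (l * P x) := by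
    rw [← hs, Finset.mul_sum]
    refine Finset.sum_congr rfl fun i _ => ?_
    rw [smul_apply, hi, smul_eq_mul]; ring
  rw [hs']
  ring

theorem hasFDerivAt_inner_const {F : Type*} [NormedAddCommGroup F] [InnerProductSpace ℝ F]
    (e x : F) : HasFDerivAt (fun y : F => inner ℝ e y) (innerSL ℝ e) x :=
  (innerSL ℝ e).hasFDerivAt

theorem contDiff_inner_const {F : Type*} [NormedAddCommGroup F] [InnerProductSpace ℝ F]
    (e : F) {k : WithTop ℕ∞} : ContDiff ℝ k (fun y : F => inner ℝ e y) :=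
  (innerSL ℝ e).contDiff

theorem lap_inner_mul_radial {n : ℕ} (e : EuclideanSpace ℝ (Fin n)) {H H1 : ℝ → ℝ} {H2 : ℝ}
    {x : EuclideanSpace ℝ (Fin n)} (hx : x ≠ 0) (hH : ContDiffAt ℝ 2 H ‖x‖)
    (h1 : ∀ᶠ r in 𝓝 ‖x‖, HasDerivAt H (H1 r) r) (h2 : HasDerivAt H1 H2 ‖x‖) :
    lap (fun y => inner ℝ e y * H ‖y‖) x
      = inner ℝ e x * (H2 + (n + 1) / ‖x‖ * H1 ‖x‖) := by
  have hd : fderiv ℝ (fun y : EuclideanSpace ℝ (Fin n) => inner ℝ e y)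
      = fun _ => innerSL ℝ e := by
    funext y; exact (hasFDerivAt_inner_const e y).fderiv
  rw [lap_mul_radial (l := 1) hx (contDiff_inner_const e).contDiffAt (by simp [lap, hd]) (by rw [hd]; simp) hH h1 h2]
  ring

theorem lap_inner_mul_inner {n : ℕ} {e e' : EuclideanSpace ℝ (Fin n)} (h : inner ℝ e e' = 0)
    (x : EuclideanSpace ℝ (Fin n)) :
    lap (fun y => inner ℝ e y * inner ℝ e' y) x = 0 := by
  have hd : ∀ e : EuclideanSpace ℝ (Fin n),
      fderiv ℝ (fun y : EuclideanSpace ℝ (Fin n) => inner ℝ e y) = fun _ => innerSL ℝ e := by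
    intro e; funext y; exact (hasFDerivAt_inner_const e y).fderiv
  have h0 : ∀ e : EuclideanSpace ℝ (Fin n),
      lap (fun y : EuclideanSpace ℝ (Fin n) => inner ℝ e y) x = 0 := by
    intro e; simp [lap, hd]
  rw [lap_mul (contDiff_inner_const e).contDiffAt (contDiff_inner_const e').contDiffAt, h0, h0, hd, hd]
  have : ∑ i, innerSL ℝ e (EuclideanSpace.single i 1) * innerSL ℝ e' (EuclideanSpace.single i 1)
      = inner ℝ e e' := by
    simp only [innerSL_apply_apply, PiLp.inner_apply]
    simp [mul_comm]
  rw [this, h]; ring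

theorem lap_inner_mul_inner_mul_radial {n : ℕ} {e e' : EuclideanSpace ℝ (Fin n)}
    (hee : inner ℝ e e' = 0) {H H1 : ℝ → ℝ} {H2 : ℝ}
    {x : EuclideanSpace ℝ (Fin n)} (hx : x ≠ 0) (hH : ContDiffAt ℝ 2 H ‖x‖)
    (h1 : ∀ᶠ r in 𝓝 ‖x‖, HasDerivAt H (H1 r) r) (h2 : HasDerivAt H1 H2 ‖x‖) :
    lap (fun y => inner ℝ e y * inner ℝ e' y * H ‖y‖) x
      = inner ℝ e x * inner ℝ e' x * (H2 + (n + 3) / ‖x‖ * H1 ‖x‖) := by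
  have hd := (hasFDerivAt_inner_const e x).mul (hasFDerivAt_inner_const e' x)
  have hd' : fderiv ℝ (fun y => inner ℝ e y * inner ℝ e' y) x x
      = 2 * (inner ℝ e x * inner ℝ e' x) := by
    erw [hd.fderiv]
    simp only [add_apply, smul_apply, innerSL_apply_apply, smul_eq_mul]
    ring
  rw [lap_mul_radial (l := 2) hx
    ((contDiff_inner_const e).mul (contDiff_inner_const e')).contDiffAt (lap_inner_mul_inner hee x) hd' hH h1 h2]
  ring

theorem lap_rpow_norm {n : ℕ} (s : ℝ) {x : EuclideanSpace ℝ (Fin n)} (hx : x ≠ 0) :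
    lap (fun y => ‖y‖ ^ (-s)) x = - (s * (n - 2 - s)) * ‖x‖ ^ (-s - 2) := by
  have hpos : 0 < ‖x‖ := norm_pos_iff.2 hx
  have h1 : ∀ᶠ r in 𝓝 ‖x‖, HasDerivAt (fun r : ℝ => r ^ (-s)) (-s * r ^ (-s - 1)) r := by
    filter_upwards [lt_mem_nhds hpos] with r hr
    exact Real.hasDerivAt_rpow_const (Or.inl (ne_of_gt hr))
  have h2 : HasDerivAt (fun r : ℝ => -s * r ^ (-s - 1)) (-s * ((-s - 1) * ‖x‖ ^ (-s - 1 - 1))) ‖x‖ :=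
    (Real.hasDerivAt_rpow_const (Or.inl hpos.ne')).const_mul _
  rw [lap_radial (H := fun r => r ^ (-s)) hx h1 h2]
  have e1 : ‖x‖ ^ (-s - 1) = ‖x‖ ^ (-s - 2) * ‖x‖ := by
    rw [← Real.rpow_add_one hpos.ne']; congr 1; ring
  rw [show -s - 1 - 1 = -s - 2 by ring, e1]
  field_simp
  ring

theorem lap_inner_mul_inner_mul_rpow_norm {n : ℕ} {e e' : EuclideanSpace ℝ (Fin n)}
    (hee : inner ℝ e e' = 0) (s : ℝ) {x : EuclideanSpace ℝ (Fin n)} (hx : x ≠ 0) :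
    lap (fun y => inner ℝ e y * inner ℝ e' y * ‖y‖ ^ (-s)) x
      = - (s * (n + 2 - s)) * (inner ℝ e x * inner ℝ e' x * ‖x‖ ^ (-s - 2)) := by
  have hpos : 0 < ‖x‖ := norm_pos_iff.2 hx
  have h1 : ∀ᶠ r in 𝓝 ‖x‖, HasDerivAt (fun r : ℝ => r ^ (-s)) (-s * r ^ (-s - 1)) r := by
    filter_upwards [lt_mem_nhds hpos] with r hr
    exact Real.hasDerivAt_rpow_const (Or.inl (ne_of_gt hr))
  have h2 : HasDerivAt (fun r : ℝ => -s * r ^ (-s - 1)) (-s * ((-s - 1) * ‖x‖ ^ (-s - 1 - 1))) ‖x‖ :=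
    (Real.hasDerivAt_rpow_const (Or.inl hpos.ne')).const_mul _
  rw [lap_inner_mul_inner_mul_radial (H := fun r => r ^ (-s)) hee hx
    (Real.contDiffAt_rpow_const_of_ne hpos.ne') h1 h2]
  have e1 : ‖x‖ ^ (-s - 1) = ‖x‖ ^ (-s - 2) * ‖x‖ := by
    rw [← Real.rpow_add_one hpos.ne']; congr 1; ring
  rw [show -s - 1 - 1 = -s - 2 by ring, e1]
  field_simp
  ring

/-- Radial profiles of a positive decaying solution of the Lane-Emden system, with `N` the
dimension, `u1`, `v1` the derivatives of `u`, `v`. -/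
structure RadialProfile (N p q : ℝ) (u v u1 v1 : ℝ → ℝ) : Prop where
  two_lt : 2 < N
  p_pos : 0 < p
  q_pos : 0 < q
  u_pos : ∀ r, 0 < u r
  v_pos : ∀ r, 0 < v r
  hu : ∀ r, HasDerivAt u (u1 r) r
  hv : ∀ r, HasDerivAt v (v1 r) r
  u1_cont : Continuous u1
  v1_cont : Continuous v1
  u1_zero : u1 0 = 0
  v1_zero : v1 0 = 0
  hu1 : ∀ r, 0 < r → HasDerivAt u1 (-((N - 1) / r * u1 r) - v r ^ p) r
  hv1 : ∀ r, 0 < r → HasDerivAt v1 (-((N - 1) / r * v1 r) - u r ^ q) r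
  u_lim : Tendsto u atTop (𝓝 0)
  v_lim : Tendsto v atTop (𝓝 0)

theorem HasDerivAt.rpow_mul {f : ℝ → ℝ} {f' r : ℝ} (a : ℝ) (hr : 0 < r) (hf : HasDerivAt f f' r) :
    HasDerivAt (fun x => x ^ a * f x) (r ^ a * (f' + a / r * f r)) r := by
  have h := (Real.hasDerivAt_rpow_const (p := a) (Or.inl hr.ne')).mul hf
  refine h.congr_deriv ?_
  rw [Real.rpow_sub_one hr.ne']
  field_simp
  ring

theorem contDiffOn_two_of_hasDerivAt {f f1 f2 : ℝ → ℝ} {s : Set ℝ} (hs : IsOpen s)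
    (h1 : ∀ r ∈ s, HasDerivAt f (f1 r) r) (h2 : ∀ r ∈ s, HasDerivAt f1 (f2 r) r)
    (h3 : ContinuousOn f2 s) : ContDiffOn ℝ 2 f s := by
  have e : (2 : WithTop ℕ∞) = 1 + 1 := by norm_num
  have hd1 : ContDiffOn ℝ 1 f1 s := by
    rw [show (1 : WithTop ℕ∞) = 0 + 1 by norm_num, contDiffOn_succ_iff_deriv_of_isOpen hs]
    refine ⟨fun r hr => (h2 r hr).differentiableAt.differentiableWithinAt, by simp, ?_⟩
    rw [contDiffOn_zero]
    exact h3.congr fun r hr => (h2 r hr).deriv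
  rw [e, contDiffOn_succ_iff_deriv_of_isOpen hs]
  refine ⟨fun r hr => (h1 r hr).differentiableAt.differentiableWithinAt, by simp, ?_⟩
  exact hd1.congr fun r hr => (h1 r hr).deriv

namespace RadialProfile

variable {N p q : ℝ} {u v u1 v1 : ℝ → ℝ}

theorem symm (P : RadialProfile N p q u v u1 v1) : RadialProfile N q p v u v1 u1 :=
  ⟨P.two_lt, P.q_pos, P.p_pos, P.v_pos, P.u_pos, P.hv, P.hu, P.v1_cont, P.u1_cont, P.v1_zero,
    P.u1_zero, P.hv1, P.hu1, P.v_lim, P.u_lim⟩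

theorem u_cont (P : RadialProfile N p q u v u1 v1) : Continuous u :=
  continuous_iff_continuousAt.2 fun r => (P.hu r).continuousAt

theorem v_cont (P : RadialProfile N p q u v u1 v1) : Continuous v := P.symm.u_cont

theorem hasDerivAt_flux (P : RadialProfile N p q u v u1 v1) {r : ℝ} (hr : 0 < r) :
    HasDerivAt (fun x => x ^ (N - 1) * u1 x) (-(r ^ (N - 1) * v r ^ p)) r :=
  ((P.hu1 r hr).rpow_mul (N - 1) hr).congr_deriv (by ring)

theorem hasDerivAt_v_rpow (P : RadialProfile N p q u v u1 v1) (s r : ℝ) :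
    HasDerivAt (fun x => v x ^ s) (s * v r ^ (s - 1) * v1 r) r :=
  ((P.hv r).rpow_const (p := s) (Or.inl (P.v_pos r).ne')).congr_deriv (by ring)

theorem u1_neg (P : RadialProfile N p q u v u1 v1) {r : ℝ} (hr : 0 < r) : u1 r < 0 := by
  have hN := P.two_lt
  have hanti : StrictAntiOn (fun x => x ^ (N - 1) * u1 x) (Set.Ici 0) := by
    refine strictAntiOn_of_deriv_neg (convex_Ici 0) ?_ ?_
    · exact ((Real.continuous_rpow_const (by linarith)).mul P.u1_cont).continuousOn
    · intro x hx
      rw [interior_Ici, Set.mem_Ioi] at hx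
      rw [(P.hasDerivAt_flux hx).deriv]
      have := P.v_pos x
      have : 0 < x ^ (N - 1) * v x ^ p := by positivity
      linarith
  have h := hanti Set.self_mem_Ici (Set.mem_Ici.2 hr.le) hr
  simp only [P.u1_zero, mul_zero] at h
  have : 0 < r ^ (N - 1) := by positivity
  by_contra! hc
  nlinarith [mul_nonneg this.le hc]

theorem v1_neg (P : RadialProfile N p q u v u1 v1) {r : ℝ} (hr : 0 < r) : v1 r < 0 :=
  P.symm.u1_neg hr

/-- Strict lower bound for the slope. -/
theorem slope_lower (P : RadialProfile N p q u v u1 v1) {r : ℝ} (hr : 0 < r) :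
    r * v r ^ p / N < - u1 r := by
  have hN := P.two_lt
  have hd : ∀ x, 0 < x → HasDerivAt (fun x => x ^ (N - 1) * (u1 x + x * v x ^ p / N))
      (x ^ (N - 1) * (x * (p * v x ^ (p - 1) * v1 x) / N)) x := by
    intro x hx
    have h1 := (P.hu1 x hx).add (((hasDerivAt_id x).mul (P.hasDerivAt_v_rpow p x)).div_const N)
    have h2 := h1.rpow_mul (N - 1) hx
    refine h2.congr_deriv ?_
    simp
    left
    field_simp
    ring
  have hanti : StrictAntiOn (fun x => x ^ (N - 1) * (u1 x + x * v x ^ p / N)) (Set.Ici 0) := by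
    refine strictAntiOn_of_deriv_neg (convex_Ici 0) ?_ ?_
    · refine ((Real.continuous_rpow_const (by linarith)).mul ?_).continuousOn
      exact P.u1_cont.add ((continuous_id.mul
        (P.v_cont.rpow_const fun x => Or.inl (P.v_pos x).ne')).div_const _)
    · intro x hx
      rw [interior_Ici, Set.mem_Ioi] at hx
      rw [(hd x hx).deriv]
      have := P.v_pos x
      have h1 := P.v1_neg hx
      have h2 := P.p_pos
      have h3 : 0 < x ^ (N - 1) * (x * (p * v x ^ (p - 1) * (-v1 x)) / N) := by
        have : 0 < -v1 x := by linarith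
        positivity
      have h4 : x ^ (N - 1) * (x * (p * v x ^ (p - 1) * (-v1 x)) / N) =
        -(x ^ (N - 1) * (x * (p * v x ^ (p - 1) * v1 x) / N)) := by ring
      linarith
  have h := hanti Set.self_mem_Ici (Set.mem_Ici.2 hr.le) hr
  simp only [P.u1_zero, zero_mul, zero_div, add_zero, mul_zero] at h
  have : 0 < r ^ (N - 1) := by positivity
  by_contra! hc
  have hc' : 0 ≤ u1 r + r * v r ^ p / N := by linarith
  nlinarith [mul_nonneg this.le hc']

theorem neg_u1_le (P : RadialProfile N p q u v u1 v1) {r : ℝ} (hr : 0 < r) :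
    -(r * u1 r) ≤ (N - 2) * u r := by
  have hN := P.two_lt
  by_contra! hc
  set c := -(r * u1 r) - (N - 2) * u r with hcdef
  have hcpos : 0 < c := by linarith
  have hd : ∀ x, 0 < x → HasDerivAt (fun x => (N - 2) * u x + x * u1 x) (-(x * v x ^ p)) x := by
    intro x hx
    have h1 := ((P.hu x).const_mul (N - 2)).add ((hasDerivAt_id x).mul (P.hu1 x hx))
    refine h1.congr_deriv ?_
    simp
    field_simp
    ring
  have hanti : AntitoneOn (fun x => (N - 2) * u x + x * u1 x) (Set.Ici r) := by
    refine antitoneOn_of_deriv_nonpos (convex_Ici r) ?_ ?_ ?_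
    · exact ((continuous_const.mul P.u_cont).add (continuous_id.mul P.u1_cont)).continuousOn
    · intro x hx
      rw [interior_Ici, Set.mem_Ioi] at hx
      exact (hd x (hr.trans hx)).differentiableAt.differentiableWithinAt
    · intro x hx
      rw [interior_Ici, Set.mem_Ioi] at hx
      have hx0 := hr.trans hx
      rw [(hd x hx0).deriv]
      have := P.v_pos x
      have : 0 < x * v x ^ p := by positivity
      linarith
  have hanti2 : AntitoneOn (fun x => u x + c * Real.log x) (Set.Ici r) := by
    have hd2 : ∀ x, 0 < x → HasDerivAt (fun x => u x + c * Real.log x) (u1 x + c * x⁻¹) x :=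
      fun x hx => (P.hu x).add ((Real.hasDerivAt_log hx.ne').const_mul c)
    refine antitoneOn_of_deriv_nonpos (convex_Ici r) ?_ ?_ ?_
    · intro x hx
      exact (hd2 x (hr.trans_le hx)).continuousAt.continuousWithinAt
    · intro x hx
      rw [interior_Ici, Set.mem_Ioi] at hx
      exact (hd2 x (hr.trans hx)).differentiableAt.differentiableWithinAt
    · intro x hx
      rw [interior_Ici, Set.mem_Ioi] at hx
      have hx0 := hr.trans hx
      rw [(hd2 x hx0).deriv]
      have h1 := hanti Set.self_mem_Ici (Set.mem_Ici.2 hx.le) hx.le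
      simp only at h1
      have h2 := P.u_pos x
      have h3 : x * u1 x + c ≤ 0 := by nlinarith
      have h4 : u1 x + c * x⁻¹ = (x * u1 x + c) / x := by field_simp
      rw [h4]
      exact div_nonpos_of_nonpos_of_nonneg h3 hx0.le
  have hlog : Tendsto (fun x => c * Real.log x) atTop atTop :=
    Real.tendsto_log_atTop.const_mul_atTop hcpos
  obtain ⟨x, hx1, hx2⟩ := ((hlog.eventually_gt_atTop (u r + c * Real.log r)).and
    (eventually_ge_atTop r)).exists
  have h5 := hanti2 Set.self_mem_Ici (Set.mem_Ici.2 hx2) hx2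
  simp only at h5
  linarith [P.u_pos x]

theorem monotoneOn_rpow_mul_u (P : RadialProfile N p q u v u1 v1) :
    MonotoneOn (fun r => r ^ (N - 2) * u r) (Set.Ioi 0) := by
  have hd : ∀ x, 0 < x → HasDerivAt (fun r => r ^ (N - 2) * u r)
      (x ^ (N - 2) * (u1 x + (N - 2) / x * u x)) x := fun x hx => (P.hu x).rpow_mul _ hx
  refine monotoneOn_of_deriv_nonneg (convex_Ioi 0) ?_ ?_ ?_
  · exact fun x hx => (hd x hx).continuousAt.continuousWithinAt
  · intro x hx
    rw [interior_Ioi] at hx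
    exact (hd x hx).differentiableAt.differentiableWithinAt
  · intro x hx
    rw [interior_Ioi, Set.mem_Ioi] at hx
    rw [(hd x hx).deriv]
    have h1 := P.neg_u1_le hx
    have h2 : u1 x + (N - 2) / x * u x = (x * u1 x + (N - 2) * u x) / x := by field_simp
    rw [h2]
    have : 0 ≤ (x * u1 x + (N - 2) * u x) / x := div_nonneg (by linarith) hx.le
    positivity

theorem rpow_le_u (P : RadialProfile N p q u v u1 v1) {r : ℝ} (hr : 1 ≤ r) :
    u 1 * r ^ (-(N - 2)) ≤ u r := by
  have h := P.monotoneOn_rpow_mul_u (Set.mem_Ioi.2 one_pos) (Set.mem_Ioi.2 (one_pos.trans_le hr)) hr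
  simp only [Real.one_rpow, one_mul] at h
  have hr0 : 0 < r := one_pos.trans_le hr
  rw [Real.rpow_neg hr0.le]
  have : 0 < r ^ (N - 2) := by positivity
  rw [← div_eq_mul_inv, div_le_iff₀ this]
  linarith

theorem sq_mul_v_rpow_le (P : RadialProfile N p q u v u1 v1) {r : ℝ} (hr : 0 < r) :
    r ^ 2 * v r ^ p ≤ N * (N - 2) * u r := by
  have h1 := P.slope_lower hr
  have h2 := P.neg_u1_le hr
  have hN := P.two_lt
  have hN0 : 0 < N := by linarith
  rw [div_lt_iff₀ hN0] at h1
  nlinarith [mul_lt_mul_of_pos_left h1 hr]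

theorem strictAntiOn_u (P : RadialProfile N p q u v u1 v1) : StrictAntiOn u (Set.Ici 0) := by
  refine strictAntiOn_of_deriv_neg (convex_Ici 0) P.u_cont.continuousOn ?_
  intro x hx
  rw [interior_Ici, Set.mem_Ioi] at hx
  rw [(P.hu x).deriv]
  exact P.u1_neg hx

theorem u_le (P : RadialProfile N p q u v u1 v1) {r : ℝ} (hr : 0 ≤ r) : u r ≤ u 0 :=
  P.strictAntiOn_u.antitoneOn Set.self_mem_Ici hr hr

/-- The function `h = -u1 / r`. -/
theorem hasDerivAt_h (P : RadialProfile N p q u v u1 v1) {r : ℝ} (hr : 0 < r) :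
    HasDerivAt (fun x => -u1 x / x) ((N * u1 r / r + v r ^ p) / r) r := by
  refine ((P.hu1 r hr).neg.div (hasDerivAt_id r) hr.ne').congr_deriv ?_
  simp
  field_simp
  ring

theorem hasDerivAt_h1 (P : RadialProfile N p q u v u1 v1) {r : ℝ} (hr : 0 < r) :
    HasDerivAt (fun x => (N * u1 x / x + v x ^ p) / x)
      (-((N + 1) / r * ((N * u1 r / r + v r ^ p) / r)) -
        p * v r ^ (p - 1) * (-v1 r / r)) r := by
  refine (((((P.hu1 r hr).const_mul N).div (hasDerivAt_id r) hr.ne').add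
    (P.hasDerivAt_v_rpow p r)).div (hasDerivAt_id r) hr.ne').congr_deriv ?_
  simp
  field_simp
  ring

theorem h_pos (P : RadialProfile N p q u v u1 v1) {r : ℝ} (hr : 0 < r) : 0 < -u1 r / r :=
  div_pos (neg_pos.2 (P.u1_neg hr)) hr

theorem h_lower (P : RadialProfile N p q u v u1 v1) {r : ℝ} (hr : 0 < r) :
    v r ^ p / N < -u1 r / r := by
  rw [lt_div_iff₀ hr]
  have := P.slope_lower hr
  calc v r ^ p / N * r = r * v r ^ p / N := by ring
    _ < _ := this

theorem h1_neg (P : RadialProfile N p q u v u1 v1) {r : ℝ} (hr : 0 < r) :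
    (N * u1 r / r + v r ^ p) / r < 0 := by
  refine div_neg_of_neg_of_pos ?_ hr
  have := P.h_lower hr
  have hN : 0 < N := by linarith [P.two_lt]
  rw [div_lt_iff₀ hN] at this
  have h2 : N * u1 r / r = -(-u1 r / r * N) := by ring
  rw [h2]
  linarith

theorem contDiffOn_h (P : RadialProfile N p q u v u1 v1) :
    ContDiffOn ℝ 2 (fun x => -u1 x / x) (Set.Ioi 0) := by
  refine contDiffOn_two_of_hasDerivAt isOpen_Ioi (fun r hr => P.hasDerivAt_h hr)
    (fun r hr => P.hasDerivAt_h1 hr) ?_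
  have h0 : ∀ x ∈ Set.Ioi (0:ℝ), x ≠ 0 := fun x hx => ne_of_gt hx
  have c1 := P.u1_cont.continuousOn (s := Set.Ioi 0)
  have c2 := P.v1_cont.continuousOn (s := Set.Ioi 0)
  have c3 : ∀ s : ℝ, ContinuousOn (fun r => v r ^ s) (Set.Ioi 0) := fun s =>
    (P.v_cont.rpow_const fun x => Or.inl (P.v_pos x).ne').continuousOn
  have c4 := c3 p
  have c5 := c3 (p - 1)
  fun_prop (disch := assumption)

end RadialProfile

section RadialFunctions

variable {n : ℕ} {f : EuclideanSpace ℝ (Fin n) → ℝ} {e : EuclideanSpace ℝ (Fin n)}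

theorem contDiff_line {k : WithTop ℕ∞} (hf : ContDiff ℝ k f) (e : EuclideanSpace ℝ (Fin n)) :
    ContDiff ℝ k (fun r : ℝ => f (r • e)) :=
  hf.comp (contDiff_id.smul contDiff_const)

theorem ContDiff.hasDerivAt_deriv {F : ℝ → ℝ} (hF : ContDiff ℝ 2 F) (r : ℝ) :
    HasDerivAt F (deriv F r) r :=
  (hF.differentiable (by simp) r).hasDerivAt

theorem ContDiff.contDiff_deriv_one {F : ℝ → ℝ} (hF : ContDiff ℝ 2 F) :
    ContDiff ℝ 1 (deriv F) := by
  rw [show (2 : WithTop ℕ∞) = 1 + 1 by norm_num, contDiff_succ_iff_deriv] at hF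
  exact hF.2.2

theorem ContDiff.hasDerivAt_deriv_deriv {F : ℝ → ℝ} (hF : ContDiff ℝ 2 F) (r : ℝ) :
    HasDerivAt (deriv F) (deriv (deriv F) r) r :=
  (hF.contDiff_deriv_one.differentiable (by simp) r).hasDerivAt

theorem radial_eq_profile (hr : ∀ x y, ‖x‖ = ‖y‖ → f x = f y) (he : ‖e‖ = 1)
    (x : EuclideanSpace ℝ (Fin n)) : f x = f (‖x‖ • e) :=
  hr _ _ (by simp [norm_smul, he])

theorem deriv_profile_zero (hr : ∀ x y, ‖x‖ = ‖y‖ → f x = f y)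
    (e : EuclideanSpace ℝ (Fin n)) :
    deriv (fun r : ℝ => f (r • e)) 0 = 0 := by
  have h1 : (fun r : ℝ => f (r • e)) = fun r => (fun r : ℝ => f (r • e)) (-r) := by
    funext r; exact hr _ _ (by simp [norm_smul])
  have h2 := congrArg (fun g => deriv g 0) h1
  simp only [deriv_comp_neg (f := fun r : ℝ => f (r • e)), neg_zero] at h2
  linarith

theorem lap_profile (hf : ContDiff ℝ 2 f) (hr : ∀ x y, ‖x‖ = ‖y‖ → f x = f y) (he : ‖e‖ = 1)
    {r : ℝ} (hr0 : 0 < r) :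
    lap f (r • e) = deriv (deriv fun r : ℝ => f (r • e)) r +
      (n - 1) / r * deriv (fun r : ℝ => f (r • e)) r := by
  have hF := contDiff_line hf e
  have hnorm : ‖r • e‖ = r := by simp [norm_smul, he, abs_of_pos hr0]
  have h0 : r • e ≠ 0 := by rw [← norm_pos_iff, hnorm]; exact hr0
  have h := lap_radial (n := n) h0 (H := fun r : ℝ => f (r • e)) (Eventually.of_forall hF.hasDerivAt_deriv)
    (hF.hasDerivAt_deriv_deriv _)
  rw [hnorm] at h
  rw [← h]
  congr 1
  funext x
  exact radial_eq_profile hr he x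

theorem tendsto_smul_cocompact (he : ‖e‖ = 1) :
    Tendsto (fun r : ℝ => r • e) atTop (cocompact _) := by
  rw [← Metric.cobounded_eq_cocompact, ← tendsto_norm_atTop_iff_cobounded]
  refine tendsto_id.congr' ?_
  filter_upwards [eventually_ge_atTop 0] with r hr
  simp [norm_smul, he, abs_of_nonneg hr]

end RadialFunctions

theorem IsGroundState.radialProfile {n : ℕ} {p q : ℝ} {U V : EuclideanSpace ℝ (Fin n) → ℝ}
    (G : IsGroundState n p q U V) (hn : 5 ≤ n) (hp : 0 < p) (hq : 0 < q)
    {e : EuclideanSpace ℝ (Fin n)} (he : ‖e‖ = 1) :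
    RadialProfile n p q (fun r => U (r • e)) (fun r => V (r • e))
      (deriv fun r => U (r • e)) (deriv fun r => V (r • e)) := by
  obtain ⟨hU, hV, Upos, Vpos, eU, eV, dU, dV, lU, lV, -⟩ := G
  have rU : ∀ x y, ‖x‖ = ‖y‖ → U x = U y := fun x y h =>
    le_antisymm (dU _ _ h.ge) (dU _ _ h.le)
  have rV : ∀ x y, ‖x‖ = ‖y‖ → V x = V y := fun x y h =>
    le_antisymm (dV _ _ h.ge) (dV _ _ h.le)
  have hl := tendsto_smul_cocompact he
  have cU := contDiff_line hU e
  have cV := contDiff_line hV e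
  refine ⟨?_, hp, hq, fun r => Upos _, fun r => Vpos _, cU.hasDerivAt_deriv, cV.hasDerivAt_deriv,
    cU.contDiff_deriv_one.continuous, cV.contDiff_deriv_one.continuous,
    deriv_profile_zero rU e, deriv_profile_zero rV e, ?_, ?_, lU.comp hl, lV.comp hl⟩
  · have : (5:ℝ) ≤ n := by exact_mod_cast hn
    linarith
  · intro r hr
    refine (cU.hasDerivAt_deriv_deriv r).congr_deriv ?_
    have h1 := lap_profile hU rU he hr
    have h2 := eU (r • e)
    linarith
  · intro r hr
    refine (cV.hasDerivAt_deriv_deriv r).congr_deriv ?_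
    have h1 := lap_profile hV rV he hr
    have h2 := eV (r • e)
    linarith

theorem nonpos_of_deriv_le_mul {w w' : ℝ → ℝ} {a b k : ℝ}
    (hw : ∀ t ∈ Set.Icc a b, HasDerivAt w (w' t) t) (hle : ∀ t ∈ Set.Icc a b, w' t ≤ k * w t)
    (ha : w a ≤ 0) : ∀ t ∈ Set.Icc a b, w t ≤ 0 := by
  intro t ht
  have hd : ∀ s ∈ Set.Icc a b, HasDerivAt (fun s => Real.exp (-k * s) * w s)
      (Real.exp (-k * s) * (w' s - k * w s)) s := by
    intro s hs
    have h1 : HasDerivAt (fun s : ℝ => Real.exp (-k * s)) (Real.exp (-k * s) * (-k * 1)) s :=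
      ((hasDerivAt_id s).const_mul (-k)).exp
    exact (h1.mul (hw s hs)).congr_deriv (by ring)
  have hanti : AntitoneOn (fun s => Real.exp (-k * s) * w s) (Set.Icc a b) := by
    refine antitoneOn_of_deriv_nonpos (convex_Icc a b)
      (fun s hs => (hd s hs).continuousAt.continuousWithinAt) ?_ ?_
    · intro s hs
      exact (hd s (interior_subset hs)).differentiableAt.differentiableWithinAt
    · intro s hs
      rw [(hd s (interior_subset hs)).deriv]
      exact mul_nonpos_of_nonneg_of_nonpos (Real.exp_pos _).le
        (by linarith [hle s (interior_subset hs)])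
  have h := hanti (Set.left_mem_Icc.2 (ht.1.trans ht.2)) ht ht.1
  simp only at h
  have h1 : Real.exp (-k * a) * w a ≤ 0 :=
    mul_nonpos_of_nonneg_of_nonpos (Real.exp_pos _).le ha
  by_contra! hc
  have := mul_pos (Real.exp_pos (-k * t)) hc
  linarith

theorem second_order_nonpos {z z1 g : ℝ → ℝ} {a b l m : ℝ}
    (hz : ∀ t ∈ Set.Icc a b, HasDerivAt z (z1 t) t)
    (hz1 : ∀ t ∈ Set.Icc a b, HasDerivAt z1 ((l - m) * z1 t + l * m * z t - g t) t)
    (hg : ∀ t ∈ Set.Icc a b, 0 ≤ g t) (ha : z a = 0) (ha1 : z1 a ≤ 0) :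
    ∀ t ∈ Set.Icc a b, z t ≤ 0 := by
  have h1 : ∀ t ∈ Set.Icc a b, z1 t - l * z t ≤ 0 := by
    refine nonpos_of_deriv_le_mul (k := -m)
      (fun t ht => (hz1 t ht).sub ((hz t ht).const_mul l)) ?_ (by rw [ha]; linarith)
    intro t ht
    have := hg t ht
    nlinarith
  exact nonpos_of_deriv_le_mul (k := l) hz (fun t ht => by linarith [h1 t ht]) ha.le

theorem exists_seq_deriv_tendsto_zero_of_bounded {f f' : ℝ → ℝ} {M : ℝ} (hf : ∀ t, HasDerivAt f (f' t) t)
    (hM : ∀ t, |f t| ≤ M) : ∃ ξ : ℕ → ℝ, Tendsto ξ atTop atTop ∧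
      Tendsto (fun k => f' (ξ k)) atTop (𝓝 0) := by
  have h : ∀ k : ℕ, ∃ ξ : ℝ, (k : ℝ) + 1 ≤ ξ ∧ |f' ξ| ≤ 2 * M / ((k : ℝ) + 1) := by
    intro k
    have hk : (0:ℝ) < (k:ℝ) + 1 := by positivity
    obtain ⟨ξ, hξ, hξ'⟩ := exists_hasDerivAt_eq_slope f f' (a := (k:ℝ) + 1) (b := 2 * ((k:ℝ) + 1))
      (by linarith) (fun t _ => (hf t).continuousAt.continuousWithinAt) (fun t _ => hf t)
    refine ⟨ξ, hξ.1.le, ?_⟩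
    rw [hξ', show 2 * ((k:ℝ) + 1) - ((k:ℝ) + 1) = (k:ℝ) + 1 by ring, abs_div, abs_of_pos hk]
    gcongr
    have := abs_sub (f (2 * ((k:ℝ) + 1))) (f ((k:ℝ) + 1))
    linarith [hM (2 * ((k:ℝ) + 1)), hM ((k:ℝ) + 1)]
  choose ξ h1 h2 using h
  have hk : Tendsto (fun k : ℕ => (k:ℝ) + 1) atTop atTop :=
    tendsto_atTop_add_const_right _ _ tendsto_natCast_atTop_atTop
  refine ⟨ξ, tendsto_atTop_mono h1 hk, ?_⟩
  exact squeeze_zero_norm h2 (Tendsto.const_div_atTop hk _)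

/-- A trapping argument for the Emden-Fowler system. -/
theorem trapping_false {x x1 y y1 : ℝ → ℝ} {l m l' m' c p q t1 M : ℝ} (hp : 0 < p) (hq : 0 < q)
    (hc : 0 < c) (hlm : l * m = c) (hlm' : l' * m' = c)
    (xpos : ∀ t, 0 < x t) (ypos : ∀ t, 0 < y t)
    (hx : ∀ t, HasDerivAt x (x1 t) t) (hy : ∀ t, HasDerivAt y (y1 t) t)
    (hx1 : ∀ t, HasDerivAt x1 ((l - m) * x1 t + c * x t - y t ^ p) t)
    (hy1 : ∀ t, HasDerivAt y1 ((l' - m') * y1 t + c * y t - x t ^ q) t)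
    (hMy : ∀ t, |y t| ≤ M) (hMy1 : ∀ t, |y1 t| ≤ M)
    (h0 : x1 t1 = 0) (h1 : y1 t1 ≤ 0) (h2 : y t1 ^ p ≤ c * x t1) (h3 : c * y t1 < x t1 ^ q) :
    False := by
  have key : ∀ T, (∀ t ∈ Set.Icc t1 T, c * y t1 ≤ x t ^ q) →
      ∀ t ∈ Set.Icc t1 T, y t ≤ y t1 ∧ x t1 ≤ x t := by
    intro T hT
    have hy' : ∀ t ∈ Set.Icc t1 T, y t - y t1 ≤ 0 := by
      refine second_order_nonpos (z1 := y1) (g := fun t => x t ^ q - c * y t1) (l := l') (m := m')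
        (fun t _ => (hy t).sub_const _) (fun t _ => (hy1 t).congr_deriv ?_)
        (fun t ht => by simpa using hT t ht) (by simp) h1
      rw [hlm']; ring
    have hx' : ∀ t ∈ Set.Icc t1 T, x t1 - x t ≤ 0 := by
      refine second_order_nonpos (z1 := fun t => -x1 t) (g := fun t => c * x t1 - y t ^ p)
        (l := l) (m := m)
        (fun t _ => (hx t).const_sub _) (fun t _ => (hx1 t).neg.congr_deriv ?_)
        (fun t ht => ?_) (by simp) (by simp [h0])
      · rw [hlm]; ring
      · have : y t ^ p ≤ y t1 ^ p :=
          Real.rpow_le_rpow (ypos t).le (by linarith [hy' t ht]) hp.le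
        linarith
    exact fun t ht => ⟨by linarith [hy' t ht], by linarith [hx' t ht]⟩
  have xcont : Continuous x := continuous_iff_continuousAt.2 fun t => (hx t).continuousAt
  have hall : ∀ t, t1 ≤ t → c * y t1 < x t ^ q := by
    by_contra! hcon
    obtain ⟨T, hT1, hT2⟩ := hcon
    set S := {t | t1 ≤ t ∧ x t ^ q ≤ c * y t1} with hS
    have hclosed : IsClosed S := by
      have : IsClosed {t | t1 ≤ t} := isClosed_Ici
      have h' : IsClosed {t | x t ^ q ≤ c * y t1} :=
        isClosed_le (xcont.rpow_const fun t => Or.inl (xpos t).ne') continuous_const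
      exact this.inter h'
    have hbdd : BddBelow S := ⟨t1, fun t ht => ht.1⟩
    have hmem : sInf S ∈ S := hclosed.csInf_mem ⟨T, hT1, hT2⟩ hbdd
    have hlt : ∀ t ∈ Set.Ico t1 (sInf S), c * y t1 ≤ x t ^ q := by
      intro t ht
      by_contra! hh
      exact absurd (csInf_le hbdd (show t ∈ S from ⟨ht.1, hh.le⟩)) (not_le.2 ht.2)
    have hne : t1 ≠ sInf S := by
      intro h
      rw [← h] at hmem
      exact absurd hmem.2 (not_le.2 h3)
    have hlt1 : t1 < sInf S := lt_of_le_of_ne hmem.1 hne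
    have hle : ∀ t ∈ Set.Icc t1 (sInf S), c * y t1 ≤ x t ^ q := by
      have hcl : Set.Icc t1 (sInf S) ⊆ closure (Set.Ico t1 (sInf S)) := by
        rw [closure_Ico hlt1.ne]
      intro t ht
      have hc2 : IsClosed {t | c * y t1 ≤ x t ^ q} :=
        isClosed_le continuous_const (xcont.rpow_const fun t => Or.inl (xpos t).ne')
      exact closure_minimal hlt hc2 (hcl ht)
    have h5 := (key _ hle (sInf S) ⟨hmem.1, le_rfl⟩).2
    have h6 := Real.rpow_le_rpow (xpos t1).le h5 hq.le
    linarith [hmem.2]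
  have hforever : ∀ t, t1 ≤ t → y t ≤ y t1 ∧ x t1 ≤ x t := fun t ht =>
    key t (fun s hs => (hall s hs.1).le) t ⟨ht, le_rfl⟩
  set d := x t1 ^ q - c * y t1 with hd
  have hdpos : 0 < d := by linarith
  have hanti : AntitoneOn (fun t => y1 t - (l' - m') * y t + d * t) (Set.Ici t1) := by
    have hder : ∀ t, HasDerivAt (fun t => y1 t - (l' - m') * y t + d * t)
        (c * y t - x t ^ q + d) t := fun t =>
      (((hy1 t).sub ((hy t).const_mul (l' - m'))).add ((hasDerivAt_id t).const_mul d)).congr_deriv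
        (by ring)
    refine antitoneOn_of_deriv_nonpos (convex_Ici t1)
      (fun s _ => (hder s).continuousAt.continuousWithinAt)
      (fun s _ => (hder s).differentiableAt.differentiableWithinAt) ?_
    intro s hs
    rw [interior_Ici, Set.mem_Ioi] at hs
    rw [(hder s).deriv]
    obtain ⟨h7, h8⟩ := hforever s hs.le
    have h9 := Real.rpow_le_rpow (xpos t1).le h8 hq.le
    nlinarith
  set C := y1 t1 - (l' - m') * y t1 + d * t1 with hC
  have hb : ∀ t, |y1 t - (l' - m') * y t| ≤ M + |l' - m'| * M := by
    intro t
    refine (abs_sub _ _).trans (add_le_add (hMy1 t) ?_)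
    rw [abs_mul]
    exact mul_le_mul_of_nonneg_left (hMy t) (abs_nonneg _)
  have htop : Tendsto (fun t => d * t) atTop atTop := tendsto_id.const_mul_atTop hdpos
  obtain ⟨t, ht, ht'⟩ := ((htop.eventually_gt_atTop (C + (M + |l' - m'| * M))).and
    (eventually_ge_atTop t1)).exists
  have h10 := hanti Set.self_mem_Ici (Set.mem_Ici.2 ht') ht'
  simp only at h10
  have h11 := (abs_le.1 (hb t)).1
  linarith

/-- A bounded positive zero energy solution of the Emden-Fowler form of the system. -/
structure EmdenFowler (α β p q : ℝ) (x y x1 y1 : ℝ → ℝ) : Prop where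
  α_pos : 0 < α
  β_pos : 0 < β
  p_pos : 0 < p
  q_pos : 0 < q
  one_lt : 1 < p * q
  x_pos : ∀ t, 0 < x t
  y_pos : ∀ t, 0 < y t
  hx : ∀ t, HasDerivAt x (x1 t) t
  hy : ∀ t, HasDerivAt y (y1 t) t
  hx1 : ∀ t, HasDerivAt x1 ((α - β) * x1 t + α * β * x t - y t ^ p) t
  hy1 : ∀ t, HasDerivAt y1 ((β - α) * y1 t + α * β * y t - x t ^ q) t
  energy : ∀ t, x1 t * y1 t - α * β * (x t * y t) + x t ^ (q + 1) / (q + 1) +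
    y t ^ (p + 1) / (p + 1) = 0
  bdd : ∃ M, ∀ t, |x t| ≤ M ∧ |y t| ≤ M ∧ |x1 t| ≤ M ∧ |y1 t| ≤ M

namespace EmdenFowler

variable {α β p q : ℝ} {x y x1 y1 : ℝ → ℝ}

theorem symm (S : EmdenFowler α β p q x y x1 y1) : EmdenFowler β α q p y x y1 x1 := by
  obtain ⟨M, hM⟩ := S.bdd
  refine ⟨S.β_pos, S.α_pos, S.q_pos, S.p_pos, by linarith [S.one_lt, mul_comm p q], S.y_pos,
    S.x_pos, S.hy, S.hx, fun t => ?_, fun t => ?_, fun t => ?_,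
    ⟨M, fun t => ⟨(hM t).2.1, (hM t).1, (hM t).2.2.2, (hM t).2.2.1⟩⟩⟩
  · exact (S.hy1 t).congr_deriv (by ring)
  · exact (S.hx1 t).congr_deriv (by ring)
  · linarith [S.energy t, mul_comm (x1 t) (y1 t), mul_comm (x t) (y t), mul_comm α β,
      congrArg₂ (· * ·) (mul_comm α β) (mul_comm (x t) (y t))]

theorem strictly_concave_at_critical (S : EmdenFowler α β p q x y x1 y1) {t1 : ℝ}
    (h0 : x1 t1 = 0) : α * β * x t1 - y t1 ^ p < 0 := by
  by_contra! hcon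
  have hα := S.α_pos
  have hβ := S.β_pos
  have hp := S.p_pos
  have hq := S.q_pos
  have hx := S.x_pos t1
  have hy := S.y_pos t1
  have h1 := S.energy t1
  have hpq := S.one_lt
  obtain ⟨M, hM⟩ := S.bdd
  have hyp : y t1 ^ p ≤ α * β * x t1 := by linarith
  have h3 : α * β * y t1 < x t1 ^ q := by
    rw [h0, zero_mul, Real.rpow_add_one hx.ne', Real.rpow_add_one hy.ne'] at h1
    have e1 : y t1 ^ p * y t1 / (p + 1) ≤ α * β * x t1 * y t1 / (p + 1) := by gcongr
    have e2 : α * β * (x t1 * y t1) ≤ x t1 ^ q * x t1 / (q + 1) + α * β * x t1 * y t1 / (p + 1) := by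
      linarith
    have e3 : α * β * y t1 ≤ x t1 ^ q / (q + 1) + α * β * y t1 / (p + 1) := by
      have : (α * β * y t1) * x t1 ≤ (x t1 ^ q / (q + 1) + α * β * y t1 / (p + 1)) * x t1 := by
        calc _ = α * β * (x t1 * y t1) := by ring
          _ ≤ _ := e2
          _ = _ := by ring
      exact le_of_mul_le_mul_right this hx
    have hX : 0 < x t1 ^ q := by positivity
    have hY : 0 < α * β * y t1 := by positivity
    have e4 : α * β * y t1 * (p / (p + 1)) ≤ x t1 ^ q / (q + 1) := by
      have : α * β * y t1 * (p / (p + 1)) = α * β * y t1 - α * β * y t1 / (p + 1) := by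
        field_simp; ring
      linarith
    rw [mul_div_assoc', div_le_div_iff₀ (by linarith) (by linarith)] at e4
    by_contra! hc
    nlinarith [mul_le_mul_of_nonneg_right hc (show 0 ≤ p + 1 by linarith)]
  rcases le_total (y1 t1) 0 with hy1 | hy1
  · exact trapping_false (l := α) (m := β) (l' := β) (m' := α) (c := α * β) hp hq (by positivity)
      rfl (mul_comm _ _) S.x_pos S.y_pos S.hx S.hy S.hx1 S.hy1 (fun t => (hM t).2.1)
      (fun t => (hM t).2.2.2) h0 hy1 hyp h3
  · have rev : ∀ {f : ℝ → ℝ} {f' t : ℝ}, HasDerivAt f f' (-t) →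
        HasDerivAt (fun s => f (-s)) (-f') t := by
      intro f f' t h
      exact (h.comp t (hasDerivAt_neg t)).congr_deriv (by ring)
    refine trapping_false (x := fun s => x (-s)) (y := fun s => y (-s)) (x1 := fun s => -x1 (-s))
      (y1 := fun s => -y1 (-s)) (t1 := -t1)
      (l := β) (m := α) (l' := α) (m' := β) (c := α * β) hp hq (by positivity)
      (mul_comm _ _) rfl (fun t => S.x_pos _) (fun t => S.y_pos _)
      (fun t => rev (S.hx _)) (fun t => rev (S.hy _))
      (fun t => ((rev (S.hx1 _)).neg).congr_deriv (by ring))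
      (fun t => ((rev (S.hy1 _)).neg).congr_deriv (by ring)) (fun t => (hM _).2.1)
      (fun t => by rw [abs_neg]; exact (hM _).2.2.2) (by simp [h0]) (by simpa using hy1)
      (by simpa using hyp) (by simpa using h3)

theorem exists_limit (S : EmdenFowler α β p q x y x1 y1) : ∃ L, Tendsto x atTop (𝓝 L) := by
  obtain ⟨M, hM⟩ := S.bdd
  by_cases hall : ∀ t, 0 < x1 t
  · have hmono : Monotone x := monotone_of_deriv_nonneg (fun t => (S.hx t).differentiableAt)
      (fun t => by rw [(S.hx t).deriv]; exact (hall t).le)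
    exact ⟨_, tendsto_atTop_ciSup hmono ⟨M, by
      rintro _ ⟨t, rfl⟩; exact (le_abs_self _).trans (hM t).1⟩⟩
  · push Not at hall
    obtain ⟨t0, ht0⟩ := hall
    have hneg : ∀ t, t0 ≤ t → x1 t ≤ 0 := by
      intro t ht
      exact image_le_of_deriv_right_lt_deriv_boundary (B := fun _ => 0) (B' := fun _ => 0) (b := t)
        (fun s _ => (S.hx1 s).continuousAt.continuousWithinAt)
        (fun s _ => (S.hx1 s).hasDerivWithinAt) ht0 (fun s => hasDerivAt_const s 0)
        (fun s _ hs => by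
          have := S.strictly_concave_at_critical hs
          rw [hs]; linarith) ⟨ht, le_rfl⟩
    have hanti : AntitoneOn x (Set.Ici t0) :=
      antitoneOn_of_deriv_nonpos (convex_Ici t0)
        (fun s _ => (S.hx s).continuousAt.continuousWithinAt)
        (fun s _ => (S.hx s).differentiableAt.differentiableWithinAt)
        (fun s hs => by
          rw [interior_Ici, Set.mem_Ioi] at hs
          rw [(S.hx s).deriv]; exact hneg s hs.le)
    have hanti2 : Antitone (fun t => x (max t0 t)) := fun s t hst =>
      hanti (Set.mem_Ici.2 (le_max_left _ _)) (Set.mem_Ici.2 (le_max_left _ _))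
        (max_le_max le_rfl hst)
    have hlim := tendsto_atTop_ciInf hanti2 ⟨0, by
      rintro _ ⟨t, rfl⟩; exact (S.x_pos _).le⟩
    refine ⟨_, hlim.congr' ?_⟩
    filter_upwards [eventually_ge_atTop t0] with t ht
    rw [max_eq_right ht]

theorem limit_relation (S : EmdenFowler α β p q x y x1 y1) {L L' : ℝ}
    (hL : Tendsto x atTop (𝓝 L)) (hL' : Tendsto y atTop (𝓝 L')) : α * β * L = L' ^ p := by
  obtain ⟨M, hM⟩ := S.bdd
  obtain ⟨ξ, h1, h2⟩ := exists_seq_deriv_tendsto_zero_of_bounded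
    (f := fun t => x1 t - (α - β) * x t) (f' := fun t => α * β * x t - y t ^ p)
    (M := M + |α - β| * M)
    (fun t => ((S.hx1 t).sub ((S.hx t).const_mul (α - β))).congr_deriv (by ring))
    (fun t => by
      refine (abs_sub _ _).trans (add_le_add (hM t).2.2.1 ?_)
      rw [abs_mul]
      exact mul_le_mul_of_nonneg_left (hM t).1 (abs_nonneg _))
  have h3 : Tendsto (fun t => α * β * x t - y t ^ p) atTop (𝓝 (α * β * L - L' ^ p)) :=
    (hL.const_mul _).sub (hL'.rpow_const (Or.inr S.p_pos.le))
  linarith [tendsto_nhds_unique (h3.comp h1) h2]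

theorem tendsto_zero (S : EmdenFowler α β p q x y x1 y1) :
    Tendsto x atTop (𝓝 0) ∧ Tendsto y atTop (𝓝 0) := by
  obtain ⟨L, hL⟩ := S.exists_limit
  obtain ⟨L', hL'⟩ := S.symm.exists_limit
  have hL0 : 0 ≤ L := ge_of_tendsto' hL fun t => (S.x_pos t).le
  have hL0' : 0 ≤ L' := ge_of_tendsto' hL' fun t => (S.y_pos t).le
  have r1 := S.limit_relation hL hL'
  have r2 := S.symm.limit_relation hL' hL
  have hα := S.α_pos
  have hβ := S.β_pos
  have hp := S.p_pos
  have hq := S.q_pos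
  obtain ⟨M, hM⟩ := S.bdd
  obtain ⟨ξ, h1, h2⟩ := exists_seq_deriv_tendsto_zero_of_bounded S.hx (fun t => (hM t).1)
  have h3 : Tendsto (fun k => x1 (ξ k) * y1 (ξ k)) atTop (𝓝 0) :=
    h2.zero_mul_isBoundedUnder_le ⟨M, by
      simp only [eventually_map]; exact Eventually.of_forall fun k => (hM _).2.2.2⟩
  have h4 := ((h3.sub (((hL.comp h1).mul (hL'.comp h1)).const_mul (α * β))).add
    (((hL.comp h1).rpow_const (p := q + 1) (Or.inr (by linarith))).div_const (q + 1))).add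
    (((hL'.comp h1).rpow_const (p := p + 1) (Or.inr (by linarith))).div_const (p + 1))
  have h5 := tendsto_nhds_unique (h4.congr (fun k => S.energy (ξ k))) tendsto_const_nhds
  have e1 : L ^ (q + 1) = α * β * (L * L') := by
    rw [Real.rpow_add_one' hL0 (by linarith), ← r2]; ring
  have e2 : L' ^ (p + 1) = α * β * (L * L') := by
    rw [Real.rpow_add_one' hL0' (by linarith), ← r1]; ring
  rw [e1, e2] at h5
  have h6 : L * L' = 0 := by
    have h7 : α * β * (L * L') * (p * q - 1) = 0 := by
      field_simp at h5
      nlinarith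
    have h8 : α * β ≠ 0 := by positivity
    have h9 : p * q - 1 ≠ 0 := by linarith [S.one_lt]
    simpa [h8, h9, hα.ne', hβ.ne'] using h7
  have hz : L = 0 ∧ L' = 0 := by
    rcases mul_eq_zero.1 h6 with h | h
    · refine ⟨h, ?_⟩
      rw [h, mul_zero] at r1
      exact (Real.rpow_eq_zero hL0' hp.ne').1 r1.symm
    · refine ⟨?_, h⟩
      rw [h, mul_zero] at r2
      exact (Real.rpow_eq_zero hL0 hq.ne').1 r2.symm
  exact ⟨hz.1 ▸ hL, hz.2 ▸ hL'⟩

end EmdenFowler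

namespace RadialProfile

variable {N p q α β : ℝ} {u v u1 v1 : ℝ → ℝ}

theorem one_lt_mul_of_hyperbola (hα : 0 < α) (hβ : 0 < β) (hq : α * q = β + 2)
    (hp : β * p = α + 2) : 1 < p * q := by
  have h : α * β * (p * q) = (β + 2) * (α + 2) := by rw [← hq, ← hp]; ring
  by_contra! hc
  have h2 := mul_le_mul_of_nonneg_left hc (mul_pos hα hβ).le
  nlinarith

theorem rpow_mul_rpow_eq (P : RadialProfile N p q u v u1 v1) (hp : β * p = α + 2) {r : ℝ}
    (hr : 0 < r) : (r ^ β * v r) ^ p = r ^ α * (r ^ 2 * v r ^ p) := by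
  rw [Real.mul_rpow (by positivity) (P.v_pos r).le, ← Real.rpow_mul hr.le, hp, Real.rpow_add hr]
  norm_num
  ring

theorem y_rpow_le (P : RadialProfile N p q u v u1 v1) (hp : β * p = α + 2) {r : ℝ}
    (hr : 0 < r) : (r ^ β * v r) ^ p ≤ N * (N - 2) * (r ^ α * u r) := by
  rw [P.rpow_mul_rpow_eq hp hr]
  have := P.sq_mul_v_rpow_le hr
  calc _ ≤ r ^ α * (N * (N - 2) * u r) := by gcongr
    _ = _ := by ring

theorem exists_bound_x (P : RadialProfile N p q u v u1 v1) (hα : 0 < α) (hβ : 0 < β)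
    (hq : α * q = β + 2) (hp : β * p = α + 2) :
    ∃ C, ∀ r, 0 < r → r ^ α * u r ≤ C := by
  have hpq := one_lt_mul_of_hyperbola hα hβ hq hp
  set K := N * (N - 2) with hK
  have hN := P.two_lt
  have hK0 : 0 < K := by have : 0 < N - 2 := by linarith
                         positivity
  refine ⟨(K ^ (p + 1)) ^ (p * q - 1)⁻¹, fun r hr => ?_⟩
  have hu := P.u_pos r
  have hv := P.v_pos r
  have hX : 0 < r ^ α * u r := by positivity
  have hY : 0 < r ^ β * v r := by positivity
  have h1 := P.y_rpow_le hp hr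
  have h2 := P.symm.y_rpow_le hq hr
  have h3 : (r ^ α * u r) ^ (p * q - 1) ≤ K ^ (p + 1) := by
    have h4 : (r ^ α * u r) ^ (p * q) ≤ K ^ (p + 1) * (r ^ α * u r) := by
      calc (r ^ α * u r) ^ (p * q) = ((r ^ α * u r) ^ q) ^ p := by
            rw [← Real.rpow_mul hX.le, mul_comm q p]
        _ ≤ (K * (r ^ β * v r)) ^ p := Real.rpow_le_rpow (by positivity) h2 P.p_pos.le
        _ = K ^ p * (r ^ β * v r) ^ p := Real.mul_rpow hK0.le hY.le
        _ ≤ K ^ p * (K * (r ^ α * u r)) := by gcongr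
        _ = _ := by rw [Real.rpow_add_one hK0.ne']; ring
    rw [Real.rpow_sub_one hX.ne', div_le_iff₀ hX]
    exact h4
  have h5 := Real.rpow_le_rpow (by positivity) h3
    (show 0 ≤ (p * q - 1)⁻¹ from inv_nonneg.2 (by linarith))
  rwa [← Real.rpow_mul hX.le, mul_inv_cancel₀ (by linarith), Real.rpow_one] at h5

theorem hasDerivAt_x_exp (P : RadialProfile N p q u v u1 v1) (α t : ℝ) :
    HasDerivAt (fun t => Real.exp t ^ α * u (Real.exp t))
      (Real.exp t ^ α * (Real.exp t * u1 (Real.exp t) + α * u (Real.exp t))) t := by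
  have hr := Real.exp_pos t
  have h := ((P.hu (Real.exp t)).rpow_mul α hr).comp t (Real.hasDerivAt_exp t)
  refine h.congr_deriv ?_
  field_simp

theorem hasDerivAt_x1_exp (P : RadialProfile N p q u v u1 v1) (hαβ : α + β = N - 2)
    (hp : β * p = α + 2) (t : ℝ) :
    HasDerivAt (fun t => Real.exp t ^ α * (Real.exp t * u1 (Real.exp t) + α * u (Real.exp t)))
      ((α - β) * (Real.exp t ^ α * (Real.exp t * u1 (Real.exp t) + α * u (Real.exp t))) +
        α * β * (Real.exp t ^ α * u (Real.exp t)) - (Real.exp t ^ β * v (Real.exp t)) ^ p) t := by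
  have hr := Real.exp_pos t
  have h := ((((hasDerivAt_id _).mul (P.hu1 (Real.exp t) hr)).add
    ((P.hu (Real.exp t)).const_mul α)).rpow_mul α hr).comp t (Real.hasDerivAt_exp t)
  refine h.congr_deriv ?_
  rw [P.rpow_mul_rpow_eq hp hr]
  have hN : N = α + β + 2 := by linarith
  simp
  rw [hN]
  field_simp
  ring

theorem energy_zero (P : RadialProfile N p q u v u1 v1) (hα : 0 < α) (hβ : 0 < β)
    (hαβ : α + β = N - 2) (hq : α * q = β + 2) (hp : β * p = α + 2) (t : ℝ) :
    (Real.exp t ^ α * (Real.exp t * u1 (Real.exp t) + α * u (Real.exp t))) *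
      (Real.exp t ^ β * (Real.exp t * v1 (Real.exp t) + β * v (Real.exp t))) -
      α * β * ((Real.exp t ^ α * u (Real.exp t)) * (Real.exp t ^ β * v (Real.exp t))) +
      (Real.exp t ^ α * u (Real.exp t)) ^ (q + 1) / (q + 1) +
      (Real.exp t ^ β * v (Real.exp t)) ^ (p + 1) / (p + 1) = 0 := by
  have hp0 := P.p_pos
  have hq0 := P.q_pos
  set e : ℝ → ℝ := fun r => (r ^ α * (r * u1 r + α * u r)) * (r ^ β * (r * v1 r + β * v r)) -
      α * β * ((r ^ α * u r) * (r ^ β * v r)) + (r ^ α * u r) ^ (q + 1) / (q + 1) +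
      (r ^ β * v r) ^ (p + 1) / (p + 1) with he
  change e (Real.exp t) = 0
  have hcont : Continuous e := by
    have c1 := Real.continuous_rpow_const hα.le
    have c2 := Real.continuous_rpow_const hβ.le
    have c3 := P.u_cont
    have c4 := P.v_cont
    have c5 := P.u1_cont
    have c6 := P.v1_cont
    have c7 : Continuous fun r => (r ^ α * u r) ^ (q + 1) :=
      (c1.mul c3).rpow_const fun _ => Or.inr (by linarith)
    have c8 : Continuous fun r => (r ^ β * v r) ^ (p + 1) :=
      (c2.mul c4).rpow_const fun _ => Or.inr (by linarith)
    simp only [he]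
    fun_prop
  have he0 : e 0 = 0 := by
    simp only [he, Real.zero_rpow hα.ne', Real.zero_rpow hβ.ne', zero_mul,
      Real.zero_rpow (show q + 1 ≠ 0 by linarith), Real.zero_rpow (show p + 1 ≠ 0 by linarith)]
    ring
  have hd : ∀ t, HasDerivAt (fun t => e (Real.exp t)) 0 t := by
    intro t
    have hr := Real.exp_pos t
    have hu := P.u_pos (Real.exp t)
    have hv := P.v_pos (Real.exp t)
    have a1 := P.hasDerivAt_x_exp α t
    have a2 := P.symm.hasDerivAt_x_exp β t
    have a3 := P.hasDerivAt_x1_exp hαβ hp t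
    have a4 := P.symm.hasDerivAt_x1_exp (α := β) (β := α) (by linarith) hq t
    have hX : Real.exp t ^ α * u (Real.exp t) ≠ 0 := by positivity
    have hY : Real.exp t ^ β * v (Real.exp t) ≠ 0 := by positivity
    refine ((((a3.mul a4).sub ((a1.mul a2).const_mul (α * β))).add
      ((a1.rpow_const (p := q + 1) (Or.inl hX)).div_const (q + 1))).add
      ((a2.rpow_const (p := p + 1) (Or.inl hY)).div_const (p + 1))).congr_deriv ?_
    rw [add_sub_cancel_right, add_sub_cancel_right]
    field_simp
    ring
  have hconst : ∀ s t, e (Real.exp s) = e (Real.exp t) :=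
    is_const_of_deriv_eq_zero (fun t => (hd t).differentiableAt) (fun t => (hd t).deriv)
  have hlim : Tendsto (fun s => e (Real.exp s)) atBot (𝓝 0) := by
    have := (hcont.tendsto 0).comp Real.tendsto_exp_atBot
    rwa [he0] at this
  exact tendsto_nhds_unique (tendsto_const_nhds.congr fun s => hconst t s) hlim

theorem emdenFowler (P : RadialProfile N p q u v u1 v1) (hα : 0 < α) (hβ : 0 < β)
    (hαβ : α + β = N - 2) (hq : α * q = β + 2) (hp : β * p = α + 2) :
    EmdenFowler α β p q (fun t => Real.exp t ^ α * u (Real.exp t))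
      (fun t => Real.exp t ^ β * v (Real.exp t))
      (fun t => Real.exp t ^ α * (Real.exp t * u1 (Real.exp t) + α * u (Real.exp t)))
      (fun t => Real.exp t ^ β * (Real.exp t * v1 (Real.exp t) + β * v (Real.exp t))) := by
  have hN := P.two_lt
  refine ⟨hα, hβ, P.p_pos, P.q_pos, one_lt_mul_of_hyperbola hα hβ hq hp, ?_, ?_,
    P.hasDerivAt_x_exp α, P.symm.hasDerivAt_x_exp β, P.hasDerivAt_x1_exp hαβ hp,
    fun t => (P.symm.hasDerivAt_x1_exp (by linarith) hq t).congr_deriv (by ring),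
    P.energy_zero hα hβ hαβ hq hp, ?_⟩
  · intro t
    have := P.u_pos (Real.exp t)
    positivity
  · intro t
    have := P.v_pos (Real.exp t)
    positivity
  · have key : ∀ {p q α β : ℝ} {u v u1 v1 : ℝ → ℝ}, RadialProfile N p q u v u1 v1 → 0 < α →
        ∀ C, (∀ r, 0 < r → r ^ α * u r ≤ C) → ∀ r, 0 < r →
        |r ^ α * u r| ≤ (α + N) * C + C ∧ |r ^ α * (r * u1 r + α * u r)| ≤ (α + N) * C + C := by
      intro p q α β u v u1 v1 P hα C hC r hr
      have hu := P.u_pos r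
      have h0 : 0 < r ^ α := by positivity
      have h1 := hC r hr
      have h2 : 0 < r ^ α * u r := by positivity
      have h3 := P.neg_u1_le hr
      have h4 : r * u1 r < 0 := mul_neg_of_pos_of_neg hr (P.u1_neg hr)
      have hC0 : 0 < C := h2.trans_le h1
      have h6 : 0 < (α + N) * C := mul_pos (by linarith) hC0
      refine ⟨by rw [abs_of_pos h2]; linarith, ?_⟩
      rw [abs_mul, abs_of_pos h0]
      have h5 : |r * u1 r + α * u r| ≤ (α + N) * u r := by
        rw [abs_le]; constructor <;> nlinarith
      calc _ ≤ r ^ α * ((α + N) * u r) := by gcongr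
        _ = (α + N) * (r ^ α * u r) := by ring
        _ ≤ (α + N) * C := by gcongr
        _ ≤ _ := by linarith
    obtain ⟨C, hC⟩ := P.exists_bound_x hα hβ hq hp
    obtain ⟨D, hD⟩ := P.symm.exists_bound_x hβ hα hp hq
    have kC := key (β := 0) P hα C hC
    have kD := key (β := 0) P.symm hβ D hD
    refine ⟨max ((α + N) * C + C) ((β + N) * D + D), fun t => ?_⟩
    have hr := Real.exp_pos t
    exact ⟨le_max_of_le_left (kC _ hr).1, le_max_of_le_right (kD _ hr).1,
      le_max_of_le_left (kC _ hr).2, le_max_of_le_right (kD _ hr).2⟩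

theorem tendsto_potential (P : RadialProfile N p q u v u1 v1) (hα : 0 < α) (hβ : 0 < β)
    (hαβ : α + β = N - 2) (hq : α * q = β + 2) (hp : β * p = α + 2) (hq1 : 1 < q) :
    Tendsto (fun r => r ^ 4 * (u r ^ (q - 1) * v r ^ (p - 1))) atTop (𝓝 0) := by
  have hpq := one_lt_mul_of_hyperbola hα hβ hq hp
  have hN := P.two_lt
  have hx : Tendsto (fun r => r ^ α * u r) atTop (𝓝 0) := by
    refine ((P.emdenFowler hα hβ hαβ hq hp).tendsto_zero.1.comp Real.tendsto_log_atTop).congr' ?_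
    filter_upwards [eventually_gt_atTop 0] with r hr
    simp [Real.exp_log hr]
  have hx' : ∀ s : ℝ, 0 < s → Tendsto (fun r => (r ^ α * u r) ^ s) atTop (𝓝 0) := by
    intro s hs
    have := hx.rpow_const (p := s) (Or.inr hs.le)
    rwa [Real.zero_rpow hs.ne'] at this
  have heq : ∀ r, 0 < r → r ^ 4 * (u r ^ (q - 1) * v r ^ (p - 1)) =
      (r ^ α * u r) ^ (q - 1) * (r ^ β * v r) ^ (p - 1) := by
    intro r hr
    rw [Real.mul_rpow (by positivity) (P.u_pos r).le, Real.mul_rpow (by positivity) (P.v_pos r).le,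
      ← Real.rpow_mul hr.le, ← Real.rpow_mul hr.le]
    have : r ^ 4 = r ^ (α * (q - 1)) * r ^ (β * (p - 1)) := by
      rw [← Real.rpow_add hr, show α * (q - 1) + β * (p - 1) = (4:ℕ) by push_cast; linarith,
        Real.rpow_natCast]
    rw [this]; ring
  set K := N * (N - 2) with hK
  have hK0 : 0 < K := by have : 0 < N - 2 := by linarith
                         positivity
  have hnn : ∀ᶠ r in atTop, 0 ≤ r ^ 4 * (u r ^ (q - 1) * v r ^ (p - 1)) := by
    filter_upwards [eventually_gt_atTop 0] with r hr
    have := P.u_pos r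
    have := P.v_pos r
    positivity
  rcases le_total 1 p with h1 | h1
  · obtain ⟨D, hD⟩ := P.symm.exists_bound_x hβ hα hp hq
    have hlim := (hx' (q - 1) (by linarith)).mul_const (D ^ (p - 1))
    rw [zero_mul] at hlim
    refine squeeze_zero' hnn ?_ hlim
    filter_upwards [eventually_gt_atTop 0] with r hr
    rw [heq r hr]
    have hu := P.u_pos r
    have hv := P.v_pos r
    gcongr
    · exact hD r hr
  · have hlim := (hx' (p * q - 1) (by linarith)).mul_const (K ^ (1 - p))
    rw [zero_mul] at hlim
    refine squeeze_zero' hnn ?_ hlim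
    filter_upwards [eventually_gt_atTop 0] with r hr
    rw [heq r hr]
    have hu := P.u_pos r
    have hv := P.v_pos r
    have hX : 0 < r ^ α * u r := by positivity
    have hY : 0 < r ^ β * v r := by positivity
    have h2 := P.symm.y_rpow_le hq hr
    have h3 : (r ^ α * u r) ^ q / K ≤ r ^ β * v r := by
      rw [div_le_iff₀ hK0]; linarith
    have h4 : (r ^ β * v r) ^ (p - 1) ≤ ((r ^ α * u r) ^ q / K) ^ (p - 1) :=
      Real.rpow_le_rpow_of_nonpos (by positivity) h3 (by linarith)
    calc (r ^ α * u r) ^ (q - 1) * (r ^ β * v r) ^ (p - 1)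
        ≤ (r ^ α * u r) ^ (q - 1) * ((r ^ α * u r) ^ q / K) ^ (p - 1) := by gcongr
      _ = (r ^ α * u r) ^ (p * q - 1) * K ^ (1 - p) := by
        rw [Real.div_rpow (by positivity) hK0.le, ← Real.rpow_mul hX.le, div_eq_mul_inv,
          ← Real.rpow_neg hK0.le, ← mul_assoc, ← Real.rpow_add hX]
        congr 2 <;> ring

end RadialProfile

section MaximumPrinciple

variable {n : ℕ} {O : Set (EuclideanSpace ℝ (Fin n))}

theorem not_touching {w1 w2 S1 S2 c11 c12 : EuclideanSpace ℝ (Fin n) → ℝ} {M : ℝ}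
    {x : EuclideanSpace ℝ (Fin n)} (hO : O ∈ 𝓝 x)
    (hw1 : ContDiffAt ℝ 2 w1 x) (hS1 : ContDiffAt ℝ 2 S1 x)
    (hM : 0 < M) (h12 : 0 ≤ c12 x)
    (hw : -lap w1 x ≤ c11 x * w1 x + c12 x * w2 x)
    (hS : c11 x * S1 x + c12 x * S2 x < -lap S1 x)
    (hle : ∀ y ∈ O, w1 y ≤ M * S1 y) (hle2 : w2 x ≤ M * S2 x) (heq : w1 x = M * S1 x) : False := by
  have hmax : IsLocalMax (fun y => w1 y - M * S1 y) x := by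
    filter_upwards [hO] with y hy
    have := hle y hy
    linarith
  have h1 := lap_nonpos_of_isLocalMax (hw1.sub (contDiffAt_const.mul hS1)) hmax
  have h2 : lap (fun y => w1 y - M * S1 y) x = lap w1 x - M * lap S1 x := by
    rw [lap_sub hw1 (contDiffAt_const.mul hS1), lap_const_mul M hS1]
  rw [h2] at h1
  have h3 := mul_lt_mul_of_pos_left hS hM
  have h4 := mul_le_mul_of_nonneg_left hle2 h12
  have h5 : c11 x * w1 x = M * (c11 x * S1 x) := by rw [heq]; ring
  nlinarith

/-- Maximum principle for cooperative systems possessing a strict positive supersolution. -/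
theorem system_max_principle {w1 w2 S1 S2 c11 c12 c21 c22 : EuclideanSpace ℝ (Fin n) → ℝ}
    (hO : IsOpen O)
    (hw1 : ∀ x ∈ O, ContDiffAt ℝ 2 w1 x) (hw2 : ∀ x ∈ O, ContDiffAt ℝ 2 w2 x)
    (hS1 : ∀ x ∈ O, ContDiffAt ℝ 2 S1 x) (hS2 : ∀ x ∈ O, ContDiffAt ℝ 2 S2 x)
    (S1pos : ∀ x ∈ O, 0 < S1 x) (S2pos : ∀ x ∈ O, 0 < S2 x)
    (h12 : ∀ x ∈ O, 0 ≤ c12 x) (h21 : ∀ x ∈ O, 0 ≤ c21 x)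
    (ew1 : ∀ x ∈ O, -lap w1 x ≤ c11 x * w1 x + c12 x * w2 x)
    (ew2 : ∀ x ∈ O, -lap w2 x ≤ c21 x * w1 x + c22 x * w2 x)
    (eS1 : ∀ x ∈ O, c11 x * S1 x + c12 x * S2 x < -lap S1 x)
    (eS2 : ∀ x ∈ O, c21 x * S1 x + c22 x * S2 x < -lap S2 x)
    (hbd : ∀ m > 0, ∃ K ⊆ O, IsCompact K ∧ ∀ x ∈ O, x ∉ K → w1 x ≤ m * S1 x ∧ w2 x ≤ m * S2 x) :
    ∀ x ∈ O, w1 x ≤ 0 ∧ w2 x ≤ 0 := by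
  set F : EuclideanSpace ℝ (Fin n) → ℝ := fun x => max (w1 x / S1 x) (w2 x / S2 x) with hF
  suffices h : ∀ x ∈ O, F x ≤ 0 by
    intro x hx
    have h1 := (le_max_left _ _).trans (h x hx)
    have h2 := (le_max_right _ _).trans (h x hx)
    rw [div_le_iff₀ (S1pos x hx), zero_mul] at h1
    rw [div_le_iff₀ (S2pos x hx), zero_mul] at h2
    exact ⟨h1, h2⟩
  by_contra! hcon
  obtain ⟨x0, hx0, hpos⟩ := hcon
  obtain ⟨K, hKO, hK, hKbd⟩ := hbd (F x0 / 2) (by linarith)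
  have hle : ∀ x ∈ O, x ∉ K → F x ≤ F x0 / 2 := by
    intro x hx hxK
    obtain ⟨h1, h2⟩ := hKbd x hx hxK
    exact max_le ((div_le_iff₀ (S1pos x hx)).2 h1) ((div_le_iff₀ (S2pos x hx)).2 h2)
  have hx0K : x0 ∈ K := by
    by_contra hc
    have := hle x0 hx0 hc
    linarith
  have hFc : ContinuousOn F K := by
    intro x hx
    have hxO := hKO hx
    have hc : ContinuousAt F x :=
      ((hw1 x hxO).continuousAt.div (hS1 x hxO).continuousAt (S1pos x hxO).ne').max
        ((hw2 x hxO).continuousAt.div (hS2 x hxO).continuousAt (S2pos x hxO).ne')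
    exact hc.continuousWithinAt
  obtain ⟨y, hyK, hymax⟩ := hK.exists_isMaxOn ⟨x0, hx0K⟩ hFc
  have hy0 : F x0 ≤ F y := hymax hx0K
  have hall : ∀ x ∈ O, F x ≤ F y := by
    intro x hx
    by_cases hxK : x ∈ K
    · exact hymax hxK
    · linarith [hle x hx hxK]
  have hyO := hKO hyK
  have hMpos : 0 < F y := by linarith
  have l1 : ∀ x ∈ O, w1 x ≤ F y * S1 x := fun x hx =>
    (div_le_iff₀ (S1pos x hx)).1 ((le_max_left _ _).trans (hall x hx))
  have l2 : ∀ x ∈ O, w2 x ≤ F y * S2 x := fun x hx =>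
    (div_le_iff₀ (S2pos x hx)).1 ((le_max_right _ _).trans (hall x hx))
  have hOy := hO.mem_nhds hyO
  rcases max_choice (w1 y / S1 y) (w2 y / S2 y) with h | h
  · refine not_touching hOy (hw1 y hyO) (hS1 y hyO) hMpos (h12 y hyO) (ew1 y hyO) (eS1 y hyO)
      l1 (l2 y hyO) ?_
    have : F y = w1 y / S1 y := h
    rw [this, div_mul_cancel₀ _ (S1pos y hyO).ne']
  · refine not_touching (c11 := c22) (c12 := c21) hOy (hw2 y hyO) (hS2 y hyO) hMpos (h21 y hyO)
      (by linarith [ew2 y hyO]) (by linarith [eS2 y hyO]) l2 (l1 y hyO) ?_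
    have : F y = w2 y / S2 y := h
    rw [this, div_mul_cancel₀ _ (S2pos y hyO).ne']

theorem isCompact_annulus (a b : ℝ) :
    IsCompact {x : EuclideanSpace ℝ (Fin n) | a ≤ ‖x‖ ∧ ‖x‖ ≤ b} := by
  have h : {x : EuclideanSpace ℝ (Fin n) | a ≤ ‖x‖ ∧ ‖x‖ ≤ b} =
      Metric.closedBall 0 b ∩ {x | a ≤ ‖x‖} := by
    ext x; simp [and_comm]
  rw [h]
  exact (isCompact_closedBall 0 b).inter_right (isClosed_le continuous_const continuous_norm)

/-- Maximum principle in an exterior domain. -/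
theorem exterior_max_principle {w1 w2 S1 S2 c11 c12 c21 c22 : EuclideanSpace ℝ (Fin n) → ℝ} {R : ℝ}
    (hw1 : ∀ x, R < ‖x‖ → ContDiffAt ℝ 2 w1 x) (hw2 : ∀ x, R < ‖x‖ → ContDiffAt ℝ 2 w2 x)
    (hS1 : ∀ x, R < ‖x‖ → ContDiffAt ℝ 2 S1 x) (hS2 : ∀ x, R < ‖x‖ → ContDiffAt ℝ 2 S2 x)
    (S1pos : ∀ x, R < ‖x‖ → 0 < S1 x) (S2pos : ∀ x, R < ‖x‖ → 0 < S2 x)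
    (h12 : ∀ x, R < ‖x‖ → 0 ≤ c12 x) (h21 : ∀ x, R < ‖x‖ → 0 ≤ c21 x)
    (ew1 : ∀ x, R < ‖x‖ → -lap w1 x ≤ c11 x * w1 x + c12 x * w2 x)
    (ew2 : ∀ x, R < ‖x‖ → -lap w2 x ≤ c21 x * w1 x + c22 x * w2 x)
    (eS1 : ∀ x, R < ‖x‖ → c11 x * S1 x + c12 x * S2 x < -lap S1 x)
    (eS2 : ∀ x, R < ‖x‖ → c21 x * S1 x + c22 x * S2 x < -lap S2 x)
    (hin : ∀ x, R < ‖x‖ → ‖x‖ < R + 1 → w1 x ≤ 0 ∧ w2 x ≤ 0)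
    (hbd : ∀ m > 0, ∃ R', ∀ x, R < ‖x‖ → R' < ‖x‖ → w1 x ≤ m * S1 x ∧ w2 x ≤ m * S2 x) :
    ∀ x, R < ‖x‖ → w1 x ≤ 0 ∧ w2 x ≤ 0 := by
  refine system_max_principle (O := {x | R < ‖x‖}) (isOpen_lt continuous_const continuous_norm)
    hw1 hw2 hS1 hS2 S1pos S2pos h12 h21 ew1 ew2 eS1 eS2 ?_
  intro m hm
  obtain ⟨R', hR'⟩ := hbd m hm
  refine ⟨{x | R + 1 ≤ ‖x‖ ∧ ‖x‖ ≤ R'}, fun x hx => lt_of_lt_of_le (by linarith) hx.1,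
    isCompact_annulus _ _, ?_⟩
  intro x hx hxK
  rcases lt_or_ge ‖x‖ (R + 1) with h | h
  · obtain ⟨h1, h2⟩ := hin x hx h
    have h3 := mul_pos hm (S1pos x hx)
    have h4 := mul_pos hm (S2pos x hx)
    exact ⟨by linarith, by linarith⟩
  · refine hR' x hx ?_
    by_contra! hc
    exact hxK ⟨h, hc⟩

end MaximumPrinciple

theorem contDiffAt_rpow_norm {n : ℕ} (s : ℝ) {x : EuclideanSpace ℝ (Fin n)} (hx : x ≠ 0) :
    ContDiffAt ℝ 2 (fun y : EuclideanSpace ℝ (Fin n) => ‖y‖ ^ s) x :=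
  contDiffAt_norm_comp hx (Real.contDiffAt_rpow_const_of_ne (norm_ne_zero_iff.2 hx))

/-- Powers of the norm form a strict supersolution of the system governing `(u, v ^ p)`. -/
theorem rpow_norm_supersolution {n : ℕ} {s γ η K : ℝ} {x : EuclideanSpace ℝ (Fin n)} (hx : x ≠ 0)
    (hK : K < s * (n - 2 - s)) (hη : η + γ * K < K * ((s + 2) * (n - 4 - s))) :
    K * ‖x‖ ^ (-(s + 2)) < -lap (fun y => ‖y‖ ^ (-s)) x ∧
    η * ‖x‖ ^ (-4 : ℝ) * ‖x‖ ^ (-s) + γ * ‖x‖ ^ (-2 : ℝ) * (K * ‖x‖ ^ (-(s + 2))) <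
      -lap (fun y => K * ‖y‖ ^ (-(s + 2))) x := by
  have hpos : 0 < ‖x‖ := norm_pos_iff.2 hx
  constructor
  · rw [lap_rpow_norm s hx, show -s - 2 = -(s + 2) by ring]
    have := mul_lt_mul_of_pos_right hK (Real.rpow_pos_of_pos hpos (-(s + 2)))
    linarith
  · rw [lap_const_mul K (contDiffAt_rpow_norm _ hx), lap_rpow_norm (s + 2) hx]
    have e1 : ‖x‖ ^ (-4 : ℝ) * ‖x‖ ^ (-s) = ‖x‖ ^ (-(s + 2) - 2) := by
      rw [← Real.rpow_add hpos]; congr 1; ring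
    have e2 : ‖x‖ ^ (-2 : ℝ) * ‖x‖ ^ (-(s + 2)) = ‖x‖ ^ (-(s + 2) - 2) := by
      rw [← Real.rpow_add hpos]; congr 1; ring
    have := mul_lt_mul_of_pos_right hη (Real.rpow_pos_of_pos hpos (-(s + 2) - 2))
    calc η * ‖x‖ ^ (-4 : ℝ) * ‖x‖ ^ (-s) + γ * ‖x‖ ^ (-2 : ℝ) * (K * ‖x‖ ^ (-(s + 2)))
        = η * (‖x‖ ^ (-4 : ℝ) * ‖x‖ ^ (-s)) + γ * K * (‖x‖ ^ (-2 : ℝ) * ‖x‖ ^ (-(s + 2))) := by ring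
      _ < _ := by rw [e1, e2]; linarith

namespace RadialProfile

variable {n : ℕ} {N p q α β : ℝ} {u v u1 v1 : ℝ → ℝ}

theorem contDiffOn_u (P : RadialProfile N p q u v u1 v1) : ContDiffOn ℝ 2 u (Set.Ioi 0) := by
  refine contDiffOn_two_of_hasDerivAt isOpen_Ioi (fun r _ => P.hu r)
    (fun r hr => P.hu1 r hr) ?_
  have h0 : ∀ x ∈ Set.Ioi (0:ℝ), x ≠ 0 := fun x hx => ne_of_gt hx
  have c1 := P.u1_cont.continuousOn (s := Set.Ioi 0)
  have c4 : ContinuousOn (fun r => v r ^ p) (Set.Ioi 0) :=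
    (P.v_cont.rpow_const fun x => Or.inl (P.v_pos x).ne').continuousOn
  fun_prop (disch := assumption)

theorem contDiffAt_u (P : RadialProfile N p q u v u1 v1) {r : ℝ} (hr : 0 < r) :
    ContDiffAt ℝ 2 u r :=
  P.contDiffOn_u.contDiffAt (Ioi_mem_nhds hr)

theorem contDiffAt_v_rpow (P : RadialProfile N p q u v u1 v1) {r : ℝ} (s : ℝ) (hr : 0 < r) :
    ContDiffAt ℝ 2 (fun r => v r ^ s) r :=
  (P.symm.contDiffAt_u hr).rpow_const_of_ne (P.v_pos r).ne'

theorem lap_u (P : RadialProfile n p q u v u1 v1) {x : EuclideanSpace ℝ (Fin n)} (hx : x ≠ 0) :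
    -lap (fun y => u ‖y‖) x = v ‖x‖ ^ p := by
  rw [lap_radial hx (Eventually.of_forall P.hu) (P.hu1 _ (norm_pos_iff.2 hx))]
  ring

theorem neg_lap_v_rpow_le (P : RadialProfile n p q u v u1 v1) {x : EuclideanSpace ℝ (Fin n)}
    (hx : x ≠ 0) :
    -lap (fun y => v ‖y‖ ^ p) x ≤ p * (u ‖x‖ ^ (q - 1) * v ‖x‖ ^ (p - 1)) * u ‖x‖ +
      p * |1 - p| * (n - 2) ^ 2 * ‖x‖ ^ (-2 : ℝ) * v ‖x‖ ^ p := by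
  have hr := norm_pos_iff.2 hx
  set r := ‖x‖ with hrdef
  have hv := P.v_pos r
  have hu := P.u_pos r
  have hN := P.two_lt
  have h2 := ((P.hasDerivAt_v_rpow (p - 1) r).const_mul p).mul (P.hv1 r hr)
  rw [lap_radial hx (Eventually.of_forall (P.hasDerivAt_v_rpow p)) h2]
  have hb := P.symm.neg_u1_le hr
  have hv1 := P.v1_neg hr
  have e1 : u r ^ q = u r ^ (q - 1) * u r := by
    rw [← Real.rpow_add_one hu.ne']; congr 1; ring
  have e2 : v r ^ p = v r ^ (p - 1 - 1) * v r ^ 2 := by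
    rw [← Real.rpow_natCast (v r) 2, ← Real.rpow_add hv]; congr 1; push_cast; ring
  have e3 : r ^ (-2 : ℝ) = 1 / r ^ 2 := by
    rw [Real.rpow_neg hr.le, one_div]; norm_cast
  have hsq : v1 r ^ 2 ≤ (n - 2) ^ 2 * (1 / r ^ 2) * v r ^ 2 := by
    have h : (r * v1 r) ^ 2 ≤ ((n - 2) * v r) ^ 2 := by
      have : 0 ≤ -(r * v1 r) := by nlinarith
      nlinarith
    have hr2 : 0 < r ^ 2 := by positivity
    rw [show (n - 2 : ℝ) ^ 2 * (1 / r ^ 2) * v r ^ 2 = ((n - 2) * v r) ^ 2 / r ^ 2 by ring,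
      le_div_iff₀ hr2]
    nlinarith
  have hA := P.p_pos
  have h3 : (1 - p) * (v r ^ (p - 1 - 1) * v1 r ^ 2) ≤
      |1 - p| * (v r ^ (p - 1 - 1) * ((n - 2) ^ 2 * (1 / r ^ 2) * v r ^ 2)) := by
    have := Real.rpow_pos_of_pos hv (p - 1 - 1)
    calc _ ≤ |1 - p| * (v r ^ (p - 1 - 1) * v1 r ^ 2) := by
          gcongr; exact le_abs_self _
      _ ≤ _ := by gcongr
  have h4 := mul_le_mul_of_nonneg_left h3 hA.le
  rw [e3, e2, ]
  simp only [← hrdef, e1]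
  nlinarith [h4]

set_option maxHeartbeats 1000000 in
/-- Improved decay of the first component. -/
theorem exists_decay_u (P : RadialProfile n p q u v u1 v1) (hn : 5 ≤ n) (hα : 0 < α) (hβ : 0 < β)
    (hαβ : α + β = n - 2) (hq : α * q = β + 2) (hp : β * p = α + 2) (hq1 : 1 < q)
    (hα4 : ((n : ℝ) - 4) / 4 < α) (hγ : p * |1 - p| * ((n : ℝ) - 2) ^ 2 ≤ 1 / 2) :
    ∃ C R, 0 < R ∧ ∀ r, R < r → u r ≤ C * r ^ (-(3 * ((n : ℝ) - 4) / 4)) := by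
  have hn' : (5 : ℝ) ≤ n := by exact_mod_cast hn
  set γ := p * |1 - p| * ((n : ℝ) - 2) ^ 2 with hγd
  have hγ0 : 0 ≤ γ := by have := P.p_pos; positivity
  set s : ℝ := 3 * ((n : ℝ) - 4) / 4 with hs
  set s0 : ℝ := ((n : ℝ) - 4) / 4 with hs0
  set K : ℝ := s * (n - 2 - s) / 2 with hKd
  set K0 : ℝ := s0 * (n - 2 - s0) / 2 with hK0d
  have sK : 0 < s * (n - 2 - s) := by apply mul_pos <;> linarith
  have sK0 : 0 < s0 * (n - 2 - s0) := by apply mul_pos <;> linarith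
  have hK : 0 < K := by positivity
  have hK0 : 0 < K0 := by positivity
  set η := min K K0 / 10 with hη
  have hη0 : 0 < η := by positivity
  have hs1 : η + γ * K < K * ((s + 2) * (n - 4 - s)) := by
    have h1 : η ≤ K / 10 := by rw [hη]; gcongr; exact min_le_left _ _
    have h2 : 0.65 ≤ (s + 2) * (n - 4 - s) := by rw [hs]; nlinarith
    nlinarith
  have hs2 : η + γ * K0 < K0 * ((s0 + 2) * (n - 4 - s0)) := by
    have h1 : η ≤ K0 / 10 := by rw [hη]; gcongr; exact min_le_right _ _
    have h2 : 0.65 ≤ (s0 + 2) * (n - 4 - s0) := by rw [hs0]; nlinarith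
    nlinarith
  obtain ⟨R, hR0, hR⟩ : ∃ R : ℝ, 1 < R ∧ ∀ r, R < r →
      p * (u r ^ (q - 1) * v r ^ (p - 1)) ≤ η * r ^ (-4 : ℝ) := by
    have h := (P.tendsto_potential hα hβ hαβ hq hp hq1).const_mul p
    rw [mul_zero] at h
    obtain ⟨R, hR⟩ := eventually_atTop.1 (h.eventually_lt_const hη0)
    refine ⟨max R 2, by simp, fun r hr => ?_⟩
    have hr0 : 0 < r := lt_trans (by simp) hr
    have := hR r ((le_max_left _ _).trans hr.le)
    rw [Real.rpow_neg hr0.le, ← div_eq_mul_inv, le_div_iff₀ (by positivity)]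
    norm_cast
    nlinarith
  obtain ⟨B, hB⟩ := P.exists_bound_x hα hβ hq hp
  have hB0 : 0 ≤ B := le_trans (by have := P.u_pos 1; positivity) (hB 1 one_pos)
  set C := max (u 0 * (R + 1) ^ s) (v 0 ^ p * (R + 1) ^ (s + 2) / K) with hC
  have hC0 : 0 ≤ C := le_max_of_le_left (by have := P.u_pos 0; positivity)
  have hx0 : ∀ x : EuclideanSpace ℝ (Fin n), R < ‖x‖ → x ≠ 0 := fun x hx => by
    rw [← norm_pos_iff]; linarith
  have main := exterior_max_principle (n := n) (R := R)
    (w1 := fun x => u ‖x‖ - C * ‖x‖ ^ (-s))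
    (w2 := fun x => v ‖x‖ ^ p - C * (K * ‖x‖ ^ (-(s + 2))))
    (S1 := fun x => ‖x‖ ^ (-s0)) (S2 := fun x => K0 * ‖x‖ ^ (-(s0 + 2)))
    (c11 := fun _ => 0) (c12 := fun _ => 1) (c21 := fun x => η * ‖x‖ ^ (-4 : ℝ))
    (c22 := fun x => γ * ‖x‖ ^ (-2 : ℝ))
    (fun x hx => (contDiffAt_norm_comp (hx0 x hx) (P.contDiffAt_u (norm_pos_iff.2 (hx0 x hx)))).sub
      (contDiffAt_const.mul (contDiffAt_rpow_norm _ (hx0 x hx))))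
    (fun x hx => (contDiffAt_norm_comp (hx0 x hx)
      (P.contDiffAt_v_rpow p (norm_pos_iff.2 (hx0 x hx)))).sub
      (contDiffAt_const.mul (contDiffAt_const.mul (contDiffAt_rpow_norm _ (hx0 x hx)))))
    (fun x hx => contDiffAt_rpow_norm _ (hx0 x hx))
    (fun x hx => contDiffAt_const.mul (contDiffAt_rpow_norm _ (hx0 x hx)))
    (fun x hx => Real.rpow_pos_of_pos (norm_pos_iff.2 (hx0 x hx)) _)
    (fun x hx => mul_pos hK0 (Real.rpow_pos_of_pos (norm_pos_iff.2 (hx0 x hx)) _))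
    (fun _ _ => zero_le_one) (fun x _ => by positivity) ?_ ?_ ?_ ?_ ?_ ?_
  · have hn0 : 0 < n := by omega
    refine ⟨C, R, by linarith, fun r hr => ?_⟩
    have := (main (EuclideanSpace.single ⟨0, hn0⟩ r) (by
      simpa using lt_of_lt_of_le hr (le_abs_self r))).1
    simp only [PiLp.norm_single, Real.norm_eq_abs, abs_of_pos (by linarith : 0 < r)] at this
    linarith
  · intro x hx
    have h1 := (rpow_norm_supersolution (hx0 x hx) (by rw [hKd]; linarith) hs1).1
    rw [lap_sub (contDiffAt_norm_comp (hx0 x hx) (P.contDiffAt_u (norm_pos_iff.2 (hx0 x hx))))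
      (contDiffAt_const.mul (contDiffAt_rpow_norm _ (hx0 x hx))),
      lap_const_mul _ (contDiffAt_rpow_norm _ (hx0 x hx))]
    have h2 := P.lap_u (hx0 x hx)
    have h4 := mul_le_mul_of_nonneg_left h1.le hC0
    linarith
  · intro x hx
    have h1 := (rpow_norm_supersolution (hx0 x hx) (by rw [hKd]; linarith) hs1).2
    rw [lap_sub (contDiffAt_norm_comp (hx0 x hx)
      (P.contDiffAt_v_rpow p (norm_pos_iff.2 (hx0 x hx))))
      (contDiffAt_const.mul (contDiffAt_const.mul (contDiffAt_rpow_norm _ (hx0 x hx)))),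
      lap_const_mul C (contDiffAt_const.mul (contDiffAt_rpow_norm _ (hx0 x hx)))]
    have h2 := P.neg_lap_v_rpow_le (hx0 x hx)
    have h3 := mul_le_mul_of_nonneg_right (hR _ hx) (P.u_pos ‖x‖).le
    have h4 := mul_le_mul_of_nonneg_left h1.le hC0
    linarith
  · intro x hx
    have h1 := (rpow_norm_supersolution (hx0 x hx) (by rw [hK0d]; linarith) hs2).1
    linarith
  · intro x hx
    exact (rpow_norm_supersolution (hx0 x hx) (by rw [hK0d]; linarith) hs2).2
  · intro x hx hx2
    have hr := norm_pos_iff.2 (hx0 x hx)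
    have hsp : 0 < s := by rw [hs]; linarith
    constructor
    · have h1 : u 0 * ‖x‖ ^ s ≤ C := le_trans (by have := P.u_pos 0; gcongr) (le_max_left _ _)
      have h2 := P.u_le hr.le
      have h3 : u ‖x‖ ≤ C * ‖x‖ ^ (-s) := by
        rw [Real.rpow_neg hr.le, ← div_eq_mul_inv, le_div_iff₀ (by positivity)]
        refine le_trans ?_ h1
        gcongr
      linarith
    · have hv0 := P.v_pos 0
      have h1 : v 0 ^ p * ‖x‖ ^ (s + 2) / K ≤ C := le_trans (by gcongr) (le_max_right _ _)
      have h2 := P.symm.u_le hr.le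
      have h3 : v ‖x‖ ^ p ≤ C * (K * ‖x‖ ^ (-(s + 2))) := by
        rw [Real.rpow_neg hr.le, ← mul_assoc, ← div_eq_mul_inv, le_div_iff₀ (by positivity)]
        rw [div_le_iff₀ hK] at h1
        refine le_trans ?_ h1
        have := (P.v_pos ‖x‖).le
        have := P.p_pos.le
        gcongr
      linarith
  · intro m hm
    have ht : Tendsto (fun r : ℝ => B * r ^ (-(α - s0))) atTop (𝓝 0) := by
      simpa using (tendsto_rpow_neg_atTop (sub_pos.2 hα4)).const_mul B
    obtain ⟨R1, h1⟩ := eventually_atTop.1 (ht.eventually_lt_const hm)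
    have ht2 := ht.const_mul ((n : ℝ) * (n - 2))
    rw [mul_zero] at ht2
    obtain ⟨R2, h2⟩ := eventually_atTop.1 (ht2.eventually_lt_const (mul_pos hm hK0))
    refine ⟨max R1 R2, fun x hx hx' => ?_⟩
    have hr := norm_pos_iff.2 (hx0 x hx)
    have g1 := h1 _ ((le_max_left _ _).trans hx'.le)
    have g2 := h2 _ ((le_max_right _ _).trans hx'.le)
    set r := ‖x‖
    have hu : u r ≤ B * r ^ (-(α - s0)) * r ^ (-s0) := by
      rw [mul_assoc, ← Real.rpow_add hr, show -(α - s0) + -s0 = -α by ring, Real.rpow_neg hr.le,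
        ← div_eq_mul_inv, le_div_iff₀ (by positivity)]
      linarith [hB r hr]
    have hS : 0 < r ^ (-s0) := by positivity
    constructor
    · have := mul_lt_mul_of_pos_right g1 hS
      have : 0 ≤ C * r ^ (-s) := by positivity
      linarith
    · have hQ := P.sq_mul_v_rpow_le hr
      have : 0 ≤ C * (K * r ^ (-(s + 2))) := by positivity
      have e : r ^ (-(s0 + 2)) = r ^ (-s0) / r ^ 2 := by
        rw [show -(s0 + 2) = -s0 - 2 by ring, Real.rpow_sub hr]; norm_cast
      have : v r ^ p ≤ m * (K0 * r ^ (-(s0 + 2))) := by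
        rw [e, ← mul_assoc, ← mul_div_assoc, le_div_iff₀ (by positivity)]
        have := mul_lt_mul_of_pos_right g2 hS
        have h5 : 0 ≤ (n : ℝ) * (n - 2) := by apply mul_nonneg <;> linarith
        have := mul_le_mul_of_nonneg_left hu h5
        linarith
      linarith

end RadialProfile

section MeanValue

variable {n : ℕ}

/-- Cut-off used in the averaged mean value inequality. -/
noncomputable def bump (z : EuclideanSpace ℝ (Fin n)) : ℝ := max 0 (1 - ‖z‖ ^ 2) ^ 3

/-- Averaging weight, related to `bump` by `∇ bump z = -bumpWeight z • z`. -/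
noncomputable def bumpWeight (z : EuclideanSpace ℝ (Fin n)) : ℝ := 6 * max 0 (1 - ‖z‖ ^ 2) ^ 2

theorem hasDerivAt_max_zero_cube (t : ℝ) :
    HasDerivAt (fun t : ℝ => max 0 t ^ 3) (3 * max 0 t ^ 2) t := by
  rcases lt_trichotomy t 0 with h | h | h
  · have e : (fun t : ℝ => max 0 t ^ 3) =ᶠ[𝓝 t] fun _ => 0 := by
      filter_upwards [Iio_mem_nhds h] with s hs
      rw [max_eq_left (le_of_lt hs)]; norm_num
    rw [max_eq_left h.le]
    simpa using (hasDerivAt_const t (0 : ℝ)).congr_of_eventuallyEq e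
  · subst h
    rw [hasDerivAt_iff_isLittleO_nhds_zero]
    have h1 : (fun h : ℝ => max 0 (0 + h) ^ 3 - max 0 (0 : ℝ) ^ 3 - h • (3 * max 0 (0 : ℝ) ^ 2))
        =O[𝓝 0] fun h : ℝ => h ^ 2 := by
      refine Asymptotics.IsBigO.of_bound 1 ?_
      filter_upwards [Metric.ball_mem_nhds (0 : ℝ) one_pos] with h hh
      rw [Metric.mem_ball, dist_zero_right, Real.norm_eq_abs, abs_lt] at hh
      simp only [zero_add, max_self, smul_eq_mul, Real.norm_eq_abs, one_mul]
      rcases le_total h 0 with h0 | h0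
      · rw [max_eq_left h0]; norm_num; positivity
      · rw [max_eq_right h0]
        norm_num
        rw [abs_of_nonneg h0]; nlinarith [pow_nonneg h0 2]
    exact h1.trans_isLittleO (by simpa using Asymptotics.isLittleO_pow_id (𝕜 := ℝ) (n := 2) (by norm_num))
  · have e : (fun t : ℝ => max 0 t ^ 3) =ᶠ[𝓝 t] fun s => s ^ 3 := by
      filter_upwards [Ioi_mem_nhds h] with s hs
      rw [max_eq_right (le_of_lt hs)]
    rw [max_eq_right h.le]
    simpa using (hasDerivAt_pow 3 t).congr_of_eventuallyEq e

theorem hasFDerivAt_bump (z : EuclideanSpace ℝ (Fin n)) :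
    HasFDerivAt bump (-(bumpWeight z) • innerSL ℝ z) z := by
  have h1 : HasFDerivAt (fun z : EuclideanSpace ℝ (Fin n) => 1 - ‖z‖ ^ 2)
      (-(2 • innerSL ℝ z)) z := by
    simpa using (hasStrictFDerivAt_norm_sq z).hasFDerivAt.const_sub 1
  refine ((hasDerivAt_max_zero_cube _).comp_hasFDerivAt z h1).congr_fderiv ?_
  ext w
  simp [bumpWeight]
  ring

theorem continuous_bump : Continuous (bump (n := n)) := by unfold bump; fun_prop
theorem continuous_bumpWeight : Continuous (bumpWeight (n := n)) := by unfold bumpWeight; fun_prop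
theorem bump_nonneg (z : EuclideanSpace ℝ (Fin n)) : 0 ≤ bump z := by unfold bump; positivity
theorem bumpWeight_nonneg (z : EuclideanSpace ℝ (Fin n)) : 0 ≤ bumpWeight z := by
  unfold bumpWeight; positivity

theorem bump_eq_zero {z : EuclideanSpace ℝ (Fin n)} (hz : 1 < ‖z‖) : bump z = 0 := by
  rw [bump, max_eq_left (by nlinarith)]; norm_num

theorem bumpWeight_eq_zero {z : EuclideanSpace ℝ (Fin n)} (hz : 1 < ‖z‖) : bumpWeight z = 0 := by
  rw [bumpWeight, max_eq_left (by nlinarith)]; norm_num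

theorem bumpWeight_le (z : EuclideanSpace ℝ (Fin n)) : bumpWeight z ≤ 6 := by
  have h1 : max 0 (1 - ‖z‖ ^ 2) ≤ 1 := max_le zero_le_one (by nlinarith [norm_nonneg z])
  have h0 : 0 ≤ max 0 (1 - ‖z‖ ^ 2) := le_max_left _ _
  unfold bumpWeight
  nlinarith

theorem hasCompactSupport_bump : HasCompactSupport (bump (n := n)) :=
  HasCompactSupport.intro (isCompact_closedBall 0 1) fun z hz =>
    bump_eq_zero (by simpa using hz)

theorem hasCompactSupport_bumpWeight : HasCompactSupport (bumpWeight (n := n)) :=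
  HasCompactSupport.intro (isCompact_closedBall 0 1) fun z hz =>
    bumpWeight_eq_zero (by simpa using hz)

theorem integrable_mul_bump {f : EuclideanSpace ℝ (Fin n) → ℝ} (hf : Continuous f) :
    Integrable fun z => f z * bump z :=
  (hf.mul continuous_bump).integrable_of_hasCompactSupport hasCompactSupport_bump.mul_left

theorem integrable_mul_bumpWeight {f : EuclideanSpace ℝ (Fin n) → ℝ} (hf : Continuous f) :
    Integrable fun z => f z * bumpWeight z :=
  (hf.mul continuous_bumpWeight).integrable_of_hasCompactSupport hasCompactSupport_bumpWeight.mul_left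

theorem integral_bumpWeight_pos : 0 < ∫ z : EuclideanSpace ℝ (Fin n), bumpWeight z := by
  refine continuous_bumpWeight.integral_pos_of_hasCompactSupport_nonneg_nonzero
    hasCompactSupport_bumpWeight bumpWeight_nonneg (x := 0) ?_
  simp [bumpWeight]

theorem hasDerivAt_average {u : EuclideanSpace ℝ (Fin n) → ℝ} (hu : ContDiff ℝ 2 u)
    (x : EuclideanSpace ℝ (Fin n)) (τ : ℝ) :
    HasDerivAt (fun τ : ℝ => ∫ z, u (x + τ • z) * bumpWeight z)
      (∫ z, fderiv ℝ u (x + τ • z) z * bumpWeight z) τ := by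
  have hd : Continuous (fderiv ℝ u) := hu.continuous_fderiv (by norm_num)
  obtain ⟨C, hC⟩ := (isCompact_closedBall x (|τ| + 1)).exists_bound_of_continuousOn hd.continuousOn
  have hcont : ∀ s : ℝ, Continuous fun z : EuclideanSpace ℝ (Fin n) => fderiv ℝ u (x + s • z) z := by
    intro s; fun_prop
  refine (hasDerivAt_integral_of_dominated_loc_of_deriv_le
    (F := fun (τ : ℝ) z => u (x + τ • z) * bumpWeight z)
    (F' := fun (τ : ℝ) z => fderiv ℝ u (x + τ • z) z * bumpWeight z)
    (bound := fun z => C * bumpWeight z) (Metric.ball_mem_nhds τ one_pos) ?_ ?_ ?_ ?_ ?_ ?_).2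
  · refine Eventually.of_forall fun s => (integrable_mul_bumpWeight ?_).aestronglyMeasurable
    have := hu.continuous; fun_prop
  · apply integrable_mul_bumpWeight
    have := hu.continuous; fun_prop
  · exact (integrable_mul_bumpWeight (hcont τ)).aestronglyMeasurable
  · refine Eventually.of_forall fun z s hs => ?_
    rw [norm_mul, Real.norm_of_nonneg (bumpWeight_nonneg z)]
    rcases le_or_gt ‖z‖ 1 with hz | hz
    · refine mul_le_mul_of_nonneg_right ?_ (bumpWeight_nonneg z)
      have hs' : |s| ≤ |τ| + 1 := by
        have h1 : |s - τ| < 1 := hs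
        have := abs_sub_abs_le_abs_sub s τ
        linarith
      have h2 := hC (x + s • z) (by
        simp only [Metric.mem_closedBall, dist_self_add_left, norm_smul, Real.norm_eq_abs]
        nlinarith [abs_nonneg s, norm_nonneg z])
      calc ‖fderiv ℝ u (x + s • z) z‖ ≤ ‖fderiv ℝ u (x + s • z)‖ * ‖z‖ :=
            ContinuousLinearMap.le_opNorm _ _
        _ ≤ C * 1 := by
            have := norm_nonneg (fderiv ℝ u (x + s • z))
            gcongr; linarith
        _ = C := mul_one C
    · rw [bumpWeight_eq_zero hz]; simp
  · exact integrable_mul_bumpWeight continuous_const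
  · refine Eventually.of_forall fun z s _ => ?_
    have h1 : HasDerivAt (fun s : ℝ => x + s • z) z s := by
      simpa using ((hasDerivAt_id s).smul_const z).const_add x
    have h2 := ((hu.differentiable (by norm_num)) (x + s • z)).hasFDerivAt.comp_hasDerivAt s h1
    exact h2.mul_const _

theorem integral_fderiv_mul_bumpWeight {u : EuclideanSpace ℝ (Fin n) → ℝ} (hu : ContDiff ℝ 2 u)
    (x : EuclideanSpace ℝ (Fin n)) (τ : ℝ) :
    ∫ z, fderiv ℝ u (x + τ • z) z * bumpWeight z = τ * ∫ z, lap u (x + τ • z) * bump z := by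
  have hd1 : ContDiff ℝ 1 (fderiv ℝ u) := hu.fderiv_right (by norm_num)
  have hd : Continuous (fderiv ℝ u) := hd1.continuous
  have hdd : Continuous (fderiv ℝ (fderiv ℝ u)) := hd1.continuous_fderiv (by norm_num)
  have hpart : ∀ i : Fin n,
      ∫ z, fderiv ℝ u (x + τ • z) (EuclideanSpace.single i 1) * (bumpWeight z * z i) =
      τ * ∫ z, fderiv ℝ (fderiv ℝ u) (x + τ • z) (EuclideanSpace.single i 1)
        (EuclideanSpace.single i 1) * bump z := by
    intro i
    set e : EuclideanSpace ℝ (Fin n) := EuclideanSpace.single i 1 with he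
    have hb : ∀ z : EuclideanSpace ℝ (Fin n), fderiv ℝ bump z e = -(bumpWeight z * z i) := by
      intro z
      rw [(hasFDerivAt_bump z).fderiv]
      simp [he, EuclideanSpace.inner_single_right]
    have hf : ∀ z, HasFDerivAt (fun z => fderiv ℝ u (x + τ • z) e)
        (τ • (fderiv ℝ (fderiv ℝ u) (x + τ • z)).flip e) z := by
      intro z
      have h1 : HasFDerivAt (fun z : EuclideanSpace ℝ (Fin n) => x + τ • z)
          (τ • ContinuousLinearMap.id ℝ _) z := ((hasFDerivAt_id z).const_smul τ).const_add x
      have h2 := ((hd1.differentiable (by norm_num)) (x + τ • z)).hasFDerivAt.comp z h1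
      refine (h2.clm_apply (hasFDerivAt_const e z)).congr_fderiv ?_
      ext w
      simp
    have hf' : ∀ z, fderiv ℝ (fun z => fderiv ℝ u (x + τ • z) e) z e =
        τ * fderiv ℝ (fderiv ℝ u) (x + τ • z) e e := by
      intro z; rw [(hf z).fderiv]; simp
    have h := integral_mul_fderiv_eq_neg_fderiv_mul_of_integrable (μ := volume) (v := e)
      (f := fun z => fderiv ℝ u (x + τ • z) e) (g := bump) ?_ ?_ ?_
      (fun z _ => (hf z).differentiableAt) (fun z _ => (hasFDerivAt_bump z).differentiableAt)
    · simp only [hb, hf'] at h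
      rw [← integral_const_mul]
      simp only [mul_neg, integral_neg, neg_inj] at h
      simpa only [mul_assoc] using h
    · simp only [hf']
      apply integrable_mul_bump
      fun_prop
    · simp only [hb]
      have : Continuous fun z => fderiv ℝ u (x + τ • z) e * -z i := by fun_prop
      refine (integrable_mul_bumpWeight this).congr (Eventually.of_forall fun z => ?_)
      simp only; ring
    · apply integrable_mul_bump
      fun_prop
  have hsum : ∀ z : EuclideanSpace ℝ (Fin n), fderiv ℝ u (x + τ • z) z * bumpWeight z =
      ∑ i, fderiv ℝ u (x + τ • z) (EuclideanSpace.single i 1) * (bumpWeight z * z i) := by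
    intro z
    have hz : z = ∑ i, z i • EuclideanSpace.single i (1 : ℝ) := by
      simpa using ((EuclideanSpace.basisFun (Fin n) ℝ).sum_repr z).symm
    have hL : fderiv ℝ u (x + τ • z) z =
        fderiv ℝ u (x + τ • z) (∑ i, z i • EuclideanSpace.single i (1 : ℝ)) := by rw [← hz]
    rw [hL, map_sum, Finset.sum_mul]
    refine Finset.sum_congr rfl fun i _ => ?_
    rw [map_smul, smul_eq_mul]; ring
  simp only [hsum]
  rw [integral_finsetSum]
  · simp only [hpart, lap, Finset.sum_mul]
    rw [integral_finsetSum, Finset.mul_sum]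
    intro i _
    apply integrable_mul_bump
    fun_prop
  · intro i _
    have : Continuous fun z : EuclideanSpace ℝ (Fin n) =>
      fderiv ℝ u (x + τ • z) (EuclideanSpace.single i 1) * z i := by fun_prop
    refine (integrable_mul_bumpWeight this).congr (Eventually.of_forall fun z => ?_)
    simp only; ring

/-- Averaged mean value inequality. -/
theorem abs_le_average_add {u : EuclideanSpace ℝ (Fin n) → ℝ} (hu : ContDiff ℝ 2 u)
    (x : EuclideanSpace ℝ (Fin n)) {ρ M : ℝ} (hρ : 0 ≤ ρ)
    (hM : ∀ y, ‖y - x‖ ≤ ρ → |lap u y| ≤ M) :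
    |u x| * ∫ z : EuclideanSpace ℝ (Fin n), bumpWeight z ≤
      (∫ z, |u (x + ρ • z)| * bumpWeight z) + ρ ^ 2 * M * ∫ z : EuclideanSpace ℝ (Fin n), bump z := by
  have hM0 : 0 ≤ M := (abs_nonneg _).trans (hM x (by simpa using hρ))
  have hb0 : 0 ≤ ∫ z : EuclideanSpace ℝ (Fin n), bump z := integral_nonneg bump_nonneg
  have hder : ∀ τ ∈ Set.Icc 0 ρ, HasDerivWithinAt (fun τ : ℝ => ∫ z, u (x + τ • z) * bumpWeight z)
      (τ * ∫ z, lap u (x + τ • z) * bump z) (Set.Icc 0 ρ) τ := by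
    intro τ _
    rw [← integral_fderiv_mul_bumpWeight hu]
    exact (hasDerivAt_average hu x τ).hasDerivWithinAt
  have hbound : ∀ τ ∈ Set.Ico 0 ρ, ‖τ * ∫ z, lap u (x + τ • z) * bump z‖ ≤
      ρ * (M * ∫ z : EuclideanSpace ℝ (Fin n), bump z) := by
    intro τ hτ
    rw [norm_mul, Real.norm_of_nonneg hτ.1]
    refine mul_le_mul hτ.2.le ?_ (norm_nonneg _) hρ
    rw [← integral_const_mul]
    refine norm_integral_le_of_norm_le ?_ (Eventually.of_forall fun z => ?_)
    · exact integrable_mul_bump continuous_const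
    · rw [norm_mul, Real.norm_of_nonneg (bump_nonneg z), Real.norm_eq_abs]
      rcases le_or_gt ‖z‖ 1 with hz | hz
      · refine mul_le_mul_of_nonneg_right (hM _ ?_) (bump_nonneg z)
        rw [add_sub_cancel_left, norm_smul, Real.norm_of_nonneg hτ.1]
        nlinarith [hτ.1, hτ.2, norm_nonneg z]
      · rw [bump_eq_zero hz]; simp
  have h := norm_image_sub_le_of_norm_deriv_le_segment' hder hbound ρ ⟨hρ, le_rfl⟩
  simp only [zero_smul, add_zero, integral_const_mul, sub_zero] at h
  have h2 : |∫ z, u (x + ρ • z) * bumpWeight z| ≤ ∫ z, |u (x + ρ • z)| * bumpWeight z := by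
    refine norm_integral_le_of_norm_le (f := fun z => u (x + ρ • z) * bumpWeight z) ?_
      (Eventually.of_forall fun z => ?_)
    · apply integrable_mul_bumpWeight
      have := hu.continuous; fun_prop
    · rw [norm_mul, Real.norm_of_nonneg (bumpWeight_nonneg z), Real.norm_eq_abs]
  have h3 : |u x * ∫ z : EuclideanSpace ℝ (Fin n), bumpWeight z| =
      |u x| * ∫ z : EuclideanSpace ℝ (Fin n), bumpWeight z := by
    rw [abs_mul, abs_of_pos integral_bumpWeight_pos]
  rw [Real.norm_eq_abs, abs_sub_comm] at h
  have h4 := abs_sub_abs_le_abs_sub (u x * ∫ z : EuclideanSpace ℝ (Fin n), bumpWeight z)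
    (∫ z, u (x + ρ • z) * bumpWeight z)
  rw [h3] at h4
  nlinarith

end MeanValue

section LinearDecay

variable {n : ℕ} {a b : ℝ → ℝ} {φ ψ : EuclideanSpace ℝ (Fin n) → ℝ}

/-- Coefficients of the linearized system: positive, continuous, with power bounds at infinity. -/
structure LinearCoeff (a b : ℝ → ℝ) : Prop where
  a_cont : Continuous a
  b_cont : Continuous b
  a_pos : ∀ r, 0 < a r
  b_pos : ∀ r, 0 < b r
  a_lower : ∃ c > 0, ∀ r, 1 ≤ r → c * r ^ (-(1 / 100) : ℝ) ≤ a r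
  a_upper : ∃ C > 0, ∀ r, 1 ≤ r → a r ≤ C * r ^ (1 / 100 : ℝ)
  b_upper : ∃ C > 0, ∀ r, 1 ≤ r → b r ≤ C * r ^ (-5 : ℝ)

/-- A solution of the linearized system with radial coefficients. -/
structure LinearPair (a b : ℝ → ℝ) (φ ψ : EuclideanSpace ℝ (Fin n) → ℝ) : Prop where
  hφ : ContDiff ℝ 2 φ
  hψ : ContDiff ℝ 2 ψ
  eφ : ∀ x, -lap φ x = a ‖x‖ * ψ x
  eψ : ∀ x, -lap ψ x = b ‖x‖ * φ x

theorem tendsto_cocompact_zero_iff {f : EuclideanSpace ℝ (Fin n) → ℝ}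
    (hf : Tendsto f (cocompact _) (𝓝 0)) {m : ℝ} (hm : 0 < m) :
    ∃ R, ∀ x, R < ‖x‖ → |f x| < m := by
  have h := hf.eventually (Metric.ball_mem_nhds 0 hm)
  rw [← Metric.cobounded_eq_cocompact, ← comap_norm_atTop, eventually_comap] at h
  obtain ⟨R, hR⟩ := eventually_atTop.1 h
  exact ⟨R, fun x hx => by simpa using hR ‖x‖ hx.le x rfl⟩

theorem integral_comp_add_smul_sq {f : EuclideanSpace ℝ (Fin n) → ℝ} (hn : 5 ≤ n)
    (hf : Integrable fun x => f x ^ 2) (x : EuclideanSpace ℝ (Fin n)) {ρ : ℝ} (hρ : 1 ≤ ρ) :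
    Integrable (fun z => f (x + ρ • z) ^ 2) ∧
    ∫ z, f (x + ρ • z) ^ 2 ≤ ρ ^ (-5 : ℝ) * ∫ z, f z ^ 2 := by
  have hρ0 : 0 < ρ := by linarith
  have h1 : Integrable fun z => f (x + z) ^ 2 := hf.comp_add_left x
  constructor
  · exact h1.comp_smul hρ0.ne'
  · rw [Measure.integral_comp_smul volume (fun z => f (x + z) ^ 2) ρ,
      integral_add_left_eq_self (μ := volume) (fun z => f z ^ 2) x]
    simp only [finrank_euclideanSpace, Fintype.card_fin, smul_eq_mul]
    refine mul_le_mul_of_nonneg_right ?_ (integral_nonneg fun z => sq_nonneg _)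
    rw [abs_of_nonneg (by positivity), Real.rpow_neg hρ0.le]
    have : ρ ^ (5 : ℝ) ≤ ρ ^ n := by
      rw [← Real.rpow_natCast]
      exact Real.rpow_le_rpow_of_exponent_le hρ (by exact_mod_cast hn)
    gcongr

theorem integral_abs_mul_bumpWeight_le {f : EuclideanSpace ℝ (Fin n) → ℝ} (hn : 5 ≤ n)
    (hf : Integrable fun x => f x ^ 2) (hfc : Continuous f) (x : EuclideanSpace ℝ (Fin n)) {ρ : ℝ}
    (hρ : 1 ≤ ρ) :
    ∫ z, |f (x + ρ • z)| * bumpWeight z ≤ ρ ^ (-(5 / 2) : ℝ) * ((∫ z, f z ^ 2) +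
      6 * ∫ z : EuclideanSpace ℝ (Fin n), bumpWeight z) := by
  have hρ0 : 0 < ρ := by linarith
  obtain ⟨h1, h2⟩ := integral_comp_add_smul_sq hn hf x hρ
  have hb : Integrable (bumpWeight (n := n)) := by
    simpa using integrable_mul_bumpWeight (n := n) (f := fun _ => (1:ℝ)) continuous_const
  set l := ρ ^ (5 / 2 : ℝ) with hl
  have hl0 : 0 < l := by positivity
  have e1 : ρ ^ (-(5 / 2) : ℝ) = l⁻¹ := Real.rpow_neg hρ0.le _
  have e2 : l * ρ ^ (-5 : ℝ) = l⁻¹ := by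
    rw [← e1, hl, ← Real.rpow_add hρ0]; norm_num
  have hle : ∫ z, |f (x + ρ • z)| * bumpWeight z ≤
      ∫ z, (l * f (x + ρ • z) ^ 2 + l⁻¹ * (6 * bumpWeight z)) := by
    refine integral_mono (integrable_mul_bumpWeight (by fun_prop))
      ((h1.const_mul l).add ((hb.const_mul 6).const_mul l⁻¹)) fun z => ?_
    simp only
    have g1 := bumpWeight_le z
    have g0 := bumpWeight_nonneg z
    have g2 : bumpWeight z ^ 2 ≤ 6 * bumpWeight z := by nlinarith
    have g3 : |f (x + ρ • z)| * bumpWeight z ≤ l * f (x + ρ • z) ^ 2 + l⁻¹ * bumpWeight z ^ 2 := by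
      have h := sq_nonneg (l * |f (x + ρ • z)| - bumpWeight z)
      have h' : 0 ≤ l⁻¹ * (l * |f (x + ρ • z)| - bumpWeight z) ^ 2 := by positivity
      have e : l⁻¹ * (l * |f (x + ρ • z)| - bumpWeight z) ^ 2 =
          l * f (x + ρ • z) ^ 2 - 2 * (|f (x + ρ • z)| * bumpWeight z) +
            l⁻¹ * bumpWeight z ^ 2 := by
        rw [← sq_abs (f (x + ρ • z))]; field_simp; ring
      have : 0 ≤ |f (x + ρ • z)| * bumpWeight z := by positivity
      linarith
    have : l⁻¹ * bumpWeight z ^ 2 ≤ l⁻¹ * (6 * bumpWeight z) := by gcongr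
    linarith
  rw [integral_add (h1.const_mul l) ((hb.const_mul 6).const_mul l⁻¹), integral_const_mul,
    integral_const_mul, integral_const_mul] at hle
  have := mul_le_mul_of_nonneg_left h2 hl0.le
  rw [← mul_assoc, e2] at this
  rw [e1]
  linarith

theorem continuous_lap {f : EuclideanSpace ℝ (Fin n) → ℝ} (hf : ContDiff ℝ 2 f) :
    Continuous (lap f) := by
  have hd1 : ContDiff ℝ 1 (fderiv ℝ f) := hf.fderiv_right (by norm_num)
  have hdd : Continuous (fderiv ℝ (fderiv ℝ f)) := hd1.continuous_fderiv (by norm_num)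
  unfold lap
  fun_prop

/-- Pointwise decay of the second component from square integrability of `lap φ`. -/
theorem LinearPair.exists_decay_second (hc : LinearCoeff a b) (L : LinearPair a b φ ψ) (hn : 5 ≤ n)
    (hφ0 : Tendsto φ (cocompact _) (𝓝 0)) (hint : Integrable fun x => lap φ x ^ 2) :
    ∃ C R, 1 ≤ R ∧ ∀ x, R < ‖x‖ → |ψ x| ≤ C * ‖x‖ ^ (-(249 / 100) : ℝ) := by
  obtain ⟨R1, hR1⟩ := tendsto_cocompact_zero_iff hφ0 one_pos
  obtain ⟨c, hc0, hca⟩ := hc.a_lower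
  obtain ⟨B, hB0, hB⟩ := hc.b_upper
  set I1 := ∫ z : EuclideanSpace ℝ (Fin n), bumpWeight z with hI1
  set I2 := ∫ z : EuclideanSpace ℝ (Fin n), bump z with hI2
  set J := (∫ z, lap φ z ^ 2) + 6 * I1 with hJ
  have hI1p : 0 < I1 := integral_bumpWeight_pos
  have hI2p : 0 ≤ I2 := integral_nonneg bump_nonneg
  have hJ0 : 0 ≤ J := add_nonneg (integral_nonneg fun z => sq_nonneg _) (by positivity)
  refine ⟨(c⁻¹ * 4 * (8 * J) + 32 * B * I2) / I1, max 2 (2 * R1), by simp, fun x hx => ?_⟩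
  set r := ‖x‖ with hr
  have hr2 : 2 < r := (le_max_left _ _).trans_lt hx
  have hr1 : 2 * R1 < r := (le_max_right _ _).trans_lt hx
  have hr0 : 0 < r := by linarith
  have hnear : ∀ y, ‖y - x‖ ≤ r / 2 → r / 2 ≤ ‖y‖ ∧ ‖y‖ ≤ 2 * r := by
    intro y hy
    have h1 := norm_sub_norm_le x y
    have h2 := norm_sub_norm_le y x
    rw [norm_sub_rev] at h1
    exact ⟨by linarith, by linarith⟩
  have hM : ∀ y, ‖y - x‖ ≤ r / 2 → |lap ψ y| ≤ B * (32 * r ^ (-5 : ℝ)) := by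
    intro y hy
    obtain ⟨h1, h2⟩ := hnear y hy
    rw [← abs_neg, L.eψ, abs_mul, abs_of_pos (hc.b_pos _)]
    have g1 : |φ y| ≤ 1 := by
      rcases eq_or_lt_of_le h1 with h | h
      · exact (hR1 y (by linarith)).le
      · exact (hR1 y (by linarith)).le
    have g2 := hB ‖y‖ (by linarith)
    have g3 : ‖y‖ ^ (-5 : ℝ) ≤ 32 * r ^ (-5 : ℝ) := by
      calc ‖y‖ ^ (-5 : ℝ) ≤ (r / 2) ^ (-5 : ℝ) :=
            Real.rpow_le_rpow_of_nonpos (by linarith) h1 (by norm_num)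
        _ = 32 * r ^ (-5 : ℝ) := by
            rw [Real.div_rpow hr0.le (by norm_num), Real.rpow_neg (by norm_num : (0:ℝ) ≤ 2)]
            norm_num
            ring
    calc b ‖y‖ * |φ y| ≤ b ‖y‖ * 1 := by gcongr; exact (hc.b_pos _).le
      _ ≤ B * ‖y‖ ^ (-5 : ℝ) := by linarith
      _ ≤ _ := by gcongr
  have hmv := abs_le_average_add L.hψ x (by linarith : 0 ≤ r / 2) hM
  have hψb : ∀ y, ‖y - x‖ ≤ r / 2 → |ψ y| ≤ c⁻¹ * 4 * r ^ (1 / 100 : ℝ) * |lap φ y| := by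
    intro y hy
    obtain ⟨h1, h2⟩ := hnear y hy
    have hy0 : 0 < ‖y‖ := by linarith
    have g1 := hca ‖y‖ (by linarith)
    have g2 : |lap φ y| = a ‖y‖ * |ψ y| := by
      rw [← abs_neg, L.eφ, abs_mul, abs_of_pos (hc.a_pos _)]
    have g3 : (4 * r ^ (1 / 100 : ℝ))⁻¹ ≤ ‖y‖ ^ (-(1 / 100) : ℝ) := by
      rw [Real.rpow_neg hy0.le]
      gcongr
      calc ‖y‖ ^ (1 / 100 : ℝ) ≤ (2 * r) ^ (1 / 100 : ℝ) := by gcongr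
        _ = 2 ^ (1 / 100 : ℝ) * r ^ (1 / 100 : ℝ) := Real.mul_rpow (by norm_num) hr0.le
        _ ≤ 4 * r ^ (1 / 100 : ℝ) := by
            gcongr
            calc (2 : ℝ) ^ (1 / 100 : ℝ) ≤ 2 ^ (1 : ℝ) :=
                  Real.rpow_le_rpow_of_exponent_le (by norm_num) (by norm_num)
              _ ≤ 4 := by norm_num
    have g4 : c * (4 * r ^ (1 / 100 : ℝ))⁻¹ * |ψ y| ≤ |lap φ y| := by
      rw [g2]
      refine mul_le_mul_of_nonneg_right (le_trans ?_ g1) (abs_nonneg _)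
      gcongr
    calc |ψ y| = c⁻¹ * 4 * r ^ (1 / 100 : ℝ) * (c * (4 * r ^ (1 / 100 : ℝ))⁻¹ * |ψ y|) := by
          have : 0 < r ^ (1 / 100 : ℝ) := by positivity
          field_simp
      _ ≤ _ := by gcongr
  have hlapc := continuous_lap L.hφ
  have h5 : ∫ z, |ψ (x + (r / 2) • z)| * bumpWeight z ≤
      c⁻¹ * 4 * r ^ (1 / 100 : ℝ) * ∫ z, |lap φ (x + (r / 2) • z)| * bumpWeight z := by
    rw [← integral_const_mul]
    refine integral_mono (integrable_mul_bumpWeight (by have := L.hψ.continuous; fun_prop))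
      ((integrable_mul_bumpWeight (by fun_prop)).const_mul _) fun z => ?_
    simp only
    rcases le_or_gt ‖z‖ 1 with hz | hz
    · rw [← mul_assoc]
      refine mul_le_mul_of_nonneg_right (hψb _ ?_) (bumpWeight_nonneg z)
      rw [add_sub_cancel_left, norm_smul, Real.norm_of_nonneg (by linarith)]
      nlinarith
    · rw [bumpWeight_eq_zero hz]; simp
  have h6 := integral_abs_mul_bumpWeight_le hn hint hlapc x (by linarith : 1 ≤ r / 2)
  have h7 : (r / 2) ^ (-(5 / 2) : ℝ) ≤ 8 * r ^ (-(5 / 2) : ℝ) := by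
    rw [Real.div_rpow hr0.le (by norm_num), Real.rpow_neg (by norm_num : (0:ℝ) ≤ 2), div_inv_eq_mul,
      mul_comm]
    gcongr
    calc (2 : ℝ) ^ (5 / 2 : ℝ) ≤ 2 ^ (3 : ℝ) :=
          Real.rpow_le_rpow_of_exponent_le (by norm_num) (by norm_num)
      _ = 8 := by norm_num
  have e1 : r ^ (1 / 100 : ℝ) * r ^ (-(5 / 2) : ℝ) = r ^ (-(249 / 100) : ℝ) := by
    rw [← Real.rpow_add hr0]; norm_num
  have e2 : r ^ 2 * r ^ (-5 : ℝ) ≤ r ^ (-(249 / 100) : ℝ) := by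
    rw [← Real.rpow_natCast, ← Real.rpow_add hr0]
    exact Real.rpow_le_rpow_of_exponent_le (by linarith) (by norm_num)
  rw [div_mul_eq_mul_div, le_div_iff₀ hI1p]
  calc |ψ x| * I1 ≤ _ := hmv
    _ ≤ c⁻¹ * 4 * r ^ (1 / 100 : ℝ) * (8 * r ^ (-(5 / 2) : ℝ) * J) +
        (r / 2) ^ 2 * (B * (32 * r ^ (-5 : ℝ))) * I2 := by
        gcongr
        refine h5.trans ?_
        gcongr
        refine h6.trans ?_
        gcongr
    _ = c⁻¹ * 4 * (8 * J) * (r ^ (1 / 100 : ℝ) * r ^ (-(5 / 2) : ℝ)) +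
        8 * B * I2 * (r ^ 2 * r ^ (-5 : ℝ)) := by ring
    _ ≤ c⁻¹ * 4 * (8 * J) * r ^ (-(249 / 100) : ℝ) + 32 * B * I2 * r ^ (-(249 / 100) : ℝ) := by
        rw [e1]
        gcongr
        norm_num
    _ = _ := by ring

theorem decay_of_neg_lap_le {f : EuclideanSpace ℝ (Fin n) → ℝ} {C R : ℝ} (hn : 5 ≤ n)
    (hR : 1 ≤ R) (hf : ContDiff ℝ 2 f)
    (hf0 : Tendsto f (cocompact _) (𝓝 0))
    (hlap : ∀ x, R < ‖x‖ → -lap f x ≤ C * ‖x‖ ^ (-(12 / 5) : ℝ)) :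
    ∃ C', ∀ x, R < ‖x‖ → f x ≤ C' * ‖x‖ ^ (-(2 / 5) : ℝ) := by
  have hn' : (5 : ℝ) ≤ n := by exact_mod_cast hn
  obtain ⟨B, hB⟩ := (isCompact_closedBall (0 : EuclideanSpace ℝ (Fin n)) (R + 1)).exists_bound_of_continuousOn
    hf.continuous.continuousOn
  set D := max C (B * (R + 1) ^ (2 / 5 : ℝ)) with hD
  have hB0 : 0 ≤ B := (norm_nonneg _).trans (hB 0 (by simp; linarith))
  have hD0 : 0 ≤ D := le_max_of_le_right (by positivity)
  have hx0 : ∀ x : EuclideanSpace ℝ (Fin n), R < ‖x‖ → x ≠ 0 := fun x hx => by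
    rw [← norm_pos_iff]; linarith
  have cw : ∀ x, R < ‖x‖ → ContDiffAt ℝ 2 (fun x => f x - D * ‖x‖ ^ (-(2 / 5) : ℝ)) x := fun x hx =>
    hf.contDiffAt.sub (contDiffAt_const.mul (contDiffAt_rpow_norm _ (hx0 x hx)))
  have cS : ∀ x : EuclideanSpace ℝ (Fin n), R < ‖x‖ →
      ContDiffAt ℝ 2 (fun x : EuclideanSpace ℝ (Fin n) => 1 + ‖x‖ ^ (-(1 / 5) : ℝ)) x := fun x hx =>
    contDiffAt_const.add (contDiffAt_rpow_norm _ (hx0 x hx))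
  have pS : ∀ x : EuclideanSpace ℝ (Fin n), R < ‖x‖ → 0 < 1 + ‖x‖ ^ (-(1 / 5) : ℝ) := fun x hx => by
    positivity
  have ew : ∀ x, R < ‖x‖ → -lap (fun x => f x - D * ‖x‖ ^ (-(2 / 5) : ℝ)) x ≤ 0 := by
    intro x hx
    rw [lap_sub hf.contDiffAt (contDiffAt_const.mul (contDiffAt_rpow_norm _ (hx0 x hx))),
      lap_const_mul D (contDiffAt_rpow_norm _ (hx0 x hx)), lap_rpow_norm (2 / 5) (hx0 x hx)]
    have h1 := hlap x hx
    have hp : 0 < ‖x‖ := norm_pos_iff.2 (hx0 x hx)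
    rw [show (-(2 / 5) - 2 : ℝ) = -(12 / 5) by norm_num]
    have h2 : C * ‖x‖ ^ (-(12 / 5) : ℝ) ≤ D * ‖x‖ ^ (-(12 / 5) : ℝ) := by
      gcongr; exact le_max_left _ _
    have h3 : D * ‖x‖ ^ (-(12 / 5) : ℝ) * 1 ≤
        D * ‖x‖ ^ (-(12 / 5) : ℝ) * (2 / 5 * ((n : ℝ) - 2 - 2 / 5)) := by
      gcongr; linarith
    linarith
  have eS : ∀ x : EuclideanSpace ℝ (Fin n), R < ‖x‖ →
      0 < -lap (fun x : EuclideanSpace ℝ (Fin n) => 1 + ‖x‖ ^ (-(1 / 5) : ℝ)) x := by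
    intro x hx
    have hp : 0 < ‖x‖ := norm_pos_iff.2 (hx0 x hx)
    have hconst : lap (fun _ : EuclideanSpace ℝ (Fin n) => (1 : ℝ)) x = 0 := by
      simp [lap]
    rw [lap_add contDiffAt_const (contDiffAt_rpow_norm _ (hx0 x hx)), lap_rpow_norm _ (hx0 x hx),
      hconst]
    have : 0 < ((1 : ℝ) / 5 * (n - 2 - 1 / 5)) := by linarith
    have := mul_pos this (Real.rpow_pos_of_pos hp (-(1 / 5) - 2))
    linarith
  have hin : ∀ x, R < ‖x‖ → ‖x‖ < R + 1 → f x - D * ‖x‖ ^ (-(2 / 5) : ℝ) ≤ 0 := by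
    intro x hx hx2
    have hp : 0 < ‖x‖ := norm_pos_iff.2 (hx0 x hx)
    have h1 := (le_abs_self _).trans (hB x (by simpa using hx2.le))
    have h2 : B * ‖x‖ ^ (2 / 5 : ℝ) ≤ D := le_trans (by gcongr) (le_max_right _ _)
    have h3 : f x ≤ D * ‖x‖ ^ (-(2 / 5) : ℝ) := by
      rw [Real.rpow_neg hp.le, ← div_eq_mul_inv, le_div_iff₀ (by positivity)]
      refine le_trans ?_ h2
      gcongr
    linarith
  have hbd : ∀ m > 0, ∃ R', ∀ x, R < ‖x‖ → R' < ‖x‖ →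
      f x - D * ‖x‖ ^ (-(2 / 5) : ℝ) ≤ m * (1 + ‖x‖ ^ (-(1 / 5) : ℝ)) := by
    intro m hm
    obtain ⟨R', hR'⟩ := tendsto_cocompact_zero_iff hf0 hm
    refine ⟨R', fun x _ hx' => ?_⟩
    have h1 := (abs_lt.1 (hR' x hx')).2
    have h2 : 0 ≤ D * ‖x‖ ^ (-(2 / 5) : ℝ) := by positivity
    have h3 : 0 ≤ m * ‖x‖ ^ (-(1 / 5) : ℝ) := by positivity
    linarith
  have main := exterior_max_principle (n := n) (R := R) (c11 := fun _ => 0) (c12 := fun _ => 0)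
    (c21 := fun _ => 0) (c22 := fun _ => 0) cw cw cS cS pS pS (fun _ _ => le_rfl) (fun _ _ => le_rfl)
    (by simpa using ew) (by simpa using ew) (by simpa using eS) (by simpa using eS)
    (fun x h1 h2 => ⟨hin x h1 h2, hin x h1 h2⟩)
    (fun m hm => (hbd m hm).imp fun R' h x h1 h2 => ⟨h x h1 h2, h x h1 h2⟩)
  exact ⟨D, fun x hx => by linarith [(main x hx).1]⟩

theorem LinearPair.exists_decay (hc : LinearCoeff a b) (L : LinearPair a b φ ψ) (hn : 5 ≤ n)
    (hφ0 : Tendsto φ (cocompact _) (𝓝 0)) (hint : Integrable fun x => lap φ x ^ 2) :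
    ∃ C R, 0 < C ∧ 1 ≤ R ∧ ∀ x, R < ‖x‖ → |φ x| ≤ C * ‖x‖ ^ (-(2 / 5) : ℝ) ∧
      |ψ x| ≤ C * ‖x‖ ^ (-(12 / 5) : ℝ) := by
  obtain ⟨C1, R, hR, hψ⟩ := L.exists_decay_second hc hn hφ0 hint
  obtain ⟨A, hA0, hA⟩ := hc.a_upper
  have hC1 : ∀ x : EuclideanSpace ℝ (Fin n), R < ‖x‖ → ‖x‖ ^ (-(249 / 100) : ℝ) ≤ ‖x‖ ^ (-(12 / 5) : ℝ) :=
    fun x hx => Real.rpow_le_rpow_of_exponent_le (by linarith) (by norm_num)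
  have hlap : ∀ x, R < ‖x‖ → |lap φ x| ≤ A * |C1| * ‖x‖ ^ (-(12 / 5) : ℝ) := by
    intro x hx
    have hp : 0 < ‖x‖ := by linarith
    rw [← abs_neg, L.eφ, abs_mul, abs_of_pos (hc.a_pos _)]
    calc a ‖x‖ * |ψ x| ≤ A * ‖x‖ ^ (1 / 100 : ℝ) * (|C1| * ‖x‖ ^ (-(249 / 100) : ℝ)) := by
          gcongr
          · exact hA _ (by linarith)
          · refine (hψ x hx).trans ?_
            gcongr; exact le_abs_self _
      _ = A * |C1| * ‖x‖ ^ (-(248 / 100) : ℝ) := by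
          rw [show (-(248 / 100) : ℝ) = 1 / 100 + -(249 / 100) by norm_num, Real.rpow_add hp]; ring
      _ ≤ _ := mul_le_mul_of_nonneg_left
          (Real.rpow_le_rpow_of_exponent_le (by linarith) (by norm_num)) (by positivity)
  obtain ⟨D1, h1⟩ := decay_of_neg_lap_le hn hR L.hφ hφ0 (fun x hx =>
    (neg_le_abs _).trans (hlap x hx))
  obtain ⟨D2, h2⟩ := decay_of_neg_lap_le (f := fun y => -φ y) hn hR L.hφ.neg
    (by simpa using hφ0.neg) (fun x hx => by
      rw [lap_neg L.hφ.contDiffAt, neg_neg]; exact (le_abs_self _).trans (hlap x hx))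
  refine ⟨|D1| + |D2| + |C1| + 1, R, by positivity, hR, fun x hx => ⟨?_, ?_⟩⟩
  · have hp : 0 ≤ ‖x‖ ^ (-(2 / 5) : ℝ) := by positivity
    have g1 := h1 x hx
    have g2 := h2 x hx
    have g3 := mul_le_mul_of_nonneg_right (le_abs_self D1) hp
    have g4 := mul_le_mul_of_nonneg_right (le_abs_self D2) hp
    have g5 : 0 ≤ |D1| * ‖x‖ ^ (-(2 / 5) : ℝ) := by positivity
    have g6 : 0 ≤ |D2| * ‖x‖ ^ (-(2 / 5) : ℝ) := by positivity
    have g7 : 0 ≤ |C1| * ‖x‖ ^ (-(2 / 5) : ℝ) := by positivity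
    rw [abs_le]
    constructor <;> linarith
  · have hp : 0 ≤ ‖x‖ ^ (-(12 / 5) : ℝ) := by positivity
    calc |ψ x| ≤ C1 * ‖x‖ ^ (-(249 / 100) : ℝ) := hψ x hx
      _ ≤ |C1| * ‖x‖ ^ (-(12 / 5) : ℝ) :=
        mul_le_mul (le_abs_self _) (hC1 x hx) (by positivity) (abs_nonneg _)
      _ ≤ _ := by
        gcongr
        linarith [abs_nonneg D1, abs_nonneg D2]

end LinearDecay

namespace RadialProfile

variable {n : ℕ} {N p q α β : ℝ} {u v u1 v1 : ℝ → ℝ}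

/-- Powers of `v` with small exponent are almost bounded above and below. -/
theorem exists_v_rpow_bounds (P : RadialProfile N p q u v u1 v1) {t δ : ℝ} (hδ : 0 ≤ δ)
    (ht : (N - 2) * |t| ≤ δ) :
    ∃ c > 0, ∃ C > 0, ∀ r, 1 ≤ r → c * r ^ (-δ) ≤ v r ^ t ∧ v r ^ t ≤ C * r ^ δ := by
  have hN := P.two_lt
  have hv0 := P.v_pos 0
  have hv1 := P.v_pos 1
  rcases le_total 0 t with h | h
  · rw [abs_of_nonneg h] at ht
    refine ⟨v 1 ^ t, by positivity, v 0 ^ t, by positivity, fun r hr => ⟨?_, ?_⟩⟩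
    · have hr0 : 0 < r := by linarith
      calc v 1 ^ t * r ^ (-δ) ≤ v 1 ^ t * r ^ (-(N - 2) * t) := by
            gcongr
            linarith
        _ = (v 1 * r ^ (-(N - 2))) ^ t := by
            rw [Real.mul_rpow hv1.le (by positivity), ← Real.rpow_mul hr0.le]
        _ ≤ v r ^ t := Real.rpow_le_rpow (by positivity) (P.symm.rpow_le_u hr) h
    · have h1 : v r ^ t ≤ v 0 ^ t := Real.rpow_le_rpow (P.v_pos r).le (P.symm.u_le (by linarith)) h
      have h2 : 1 ≤ r ^ δ := Real.one_le_rpow hr hδ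
      have h3 : 0 < v 0 ^ t := by positivity
      nlinarith
  · rw [abs_of_nonpos h] at ht
    refine ⟨v 0 ^ t, by positivity, v 1 ^ t, by positivity, fun r hr => ⟨?_, ?_⟩⟩
    · have h1 : v 0 ^ t ≤ v r ^ t :=
        Real.rpow_le_rpow_of_nonpos (P.v_pos r) (P.symm.u_le (by linarith)) h
      have h2 : r ^ (-δ) ≤ 1 := Real.rpow_le_one_of_one_le_of_nonpos hr (by linarith)
      have h3 : 0 < v 0 ^ t := by positivity
      nlinarith
    · have hr0 : 0 < r := by linarith
      calc v r ^ t ≤ (v 1 * r ^ (-(N - 2))) ^ t :=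
            Real.rpow_le_rpow_of_nonpos (by positivity) (P.symm.rpow_le_u hr) h
        _ = v 1 ^ t * r ^ (-(N - 2) * t) := by
            rw [Real.mul_rpow hv1.le (by positivity), ← Real.rpow_mul hr0.le]
        _ ≤ v 1 ^ t * r ^ δ := by
            gcongr
            linarith

theorem linearCoeff (P : RadialProfile N p q u v u1 v1) (hδ : (N - 2) * |p - 1| ≤ 1 / 100)
    (hq1 : 1 < q) {s C R : ℝ} (hu : ∀ r, R < r → u r ≤ C * r ^ (-s)) (hs : 5 ≤ s * (q - 1)) :
    LinearCoeff (fun r => p * v r ^ (p - 1)) (fun r => q * u r ^ (q - 1)) := by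
  have hp := P.p_pos
  have hq := P.q_pos
  obtain ⟨c, hc, A, hA, hcA⟩ := P.exists_v_rpow_bounds (by norm_num) hδ
  refine ⟨?_, ?_, ?_, ?_, ?_, ?_, ?_⟩
  · exact continuous_const.mul (P.v_cont.rpow_const fun r => Or.inl (P.v_pos r).ne')
  · exact continuous_const.mul (P.u_cont.rpow_const fun r => Or.inl (P.u_pos r).ne')
  · intro r; have := P.v_pos r; positivity
  · intro r; have := P.u_pos r; positivity
  · refine ⟨p * c, by positivity, fun r hr => ?_⟩
    rw [mul_assoc]; exact mul_le_mul_of_nonneg_left (hcA r hr).1 hp.le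
  · refine ⟨p * A, by positivity, fun r hr => ?_⟩
    rw [mul_assoc]; exact mul_le_mul_of_nonneg_left (hcA r hr).2 hp.le
  · set R' := max R 1 with hR'
    have hu0 := P.u_pos 0
    have hR1 : 1 ≤ R' := le_max_right _ _
    refine ⟨q * (|C| ^ (q - 1) + u 0 ^ (q - 1) * R' ^ (5 : ℝ)), by positivity, fun r hr => ?_⟩
    have hr0 : 0 < r := by linarith
    have hur := P.u_pos r
    rw [mul_assoc]
    refine mul_le_mul_of_nonneg_left ?_ hq.le
    rw [add_mul]
    rcases le_or_gt r R' with h | h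
    · have h1 : u r ^ (q - 1) ≤ u 0 ^ (q - 1) :=
        Real.rpow_le_rpow hur.le (P.u_le hr0.le) (by linarith)
      have h2 : 1 ≤ R' ^ (5 : ℝ) * r ^ (-5 : ℝ) := by
        rw [Real.rpow_neg hr0.le, ← div_eq_mul_inv, one_le_div (by positivity)]
        gcongr
      have h3 : 0 < u 0 ^ (q - 1) := by positivity
      have h4 : 0 ≤ |C| ^ (q - 1) * r ^ (-5 : ℝ) := by positivity
      nlinarith
    · have h1 : u r ≤ |C| * r ^ (-s) := (hu r ((le_max_left _ _).trans_lt h)).trans (by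
        gcongr; exact le_abs_self C)
      have h2 : u r ^ (q - 1) ≤ |C| ^ (q - 1) * r ^ (-5 : ℝ) := by
        calc u r ^ (q - 1) ≤ (|C| * r ^ (-s)) ^ (q - 1) := Real.rpow_le_rpow hur.le h1 (by linarith)
          _ = |C| ^ (q - 1) * r ^ (-s * (q - 1)) := by
              rw [Real.mul_rpow (abs_nonneg C) (by positivity), ← Real.rpow_mul hr0.le]
          _ ≤ _ := mul_le_mul_of_nonneg_left
              (Real.rpow_le_rpow_of_exponent_le hr (by linarith)) (by positivity)
      have h4 : 0 ≤ u 0 ^ (q - 1) * R' ^ (5 : ℝ) * r ^ (-5 : ℝ) := by positivity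
      linarith

theorem exists_h_lower (P : RadialProfile N p q u v u1 v1) {δ : ℝ} (hδ : (N - 2) * |p - 1| ≤ δ) :
    ∃ c > 0, ∀ r, 1 ≤ r → c * r ^ (-(N - 2 + δ)) ≤ -u1 r / r := by
  have hN := P.two_lt
  have hv1 := P.v_pos 1
  refine ⟨v 1 ^ p / N, by positivity, fun r hr => ?_⟩
  have hr0 : 0 < r := by linarith
  refine le_trans ?_ (P.h_lower hr0).le
  rw [div_mul_eq_mul_div]
  gcongr
  calc v 1 ^ p * r ^ (-(N - 2 + δ)) ≤ v 1 ^ p * r ^ (-(N - 2) * p) := by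
        gcongr
        have := mul_le_mul_of_nonneg_left (le_abs_self (p - 1)) (by linarith : 0 ≤ N - 2)
        nlinarith
    _ = (v 1 * r ^ (-(N - 2))) ^ p := by
        rw [Real.mul_rpow hv1.le (by positivity), ← Real.rpow_mul hr0.le]
    _ ≤ v r ^ p := Real.rpow_le_rpow (by positivity) (P.symm.rpow_le_u hr) P.p_pos.le

theorem exists_k_lower (P : RadialProfile N p q u v u1 v1) :
    ∃ c > 0, ∀ r, 1 ≤ r → c * r ^ (-N) ≤ -v1 r / r := by
  refine ⟨-v1 1, by linarith [P.v1_neg one_pos], fun r hr => ?_⟩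
  have hr0 : 0 < r := by linarith
  have hanti : AntitoneOn (fun x => x ^ (N - 1) * v1 x) (Set.Ici 1) := by
    refine antitoneOn_of_deriv_nonpos (convex_Ici 1) ?_ ?_ ?_
    · intro x hx
      exact (P.symm.hasDerivAt_flux (lt_of_lt_of_le one_pos hx)).continuousAt.continuousWithinAt
    · intro x hx
      rw [interior_Ici] at hx
      exact (P.symm.hasDerivAt_flux (lt_trans one_pos hx)).differentiableAt.differentiableWithinAt
    · intro x hx
      rw [interior_Ici] at hx
      have hx0 : 0 < x := lt_trans one_pos hx
      rw [(P.symm.hasDerivAt_flux hx0).deriv]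
      have := P.u_pos x
      have : 0 ≤ x ^ (N - 1) * u x ^ q := by positivity
      linarith
  have h := hanti (Set.mem_Ici.2 le_rfl) (Set.mem_Ici.2 hr) hr
  simp only [Real.one_rpow, one_mul] at h
  rw [le_div_iff₀ hr0, mul_assoc, ← Real.rpow_add_one hr0.ne', show -N + 1 = -(N - 1) by ring,
    Real.rpow_neg hr0.le, ← div_eq_mul_inv, div_le_iff₀ (by positivity)]
  linarith

end RadialProfile

section Antisymmetrization

variable {n : ℕ}

/-- Reflection across the hyperplane orthogonal to `e`. -/
noncomputable def hyperRefl (e : EuclideanSpace ℝ (Fin n)) :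
    EuclideanSpace ℝ (Fin n) ≃ₗᵢ[ℝ] EuclideanSpace ℝ (Fin n) :=
  (Submodule.span ℝ {e})ᗮ.reflection

theorem hyperRefl_apply {e : EuclideanSpace ℝ (Fin n)} (he : ‖e‖ = 1) (x : EuclideanSpace ℝ (Fin n)) :
    hyperRefl e x = x - (2 * inner ℝ e x) • e := by
  rw [hyperRefl, Submodule.reflection_orthogonal_apply, Submodule.reflection_singleton_apply]
  simp only [he]
  rw [neg_sub]
  congr 1
  simp [two_smul, two_mul, add_smul]

/-- Antisymmetrization with respect to two reflections. -/
noncomputable def antisym (e e' : EuclideanSpace ℝ (Fin n)) (f : EuclideanSpace ℝ (Fin n) → ℝ)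
    (x : EuclideanSpace ℝ (Fin n)) : ℝ :=
  (f x - f (hyperRefl e x)) - (f (hyperRefl e' x) - f (hyperRefl e (hyperRefl e' x)))

theorem contDiff_antisym {e e' : EuclideanSpace ℝ (Fin n)} {f : EuclideanSpace ℝ (Fin n) → ℝ}
    (hf : ContDiff ℝ 2 f) : ContDiff ℝ 2 (antisym e e' f) := by
  have h := fun σ : EuclideanSpace ℝ (Fin n) ≃ₗᵢ[ℝ] EuclideanSpace ℝ (Fin n) =>
    hf.comp σ.toContinuousLinearEquiv.contDiff
  exact (hf.sub (h (hyperRefl e))).sub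
    ((h (hyperRefl e')).sub (h ((hyperRefl e').trans (hyperRefl e))))

theorem lap_antisym {e e' : EuclideanSpace ℝ (Fin n)} {f : EuclideanSpace ℝ (Fin n) → ℝ}
    (hf : ContDiff ℝ 2 f) (x : EuclideanSpace ℝ (Fin n)) :
    lap (antisym e e' f) x = antisym e e' (lap f) x := by
  have h : ∀ σ : EuclideanSpace ℝ (Fin n) ≃ₗᵢ[ℝ] EuclideanSpace ℝ (Fin n),
      ContDiffAt ℝ 2 (fun y => f (σ y)) x := fun σ =>
    (hf.comp σ.toContinuousLinearEquiv.contDiff).contDiffAt (x := x)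
  have e3 := lap_comp_linearIsometryEquiv hf ((hyperRefl e').trans (hyperRefl e)) (x := x)
  have h1 := h (hyperRefl e)
  have h2 := h (hyperRefl e')
  have h3 : ContDiffAt ℝ 2 (fun y => f (hyperRefl e (hyperRefl e' y))) x :=
    h ((hyperRefl e').trans (hyperRefl e))
  unfold antisym
  simp only [LinearIsometryEquiv.trans_apply] at e3
  rw [lap_sub (hf.contDiffAt.sub h1) (h2.sub h3), lap_sub hf.contDiffAt h1, lap_sub h2 h3,
    lap_comp_linearIsometryEquiv hf, lap_comp_linearIsometryEquiv hf, e3]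

theorem LinearPair.antisym {a b : ℝ → ℝ} {φ ψ : EuclideanSpace ℝ (Fin n) → ℝ}
    (L : LinearPair a b φ ψ) (e e' : EuclideanSpace ℝ (Fin n)) :
    LinearPair a b (antisym e e' φ) (antisym e e' ψ) := by
  have h1 : ∀ x, lap φ x = -(a ‖x‖ * ψ x) := fun x => by linarith [L.eφ x]
  have h2 : ∀ x, lap ψ x = -(b ‖x‖ * φ x) := fun x => by linarith [L.eψ x]
  refine ⟨contDiff_antisym L.hφ, contDiff_antisym L.hψ, fun x => ?_, fun x => ?_⟩
  · rw [lap_antisym L.hφ]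
    simp only [_root_.antisym, h1, LinearIsometryEquiv.norm_map]
    ring
  · rw [lap_antisym L.hψ]
    simp only [_root_.antisym, h2, LinearIsometryEquiv.norm_map]
    ring

/-- A doubly antisymmetrized function is controlled by the product of the two coordinates. -/
theorem exists_antisym_le {e e' : EuclideanSpace ℝ (Fin n)} (he : ‖e‖ = 1) (he' : ‖e'‖ = 1)
    (hee : inner ℝ e e' = 0) {f : EuclideanSpace ℝ (Fin n) → ℝ} (hf : ContDiff ℝ 2 f) (R : ℝ) :
    ∃ C ≥ 0, ∀ x, ‖x‖ ≤ R → |antisym e e' f x| ≤ C * (|inner ℝ e x| * |inner ℝ e' x|) := by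
  have hd1 : ContDiff ℝ 1 (fderiv ℝ f) := hf.fderiv_right (by norm_num)
  have hdd : Continuous (fderiv ℝ (fderiv ℝ f)) := hd1.continuous_fderiv (by norm_num)
  have hddn : Continuous fun x => ‖fderiv ℝ (fderiv ℝ f) x‖ :=
    (@continuous_norm (EuclideanSpace ℝ (Fin n) →L[ℝ] EuclideanSpace ℝ (Fin n) →L[ℝ] ℝ) _).comp hdd
  obtain ⟨M, hM⟩ := (isCompact_closedBall (0 : EuclideanSpace ℝ (Fin n)) R).exists_bound_of_continuousOn
    hddn.continuousOn
  have hM' : ∀ x ∈ Metric.closedBall (0 : EuclideanSpace ℝ (Fin n)) R,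
    ‖fderiv ℝ (fderiv ℝ f) x‖ ≤ max M 0 := fun x hx =>
      ((Real.le_norm_self _).trans (hM x hx)).trans (le_max_left _ _)
  refine ⟨4 * max M 0, by positivity, fun x hx => ?_⟩
  have hxb : x ∈ Metric.closedBall (0 : EuclideanSpace ℝ (Fin n)) R := by simpa using hx
  set σ := hyperRefl e with hσ
  set σ' := hyperRefl e' with hσ'
  set s := inner ℝ e x with hs
  set y : ℝ → EuclideanSpace ℝ (Fin n) := fun t => x - (t * (2 * s)) • e with hy
  have hy0 : y 0 = x := by simp [hy]
  have hy1 : y 1 = σ x := by rw [hσ, hyperRefl_apply he]; simp [hy, hs]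
  have hσσ : σ' (σ x) = σ (σ' x) := by
    have h1 : inner ℝ e' e = 0 := by rw [real_inner_comm]; exact hee
    simp only [hσ, hσ', hyperRefl_apply he, hyperRefl_apply he', inner_sub_right, inner_smul_right,
      hee, h1]
    simp only [mul_zero, sub_zero]
    abel
  have hyball : ∀ t ∈ Set.Icc (0 : ℝ) 1, y t ∈ Metric.closedBall (0 : EuclideanSpace ℝ (Fin n)) R := by
    intro t ht
    have h1 : y t = (1 - t) • x + t • σ x := by
      rw [hσ, hyperRefl_apply he]
      simp only [hy, sub_smul, smul_sub, one_smul, smul_smul]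
      rw [hs]; abel
    rw [h1]
    refine (convex_closedBall (0 : EuclideanSpace ℝ (Fin n)) R) hxb ?_ (by linarith [ht.2]) ht.1 (by ring)
    simpa [hσ, LinearIsometryEquiv.norm_map] using hx
  have hyd : ∀ t : ℝ, HasDerivAt y (-((2 * s) • e)) t := by
    intro t
    have h := ((hasDerivAt_id t).mul_const (2 * s)).smul_const e
    simpa using h.const_sub x
  have hfd := hf.differentiable (by norm_num)
  have hFd : ∀ t : ℝ, HasDerivAt (fun t => f (y t) - f (σ' (y t)))
      (fderiv ℝ f (y t) (-((2 * s) • e)) - fderiv ℝ f (σ' (y t)) (-((2 * s) • e))) t := by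
    intro t
    have h1 := (hfd (y t)).hasFDerivAt.comp_hasDerivAt t (hyd t)
    have h2 := (σ'.toContinuousLinearEquiv.hasFDerivAt (x := y t)).comp_hasDerivAt t (hyd t)
    have h3 := (hfd (σ' (y t))).hasFDerivAt.comp_hasDerivAt t h2
    have h4 : σ' (-((2 * s) • e)) = -((2 * s) • e) := by
      rw [hσ', hyperRefl_apply he']
      have h1 : inner ℝ e' e = 0 := by rw [real_inner_comm]; exact hee
      simp [inner_smul_right, h1]
    have h5 : (σ'.toContinuousLinearEquiv : EuclideanSpace ℝ (Fin n) →L[ℝ] _) (-((2 * s) • e)) =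
        -((2 * s) • e) := h4
    rw [h5] at h3
    exact h1.sub h3
  have hbound : ∀ t ∈ Set.Ico (0 : ℝ) 1,
      ‖fderiv ℝ f (y t) (-((2 * s) • e)) - fderiv ℝ f (σ' (y t)) (-((2 * s) • e))‖ ≤
        4 * max M 0 * (|s| * |inner ℝ e' x|) := by
    intro t ht
    have hyt := hyball t ⟨ht.1, ht.2.le⟩
    have hyt' : σ' (y t) ∈ Metric.closedBall (0 : EuclideanSpace ℝ (Fin n)) R := by
      simpa [LinearIsometryEquiv.norm_map] using hyt
    have h1 := (convex_closedBall (0 : EuclideanSpace ℝ (Fin n)) R).norm_image_sub_le_of_norm_fderiv_le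
      (fun z _ => hd1.differentiable (by norm_num) z) hM' hyt' hyt
    have h2 : ‖y t - σ' (y t)‖ = 2 * |inner ℝ e' x| := by
      rw [hσ', hyperRefl_apply he', sub_sub_cancel, norm_smul, he', mul_one, Real.norm_eq_abs, abs_mul]
      have h1 : inner ℝ e' e = 0 := by rw [real_inner_comm]; exact hee
      simp [hy, inner_sub_right, inner_smul_right, h1]
    rw [h2] at h1
    rw [← sub_apply]
    refine (ContinuousLinearMap.le_opNorm _ _).trans ?_
    rw [norm_neg, norm_smul, he, mul_one, Real.norm_eq_abs, abs_mul, abs_two]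
    calc _ ≤ max M 0 * (2 * |inner ℝ e' x|) * (2 * |s|) := by gcongr
      _ = _ := by ring
  have h := norm_image_sub_le_of_norm_deriv_le_segment_01'
    (fun t _ => (hFd t).hasDerivWithinAt) hbound
  rw [hy0, hy1, hσσ] at h
  rw [← Real.norm_eq_abs, ← norm_neg]
  refine le_trans (le_of_eq ?_) h
  congr 1
  simp only [antisym, ← hσ, ← hσ']
  ring

/-- Maximum principle in (the exterior of a ball in) a quadrant. -/
theorem quadrant_max_principle {w1 w2 S1 S2 c11 c12 c21 c22 : EuclideanSpace ℝ (Fin n) → ℝ} {R R1 : ℝ}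
    {e e' : EuclideanSpace ℝ (Fin n)} {O : Set (EuclideanSpace ℝ (Fin n))}
    (hO : O = {x | R < ‖x‖ ∧ 0 < inner ℝ e x ∧ 0 < inner ℝ e' x}) (hRR : R < R1)
    (hw1 : ∀ x ∈ O, ContDiffAt ℝ 2 w1 x) (hw2 : ∀ x ∈ O, ContDiffAt ℝ 2 w2 x)
    (hS1 : ∀ x ∈ O, ContDiffAt ℝ 2 S1 x) (hS2 : ∀ x ∈ O, ContDiffAt ℝ 2 S2 x)
    (S1pos : ∀ x ∈ O, 0 < S1 x) (S2pos : ∀ x ∈ O, 0 < S2 x)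
    (h12 : ∀ x ∈ O, 0 ≤ c12 x) (h21 : ∀ x ∈ O, 0 ≤ c21 x)
    (ew1 : ∀ x ∈ O, -lap w1 x ≤ c11 x * w1 x + c12 x * w2 x)
    (ew2 : ∀ x ∈ O, -lap w2 x ≤ c21 x * w1 x + c22 x * w2 x)
    (eS1 : ∀ x ∈ O, c11 x * S1 x + c12 x * S2 x < -lap S1 x)
    (eS2 : ∀ x ∈ O, c21 x * S1 x + c22 x * S2 x < -lap S2 x)
    (hin : ∀ x ∈ O, ‖x‖ < R1 → w1 x ≤ 0 ∧ w2 x ≤ 0)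
    (hwall : ∀ m > 0, ∀ R', ∃ ρ > 0, ∀ x ∈ O, ‖x‖ ≤ R' → inner ℝ e x < ρ ∨ inner ℝ e' x < ρ →
      w1 x ≤ m * S1 x ∧ w2 x ≤ m * S2 x)
    (hinf : ∀ m > 0, ∃ R', ∀ x ∈ O, R' < ‖x‖ → w1 x ≤ m * S1 x ∧ w2 x ≤ m * S2 x) :
    ∀ x ∈ O, w1 x ≤ 0 ∧ w2 x ≤ 0 := by
  have hc : ∀ e : EuclideanSpace ℝ (Fin n), Continuous fun x => inner ℝ e x := fun e => by fun_prop
  have hOo : IsOpen O := by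
    rw [hO]
    exact (isOpen_lt continuous_const continuous_norm).inter
      ((isOpen_lt continuous_const (hc _)).inter (isOpen_lt continuous_const (hc _)))
  refine system_max_principle hOo hw1 hw2 hS1 hS2 S1pos S2pos h12 h21 ew1 ew2 eS1 eS2 ?_
  intro m hm
  obtain ⟨R', hR'⟩ := hinf m hm
  obtain ⟨ρ, hρ, hwl⟩ := hwall m hm R'
  refine ⟨{x | R1 ≤ ‖x‖ ∧ ‖x‖ ≤ R'} ∩ ({x | ρ ≤ inner ℝ e x} ∩ {x | ρ ≤ inner ℝ e' x}), ?_, ?_, ?_⟩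
  · rintro x ⟨hx1, hx2, hx3⟩
    rw [hO]
    exact ⟨hRR.trans_le hx1.1, hρ.trans_le hx2, hρ.trans_le hx3⟩
  · exact (isCompact_annulus _ _).inter_right ((isClosed_le continuous_const (hc _)).inter
      (isClosed_le continuous_const (hc _)))
  · intro x hx hxK
    rcases lt_or_ge ‖x‖ R1 with h | h
    · obtain ⟨h1, h2⟩ := hin x hx h
      have h3 := mul_pos hm (S1pos x hx)
      have h4 := mul_pos hm (S2pos x hx)
      exact ⟨by linarith, by linarith⟩
    rcases lt_or_ge R' ‖x‖ with h' | h'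
    · exact hR' x hx h'
    refine hwl x hx h' ?_
    by_contra! hc
    exact hxK ⟨⟨h, h'⟩, hc.1, hc.2⟩

end Antisymmetrization

section QuadrantDecay

variable {n : ℕ} {a b : ℝ → ℝ} {φ ψ : EuclideanSpace ℝ (Fin n) → ℝ}

theorem exists_const_mul_rpow_neg_lt {s m : ℝ} (hs : 0 < s) (c : ℝ) (hm : 0 < m) :
    ∃ R ≥ 1, ∀ r, R < r → c * r ^ (-s) < m := by
  have h : Tendsto (fun r : ℝ => c * r ^ (-s)) atTop (𝓝 (c * 0)) :=
    (tendsto_rpow_neg_atTop hs).const_mul c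
  rw [mul_zero] at h
  obtain ⟨R, hR⟩ := eventually_atTop.1 (h.eventually (gt_mem_nhds hm))
  exact ⟨max R 1, le_max_right _ _, fun r hr => hR r ((le_max_left _ _).trans hr.le)⟩

theorem inner_le_norm_of_unit {e : EuclideanSpace ℝ (Fin n)} (he : ‖e‖ = 1)
    (x : EuclideanSpace ℝ (Fin n)) : inner ℝ e x ≤ ‖x‖ := by
  have := real_inner_le_norm e x
  rwa [he, one_mul] at this

/-- Bound for a product of positive coordinates one of which is small. -/
theorem inner_mul_inner_le {e e' x : EuclideanSpace ℝ (Fin n)} (he : ‖e‖ = 1) (he' : ‖e'‖ = 1)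
    {R ρ : ℝ} (hρ : 0 < ρ) (hR : ‖x‖ ≤ R) (h1 : 0 < inner ℝ e x) (h2 : 0 < inner ℝ e' x)
    (h : inner ℝ e x < ρ ∨ inner ℝ e' x < ρ) : inner ℝ e x * inner ℝ e' x ≤ ρ * R := by
  have h3 := (inner_le_norm_of_unit he x).trans hR
  have h4 := (inner_le_norm_of_unit he' x).trans hR
  rcases h with h | h
  · exact mul_le_mul h.le h4 h2.le hρ.le
  · rw [mul_comm]
    exact mul_le_mul h.le h3 h1.le hρ.le

theorem abs_antisym_le {f : EuclideanSpace ℝ (Fin n) → ℝ} {M : ℝ} {x : EuclideanSpace ℝ (Fin n)}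
    (e e' : EuclideanSpace ℝ (Fin n)) (h : ∀ y, ‖y‖ = ‖x‖ → |f y| ≤ M) : |antisym e e' f x| ≤ 4 * M := by
  have h1 := abs_le.1 (h x rfl)
  have h2 := abs_le.1 (h (hyperRefl e x) (by simp))
  have h3 := abs_le.1 (h (hyperRefl e' x) (by simp))
  have h4 := abs_le.1 (h (hyperRefl e (hyperRefl e' x)) (by simp))
  unfold antisym
  rw [abs_le]
  constructor <;> linarith [h1.1, h1.2, h2.1, h2.2, h3.1, h3.2, h4.1, h4.2]

theorem LinearPair.exists_antisym_decay (hc : LinearCoeff a b) (L : LinearPair a b φ ψ) (hn : 5 ≤ n)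
    {Cd Rd : ℝ} (hdec : ∀ x, Rd < ‖x‖ → |φ x| ≤ Cd * ‖x‖ ^ (-(2 / 5) : ℝ) ∧
      |ψ x| ≤ Cd * ‖x‖ ^ (-(12 / 5) : ℝ))
    {e e' : EuclideanSpace ℝ (Fin n)} (he : ‖e‖ = 1) (he' : ‖e'‖ = 1) (hee : inner ℝ e e' = 0) :
    ∃ C R, 1 ≤ R ∧ ∀ x, R < ‖x‖ → 0 < inner ℝ e x → 0 < inner ℝ e' x →
      _root_.antisym e e' φ x ≤ C * (inner ℝ e x * inner ℝ e' x * ‖x‖ ^ (-((n : ℝ) - 1 / 4))) ∧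
      _root_.antisym e e' ψ x ≤
        C * (inner ℝ e x * inner ℝ e' x * ‖x‖ ^ (-((n : ℝ) - 1 / 4 + 201 / 100))) := by
  have hn5 : (5 : ℝ) ≤ n := by exact_mod_cast hn
  obtain ⟨A, hA0, hA⟩ := hc.a_upper
  obtain ⟨B, hB0, hB⟩ := hc.b_upper
  set τ : ℝ := (n : ℝ) - 1 / 4 with hτ
  set K := 1 / (2 * A) with hK
  have hK0 : 0 < K := by positivity
  have hAK : A * K = 1 / 2 := by rw [hK]; field_simp
  obtain ⟨R, hR1, hR⟩ := exists_const_mul_rpow_neg_lt (s := 99 / 100) (by norm_num) B hK0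
  have LA := L.antisym e e'
  set w1 := _root_.antisym e e' φ with hw1
  set w2 := _root_.antisym e e' ψ with hw2
  obtain ⟨D1, hD1, hD1'⟩ := exists_antisym_le he he' hee L.hφ (R + 1)
  obtain ⟨D2, hD2, hD2'⟩ := exists_antisym_le he he' hee L.hψ (R + 1)
  set C := max (D1 * (R + 1) ^ τ) (D2 * (R + 1) ^ (τ + 201 / 100) / K) with hC
  have hC0 : 0 ≤ C := (by positivity : 0 ≤ D1 * (R + 1) ^ τ).trans (le_max_left _ _)
  set O : Set (EuclideanSpace ℝ (Fin n)) := {x | R < ‖x‖ ∧ 0 < inner ℝ e x ∧ 0 < inner ℝ e' x} with hO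
  have hx0 : ∀ x ∈ O, x ≠ 0 := fun x hx => norm_pos_iff.1 (by linarith [hx.1])
  have hxp : ∀ x ∈ O, 0 < ‖x‖ := fun x hx => norm_pos_iff.2 (hx0 x hx)
  have hT : ∀ x ∈ O, ∀ s : ℝ, ContDiffAt ℝ 2
      (fun y : EuclideanSpace ℝ (Fin n) => inner ℝ e y * inner ℝ e' y * ‖y‖ ^ (-s)) x := fun x hx s =>
    ((contDiff_inner_const e).contDiffAt.mul (contDiff_inner_const e').contDiffAt).mul
      (contDiffAt_rpow_norm _ (hx0 x hx))
  have hxx : ∀ x ∈ O, 0 < inner ℝ e x * inner ℝ e' x := fun x hx => mul_pos hx.2.1 hx.2.2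
  have hcoefA : ∀ x ∈ O, ∀ s : ℝ, a ‖x‖ * (K * ‖x‖ ^ (-(s + 201 / 100))) ≤ 1 / 2 * ‖x‖ ^ (-s - 2) := by
    intro x hx s
    have hr := hxp x hx
    have h1 := hA ‖x‖ (hR1.le.trans hx.1.le)
    calc a ‖x‖ * (K * ‖x‖ ^ (-(s + 201 / 100)))
        ≤ A * ‖x‖ ^ (1 / 100 : ℝ) * (K * ‖x‖ ^ (-(s + 201 / 100))) := by gcongr
      _ = A * K * (‖x‖ ^ (1 / 100 : ℝ) * ‖x‖ ^ (-(s + 201 / 100))) := by ring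
      _ = _ := by rw [hAK, ← Real.rpow_add hr]; congr 2; ring
  have hcoefB : ∀ x ∈ O, ∀ s : ℝ, b ‖x‖ * ‖x‖ ^ (-s) ≤ K * ‖x‖ ^ (-(s + 201 / 100) - 2) := by
    intro x hx s
    have hr := hxp x hx
    have h1 := hB ‖x‖ (hR1.le.trans hx.1.le)
    have h2 := (hR ‖x‖ hx.1).le
    calc b ‖x‖ * ‖x‖ ^ (-s) ≤ B * ‖x‖ ^ (-5 : ℝ) * ‖x‖ ^ (-s) := by gcongr
      _ = B * ‖x‖ ^ (-(99 / 100) : ℝ) * ‖x‖ ^ (-(s + 201 / 100) - 2) := by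
        rw [mul_assoc, mul_assoc, ← Real.rpow_add hr, ← Real.rpow_add hr]; congr 2; ring
      _ ≤ _ := by gcongr
  have hlapS : ∀ x ∈ O, lap (fun y : EuclideanSpace ℝ (Fin n) => K * ‖y‖ ^ (-((1 / 5 : ℝ) + 201 / 100))) x =
      K * (-(((1 / 5 : ℝ) + 201 / 100) * (n - 2 - ((1 / 5 : ℝ) + 201 / 100))) *
        ‖x‖ ^ (-((1 / 5 : ℝ) + 201 / 100) - 2)) := fun x hx => by
    rw [lap_const_mul K (contDiffAt_rpow_norm _ (hx0 x hx)), lap_rpow_norm _ (hx0 x hx)]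
  have key := quadrant_max_principle (R := R) (R1 := R + 1) (e := e) (e' := e') (O := O)
    (w1 := fun y => w1 y - C * (inner ℝ e y * inner ℝ e' y * ‖y‖ ^ (-τ)))
    (w2 := fun y => w2 y - C * K * (inner ℝ e y * inner ℝ e' y * ‖y‖ ^ (-(τ + 201 / 100))))
    (S1 := fun y => ‖y‖ ^ (-(1 / 5) : ℝ)) (S2 := fun y => K * ‖y‖ ^ (-((1 / 5 : ℝ) + 201 / 100)))
    (c11 := fun _ => 0) (c12 := fun y => a ‖y‖) (c21 := fun y => b ‖y‖) (c22 := fun _ => 0) hO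
    (by linarith)
    (fun x hx => LA.hφ.contDiffAt.sub (contDiffAt_const.mul (hT x hx _)))
    (fun x hx => LA.hψ.contDiffAt.sub (contDiffAt_const.mul (hT x hx _)))
    (fun x hx => contDiffAt_rpow_norm _ (hx0 x hx))
    (fun x hx => contDiffAt_const.mul (contDiffAt_rpow_norm _ (hx0 x hx)))
    (fun x hx => Real.rpow_pos_of_pos (hxp x hx) _)
    (fun x hx => mul_pos hK0 (Real.rpow_pos_of_pos (hxp x hx) _))
    (fun x _ => (hc.a_pos _).le) (fun x _ => (hc.b_pos _).le) ?_ ?_ ?_ ?_ ?_ ?_ ?_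
  · refine ⟨max C (C * K), R, hR1, fun x hx h1 h2 => ?_⟩
    obtain ⟨k1, k2⟩ := key x ⟨hx, h1, h2⟩
    have hr := hxp x ⟨hx, h1, h2⟩
    constructor
    · refine (sub_nonpos.1 k1).trans ?_
      gcongr; exact le_max_left _ _
    · refine (sub_nonpos.1 k2).trans ?_
      gcongr; exact le_max_right _ _
  · intro x hx
    have hr := hxp x hx
    rw [lap_sub LA.hφ.contDiffAt (contDiffAt_const.mul (hT x hx _)), lap_const_mul _ (hT x hx _),
      lap_inner_mul_inner_mul_rpow_norm hee _ (hx0 x hx)]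
    have h1 := hcoefA x hx τ
    have h2 := LA.eφ x
    have h3 : 1 / 2 * ‖x‖ ^ (-τ - 2) ≤ τ * (n + 2 - τ) * ‖x‖ ^ (-τ - 2) := by
      gcongr; rw [hτ]; nlinarith
    have h4 := mul_le_mul_of_nonneg_left (h1.trans h3) (mul_nonneg hC0 (hxx x hx).le)
    linarith
  · intro x hx
    have hr := hxp x hx
    rw [lap_sub LA.hψ.contDiffAt (contDiffAt_const.mul (hT x hx _)), lap_const_mul _ (hT x hx _),
      lap_inner_mul_inner_mul_rpow_norm hee _ (hx0 x hx)]
    have h1 := hcoefB x hx τ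
    have h2 := LA.eψ x
    have h3 : K * ‖x‖ ^ (-(τ + 201 / 100) - 2) ≤
        K * ((τ + 201 / 100) * (n + 2 - (τ + 201 / 100)) * ‖x‖ ^ (-(τ + 201 / 100) - 2)) := by
      have h5 : 1 ≤ (τ + 201 / 100) * (n + 2 - (τ + 201 / 100)) := by rw [hτ]; nlinarith
      gcongr
      exact le_mul_of_one_le_left (by positivity) h5
    have h4 := mul_le_mul_of_nonneg_left (h1.trans h3) (mul_nonneg hC0 (hxx x hx).le)
    linarith
  · intro x hx
    have hr := hxp x hx
    rw [lap_rpow_norm _ (hx0 x hx)]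
    have h1 := hcoefA x hx (1 / 5)
    have h2 : (1 / 2 : ℝ) * ‖x‖ ^ (-(1 / 5) - 2 : ℝ) < 1 / 5 * (n - 2 - 1 / 5) * ‖x‖ ^ (-(1 / 5) - 2 : ℝ) := by
      have := Real.rpow_pos_of_pos hr (-(1 / 5) - 2 : ℝ)
      apply mul_lt_mul_of_pos_right _ this
      linarith
    linarith
  · intro x hx
    have hr := hxp x hx
    rw [hlapS x hx]
    have h1 := hcoefB x hx (1 / 5)
    have h2 : K * ‖x‖ ^ (-((1 / 5 : ℝ) + 201 / 100) - 2) < K * (((1 / 5 : ℝ) + 201 / 100) *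
        (n - 2 - ((1 / 5 : ℝ) + 201 / 100)) * ‖x‖ ^ (-((1 / 5 : ℝ) + 201 / 100) - 2)) := by
      have := Real.rpow_pos_of_pos hr (-((1 / 5 : ℝ) + 201 / 100) - 2 : ℝ)
      apply mul_lt_mul_of_pos_left _ hK0
      apply lt_mul_of_one_lt_left this
      linarith
    linarith
  · intro x hx hx1
    have hr := hxp x hx
    have e1 : |inner ℝ e x| * |inner ℝ e' x| = inner ℝ e x * inner ℝ e' x := by
      rw [abs_of_pos hx.2.1, abs_of_pos hx.2.2]
    have hX := hxx x hx
    have d1 := (le_abs_self _).trans (hD1' x hx1.le)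
    have d2 := (le_abs_self _).trans (hD2' x hx1.le)
    rw [e1] at d1 d2
    have f1 : D1 ≤ C * ‖x‖ ^ (-τ) := by
      rw [Real.rpow_neg hr.le, ← div_eq_mul_inv, le_div_iff₀ (by positivity)]
      refine le_trans ?_ (le_max_left _ _)
      have : 0 ≤ τ := by rw [hτ]; linarith
      gcongr
    have f2 : D2 ≤ C * K * ‖x‖ ^ (-(τ + 201 / 100)) := by
      rw [Real.rpow_neg hr.le, ← div_eq_mul_inv, le_div_iff₀ (by positivity), ← div_le_iff₀ hK0]
      refine le_trans ?_ (le_max_right _ _)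
      have : 0 ≤ τ := by rw [hτ]; linarith
      gcongr
    have g1 := mul_le_mul_of_nonneg_right f1 hX.le
    have g2 := mul_le_mul_of_nonneg_right f2 hX.le
    exact ⟨by linarith, by linarith⟩
  · intro m hm R'
    rcases le_or_gt R' 0 with hR' | hR'
    · exact ⟨1, one_pos, fun x hx hx' => absurd (hxp x hx) (by linarith)⟩
    obtain ⟨E1, hE1, hE1'⟩ := exists_antisym_le he he' hee L.hφ R'
    obtain ⟨E2, hE2, hE2'⟩ := exists_antisym_le he he' hee L.hψ R'
    set μ := min (R' ^ (-(1 / 5) : ℝ)) (K * R' ^ (-((1 / 5 : ℝ) + 201 / 100))) with hμ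
    have hμ0 : 0 < μ := lt_min (by positivity) (by positivity)
    refine ⟨m * μ / ((E1 + E2 + 1) * R'), by positivity, fun x hx hxR hxw => ?_⟩
    have hr := hxp x hx
    have h1 := inner_mul_inner_le he he' (by positivity) hxR hx.2.1 hx.2.2 hxw
    have hX := hxx x hx
    have h2 : (E1 + E2 + 1) * (inner ℝ e x * inner ℝ e' x) ≤ m * μ := by
      rw [div_mul_eq_mul_div, le_div_iff₀ (by positivity)] at h1
      have : (E1 + E2 + 1) * (inner ℝ e x * inner ℝ e' x) * R' ≤ m * μ * R' := by linarith
      exact le_of_mul_le_mul_right this hR'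
    have d1 := (le_abs_self _).trans (hE1' x hxR)
    have d2 := (le_abs_self _).trans (hE2' x hxR)
    rw [abs_of_pos hx.2.1, abs_of_pos hx.2.2] at d1 d2
    have p1 : 0 ≤ C * (inner ℝ e x * inner ℝ e' x * ‖x‖ ^ (-τ)) := by positivity
    have p2 : 0 ≤ C * K * (inner ℝ e x * inner ℝ e' x * ‖x‖ ^ (-(τ + 201 / 100))) := by positivity
    have m1 : m * μ ≤ m * ‖x‖ ^ (-(1 / 5) : ℝ) := by
      gcongr
      exact (min_le_left _ _).trans (Real.rpow_le_rpow_of_nonpos hr hxR (by norm_num))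
    have m2 : m * μ ≤ m * (K * ‖x‖ ^ (-((1 / 5 : ℝ) + 201 / 100))) :=
      mul_le_mul_of_nonneg_left ((min_le_right _ _).trans (mul_le_mul_of_nonneg_left
        (Real.rpow_le_rpow_of_nonpos hr hxR (by norm_num)) hK0.le)) hm.le
    have q1 := mul_nonneg hE1 hX.le
    have q2 := mul_nonneg hE2 hX.le
    exact ⟨by linarith, by linarith⟩
  · intro m hm
    obtain ⟨R2, hR2, h2⟩ := exists_const_mul_rpow_neg_lt (s := 1 / 5) (by norm_num) (4 * Cd) hm
    obtain ⟨R3, hR3, h3⟩ := exists_const_mul_rpow_neg_lt (s := 19 / 100) (by norm_num) (4 * Cd)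
      (mul_pos hm hK0)
    refine ⟨max Rd (max R2 R3), fun x hx hxR => ?_⟩
    have hr := hxp x hx
    have hX := hxx x hx
    simp only [max_lt_iff] at hxR
    have d1 := (le_abs_self _).trans (abs_antisym_le e e' (f := φ) (x := x) fun y hy =>
      (hdec y (by rw [hy]; exact hxR.1)).1.trans_eq (by rw [hy]))
    have d2 := (le_abs_self _).trans (abs_antisym_le e e' (f := ψ) (x := x) fun y hy =>
      (hdec y (by rw [hy]; exact hxR.1)).2.trans_eq (by rw [hy]))
    have p1 : 0 ≤ C * (inner ℝ e x * inner ℝ e' x * ‖x‖ ^ (-τ)) := by positivity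
    have p2 : 0 ≤ C * K * (inner ℝ e x * inner ℝ e' x * ‖x‖ ^ (-(τ + 201 / 100))) := by positivity
    have f1 : ‖x‖ ^ (-(2 / 5) : ℝ) = ‖x‖ ^ (-(1 / 5) : ℝ) * ‖x‖ ^ (-(1 / 5) : ℝ) := by
      rw [← Real.rpow_add hr]; norm_num
    have f2 : ‖x‖ ^ (-(12 / 5) : ℝ) = ‖x‖ ^ (-(19 / 100) : ℝ) * ‖x‖ ^ (-((1 / 5 : ℝ) + 201 / 100)) := by
      rw [← Real.rpow_add hr]; norm_num
    have g1 := mul_le_mul_of_nonneg_right (h2 _ hxR.2.1).le (Real.rpow_nonneg hr.le (-(1 / 5) : ℝ))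
    have g2 := mul_le_mul_of_nonneg_right (h3 _ hxR.2.2).le
      (Real.rpow_nonneg hr.le (-((1 / 5 : ℝ) + 201 / 100)))
    rw [f1] at d1
    rw [f2] at d2
    exact ⟨by linarith, by linarith⟩

end QuadrantDecay

section QuadrantSign

variable {n : ℕ} {p q : ℝ} {u v u1 v1 : ℝ → ℝ} {φ ψ : EuclideanSpace ℝ (Fin n) → ℝ}

theorem RadialProfile.contDiffAt_h {N : ℝ} (P : RadialProfile N p q u v u1 v1) {r : ℝ} (hr : 0 < r) :
    ContDiffAt ℝ 2 (fun x => -u1 x / x) r :=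
  P.contDiffOn_h.contDiffAt (Ioi_mem_nhds hr)

theorem RadialProfile.contDiffAt_inner_mul_h {N : ℝ} (P : RadialProfile N p q u v u1 v1)
    (e : EuclideanSpace ℝ (Fin n)) {x : EuclideanSpace ℝ (Fin n)} (hx : x ≠ 0) :
    ContDiffAt ℝ 2 (fun y => inner ℝ e y * (-u1 ‖y‖ / ‖y‖)) x :=
  (contDiff_inner_const e).contDiffAt.mul
    (contDiffAt_norm_comp hx (P.contDiffAt_h (norm_pos_iff.2 hx)))

theorem RadialProfile.contDiffAt_inner_mul_inner_mul_h {N : ℝ} (P : RadialProfile N p q u v u1 v1)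
    (e e' : EuclideanSpace ℝ (Fin n)) {x : EuclideanSpace ℝ (Fin n)} (hx : x ≠ 0) :
    ContDiffAt ℝ 2 (fun y => inner ℝ e y * inner ℝ e' y * (-u1 ‖y‖ / ‖y‖)) x :=
  ((contDiff_inner_const e).contDiffAt.mul (contDiff_inner_const e').contDiffAt).mul
    (contDiffAt_norm_comp hx (P.contDiffAt_h (norm_pos_iff.2 hx)))

/-- The translation modes solve the linearized equation; their quadratic analogues are strict
supersolutions. -/
theorem RadialProfile.lt_neg_lap_barrier (P : RadialProfile n p q u v u1 v1)
    {e e' : EuclideanSpace ℝ (Fin n)} (hee : inner ℝ e e' = 0) {x : EuclideanSpace ℝ (Fin n)}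
    (hx : x ≠ 0) (h1 : 0 < inner ℝ e x) (h2 : 0 < inner ℝ e' x) :
    p * v ‖x‖ ^ (p - 1) * (inner ℝ e x * (-v1 ‖x‖ / ‖x‖) + inner ℝ e' x * (-v1 ‖x‖ / ‖x‖) +
      inner ℝ e x * inner ℝ e' x * (-v1 ‖x‖ / ‖x‖)) <
    -lap (fun y => inner ℝ e y * (-u1 ‖y‖ / ‖y‖) + inner ℝ e' y * (-u1 ‖y‖ / ‖y‖) +
      inner ℝ e y * inner ℝ e' y * (-u1 ‖y‖ / ‖y‖)) x := by
  have hr := norm_pos_iff.2 hx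
  have d1 : ∀ᶠ r in 𝓝 ‖x‖, HasDerivAt (fun x => -u1 x / x) (((n : ℝ) * u1 r / r + v r ^ p) / r) r := by
    filter_upwards [lt_mem_nhds hr] with r hr
    exact P.hasDerivAt_h hr
  have d2 := P.hasDerivAt_h1 hr
  rw [lap_add ((P.contDiffAt_inner_mul_h e hx).add (P.contDiffAt_inner_mul_h e' hx))
      (P.contDiffAt_inner_mul_inner_mul_h e e' hx),
    lap_add (P.contDiffAt_inner_mul_h e hx) (P.contDiffAt_inner_mul_h e' hx),
    lap_inner_mul_radial e hx (P.contDiffAt_h hr) d1 d2,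
    lap_inner_mul_radial e' hx (P.contDiffAt_h hr) d1 d2,
    lap_inner_mul_inner_mul_radial hee hx (P.contDiffAt_h hr) d1 d2]
  have h3 := P.h1_neg hr
  have h4 := mul_pos (mul_pos h1 h2) (div_pos (neg_pos.2 h3) hr)
  set H := (n * u1 ‖x‖ / ‖x‖ + v ‖x‖ ^ p) / ‖x‖
  have e1 : ((n : ℝ) + 3) / ‖x‖ * H = ((n : ℝ) + 1) / ‖x‖ * H - 2 * (-H / ‖x‖) := by ring
  rw [e1]
  linarith

theorem LinearPair.antisym_nonpos (P : RadialProfile n p q u v u1 v1)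
    (hδ : ((n : ℝ) - 2) * |p - 1| ≤ 1 / 100)
    (hc : LinearCoeff (fun r => p * v r ^ (p - 1)) (fun r => q * u r ^ (q - 1)))
    (L : LinearPair (fun r => p * v r ^ (p - 1)) (fun r => q * u r ^ (q - 1)) φ ψ) (hn : 5 ≤ n)
    {Cd Rd : ℝ} (hdec : ∀ x, Rd < ‖x‖ → |φ x| ≤ Cd * ‖x‖ ^ (-(2 / 5) : ℝ) ∧
      |ψ x| ≤ Cd * ‖x‖ ^ (-(12 / 5) : ℝ))
    {e e' : EuclideanSpace ℝ (Fin n)} (he : ‖e‖ = 1) (he' : ‖e'‖ = 1) (hee : inner ℝ e e' = 0)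
    {x : EuclideanSpace ℝ (Fin n)} (hx1 : 0 < inner ℝ e x) (hx2 : 0 < inner ℝ e' x) :
    _root_.antisym e e' φ x ≤ 0 ∧ _root_.antisym e e' ψ x ≤ 0 := by
  have hn5 : (5 : ℝ) ≤ n := by exact_mod_cast hn
  have LA := L.antisym e e'
  obtain ⟨C, R, hR1, hdecA⟩ := L.exists_antisym_decay hc hn hdec he he' hee
  obtain ⟨c1, hc1, hh⟩ := P.exists_h_lower hδ
  obtain ⟨c2, hc2, hk⟩ := P.exists_k_lower
  set O : Set (EuclideanSpace ℝ (Fin n)) :=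
    {x | (-1 : ℝ) < ‖x‖ ∧ 0 < inner ℝ e x ∧ 0 < inner ℝ e' x} with hO
  have hx0 : ∀ x ∈ O, x ≠ 0 := by
    rintro x hx rfl
    simpa using hx.2.1
  have hxp : ∀ x ∈ O, 0 < ‖x‖ := fun x hx => norm_pos_iff.2 (hx0 x hx)
  have hpos : ∀ x ∈ O, 0 < -u1 ‖x‖ / ‖x‖ := fun x hx => P.h_pos (hxp x hx)
  have kpos : ∀ x ∈ O, 0 < -v1 ‖x‖ / ‖x‖ := fun x hx => P.symm.h_pos (hxp x hx)
  have hS : ∀ x ∈ O, ∀ t : ℝ, 0 < t →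
      0 < inner ℝ e x * t + inner ℝ e' x * t + inner ℝ e x * inner ℝ e' x * t := by
    intro x hx t ht
    have := hx.2.1
    have := hx.2.2
    positivity
  refine quadrant_max_principle (R := -1) (R1 := 0) (e := e) (e' := e') (O := O)
    (w1 := _root_.antisym e e' φ) (w2 := _root_.antisym e e' ψ)
    (S1 := fun y => inner ℝ e y * (-u1 ‖y‖ / ‖y‖) + inner ℝ e' y * (-u1 ‖y‖ / ‖y‖) +
      inner ℝ e y * inner ℝ e' y * (-u1 ‖y‖ / ‖y‖))
    (S2 := fun y => inner ℝ e y * (-v1 ‖y‖ / ‖y‖) + inner ℝ e' y * (-v1 ‖y‖ / ‖y‖) +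
      inner ℝ e y * inner ℝ e' y * (-v1 ‖y‖ / ‖y‖))
    (c11 := fun _ => 0) (c12 := fun y => p * v ‖y‖ ^ (p - 1))
    (c21 := fun y => q * u ‖y‖ ^ (q - 1)) (c22 := fun _ => 0) hO
    (by norm_num) (fun x hx => LA.hφ.contDiffAt) (fun x hx => LA.hψ.contDiffAt)
    (fun x hx => ((P.contDiffAt_inner_mul_h e (hx0 x hx)).add
      (P.contDiffAt_inner_mul_h e' (hx0 x hx))).add
        (P.contDiffAt_inner_mul_inner_mul_h e e' (hx0 x hx)))
    (fun x hx => ((P.symm.contDiffAt_inner_mul_h e (hx0 x hx)).add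
      (P.symm.contDiffAt_inner_mul_h e' (hx0 x hx))).add
        (P.symm.contDiffAt_inner_mul_inner_mul_h e e' (hx0 x hx)))
    (fun x hx => hS x hx _ (hpos x hx)) (fun x hx => hS x hx _ (kpos x hx))
    (fun x _ => (hc.a_pos _).le) (fun x _ => (hc.b_pos _).le)
    (fun x _ => by simpa using (LA.eφ x).le) (fun x _ => by simpa using (LA.eψ x).le)
    (fun x hx => by simpa using P.lt_neg_lap_barrier hee (hx0 x hx) hx.2.1 hx.2.2)
    (fun x hx => by simpa using P.symm.lt_neg_lap_barrier hee (hx0 x hx) hx.2.1 hx.2.2)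
    (fun x hx hx' => absurd (hxp x hx) (by linarith)) ?_ ?_ x
    ⟨by linarith [norm_nonneg x], hx1, hx2⟩
  · intro m hm R'
    obtain ⟨E1, hE1, hE1'⟩ := exists_antisym_le he he' hee L.hφ R'
    obtain ⟨E2, hE2, hE2'⟩ := exists_antisym_le he he' hee L.hψ R'
    have hv := P.v_pos R'
    have hu := P.u_pos R'
    set μ := min (v R' ^ p / n) (u R' ^ q / n) with hμ
    have hμ0 : 0 < μ := lt_min (by positivity) (by positivity)
    refine ⟨m * μ / (E1 + E2 + 1), by positivity, fun x hx hxR hxw => ?_⟩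
    have hr := hxp x hx
    have y1 := hx.2.1
    have y2 := hx.2.2
    have hX : 0 < inner ℝ e x * inner ℝ e' x := mul_pos y1 y2
    have h1 : inner ℝ e x * inner ℝ e' x ≤
        m * μ / (E1 + E2 + 1) * (inner ℝ e x + inner ℝ e' x) := by
      have hρ : 0 < m * μ / (E1 + E2 + 1) := by positivity
      rcases hxw with h | h
      · have := mul_le_mul_of_nonneg_right h.le y2.le
        have := mul_pos hρ y1
        linarith
      · have := mul_le_mul_of_nonneg_left h.le y1.le
        have := mul_pos hρ y2
        linarith
    have h2 : (E1 + E2 + 1) * (inner ℝ e x * inner ℝ e' x) ≤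
        m * μ * (inner ℝ e x + inner ℝ e' x) := by
      rw [div_mul_eq_mul_div, le_div_iff₀ (by positivity)] at h1
      linarith
    have d1 := (le_abs_self _).trans (hE1' x hxR)
    have d2 := (le_abs_self _).trans (hE2' x hxR)
    rw [abs_of_pos y1, abs_of_pos y2] at d1 d2
    have hvm : v R' ≤ v ‖x‖ := P.symm.strictAntiOn_u.antitoneOn hr.le (hr.le.trans hxR) hxR
    have hum : u R' ≤ u ‖x‖ := P.strictAntiOn_u.antitoneOn hr.le (hr.le.trans hxR) hxR
    have hp := P.p_pos
    have hq := P.q_pos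
    have k1 : μ ≤ -u1 ‖x‖ / ‖x‖ := by
      refine ((min_le_left _ _).trans ?_).trans (P.h_lower hr).le
      gcongr
    have k2 : μ ≤ -v1 ‖x‖ / ‖x‖ := by
      refine ((min_le_right _ _).trans ?_).trans (P.symm.h_lower hr).le
      gcongr
    have q1 := mul_nonneg hE1 hX.le
    have q2 := mul_nonneg hE2 hX.le
    have z1 := mul_le_mul_of_nonneg_left k1 (mul_pos hm (add_pos y1 y2)).le
    have z2 := mul_le_mul_of_nonneg_left k2 (mul_pos hm (add_pos y1 y2)).le
    have z3 := mul_pos (mul_pos hm hX) (hpos x hx)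
    have z4 := mul_pos (mul_pos hm hX) (kpos x hx)
    exact ⟨by linarith, by linarith⟩
  · intro m hm
    obtain ⟨R2, hR2, h2⟩ := exists_const_mul_rpow_neg_lt (s := 174 / 100) (by norm_num) C
      (mul_pos hm hc1)
    obtain ⟨R3, hR3, h3⟩ := exists_const_mul_rpow_neg_lt (s := 176 / 100) (by norm_num) C
      (mul_pos hm hc2)
    refine ⟨max R (max R2 R3), fun x hx hxR => ?_⟩
    have hr := hxp x hx
    have y1 := hx.2.1
    have y2 := hx.2.2
    have hX : 0 < inner ℝ e x * inner ℝ e' x := mul_pos y1 y2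
    simp only [max_lt_iff] at hxR
    obtain ⟨d1, d2⟩ := hdecA x hxR.1 y1 y2
    have f1 : ‖x‖ ^ (-((n : ℝ) - 1 / 4)) =
        ‖x‖ ^ (-(174 / 100) : ℝ) * ‖x‖ ^ (-((n : ℝ) - 2 + 1 / 100)) := by
      rw [← Real.rpow_add hr]; congr 1; ring
    have f2 : ‖x‖ ^ (-((n : ℝ) - 1 / 4 + 201 / 100)) =
        ‖x‖ ^ (-(176 / 100) : ℝ) * ‖x‖ ^ (-(n : ℝ)) := by
      rw [← Real.rpow_add hr]; congr 1; ring
    have hr1 : 1 ≤ ‖x‖ := hR1.trans hxR.1.le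
    have g1 : C * ‖x‖ ^ (-((n : ℝ) - 1 / 4)) ≤ m * (-u1 ‖x‖ / ‖x‖) := by
      rw [f1, ← mul_assoc]
      refine (mul_le_mul_of_nonneg_right (h2 _ hxR.2.1).le (by positivity)).trans ?_
      rw [mul_assoc]
      exact mul_le_mul_of_nonneg_left (hh _ hr1) hm.le
    have g2 : C * ‖x‖ ^ (-((n : ℝ) - 1 / 4 + 201 / 100)) ≤ m * (-v1 ‖x‖ / ‖x‖) := by
      rw [f2, ← mul_assoc]
      refine (mul_le_mul_of_nonneg_right (h3 _ hxR.2.2).le (by positivity)).trans ?_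
      rw [mul_assoc]
      exact mul_le_mul_of_nonneg_left (hk _ hr1) hm.le
    have g1' := mul_le_mul_of_nonneg_left g1 hX.le
    have g2' := mul_le_mul_of_nonneg_left g2 hX.le
    have z1 := mul_pos (mul_pos hm (add_pos y1 y2)) (hpos x hx)
    have z2 := mul_pos (mul_pos hm (add_pos y1 y2)) (kpos x hx)
    exact ⟨by linarith, by linarith⟩

theorem antisym_of_inner_left_eq_zero {e e' x : EuclideanSpace ℝ (Fin n)} (he : ‖e‖ = 1)
    (he' : ‖e'‖ = 1) (hee : inner ℝ e e' = 0) (f : EuclideanSpace ℝ (Fin n) → ℝ)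
    (h : inner ℝ e x = 0) : antisym e e' f x = 0 := by
  simp [antisym, hyperRefl_apply he, hyperRefl_apply he', h, inner_sub_right, inner_smul_right, hee]

theorem antisym_of_inner_right_eq_zero {e e' x : EuclideanSpace ℝ (Fin n)}
    (he' : ‖e'‖ = 1) (f : EuclideanSpace ℝ (Fin n) → ℝ)
    (h : inner ℝ e' x = 0) : antisym e e' f x = 0 := by
  simp [antisym, hyperRefl_apply he', h]

theorem hyperRefl_neg (e : EuclideanSpace ℝ (Fin n)) : hyperRefl (-e) = hyperRefl e := by
  have : Submodule.span ℝ {-e} = Submodule.span ℝ {e} := by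
    rw [← Set.neg_singleton, Submodule.span_neg]
  simp only [hyperRefl, this]

theorem LinearPair.neg {a b : ℝ → ℝ} (L : LinearPair a b φ ψ) :
    LinearPair a b (fun x => -φ x) (fun x => -ψ x) := by
  refine ⟨L.hφ.neg, L.hψ.neg, fun x => ?_, fun x => ?_⟩
  · rw [lap_neg L.hφ.contDiffAt, neg_neg]; linarith [L.eφ x]
  · rw [lap_neg L.hψ.contDiffAt, neg_neg]; linarith [L.eψ x]

theorem LinearPair.antisym_eq_zero (P : RadialProfile n p q u v u1 v1)
    (hδ : ((n : ℝ) - 2) * |p - 1| ≤ 1 / 100)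
    (hc : LinearCoeff (fun r => p * v r ^ (p - 1)) (fun r => q * u r ^ (q - 1)))
    (L : LinearPair (fun r => p * v r ^ (p - 1)) (fun r => q * u r ^ (q - 1)) φ ψ) (hn : 5 ≤ n)
    (hφ0 : Tendsto φ (cocompact _) (𝓝 0)) (hint : Integrable fun x => lap φ x ^ 2)
    {e e' : EuclideanSpace ℝ (Fin n)} (he : ‖e‖ = 1) (he' : ‖e'‖ = 1) (hee : inner ℝ e e' = 0)
    (x : EuclideanSpace ℝ (Fin n)) :
    _root_.antisym e e' φ x = 0 ∧ _root_.antisym e e' ψ x = 0 := by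
  obtain ⟨C, R, -, -, hdec⟩ := L.exists_decay hc hn hφ0 hint
  have hpos : ∀ e e' : EuclideanSpace ℝ (Fin n), ‖e‖ = 1 → ‖e'‖ = 1 → inner ℝ e e' = 0 →
      0 < inner ℝ e x → 0 < inner ℝ e' x →
      _root_.antisym e e' φ x = 0 ∧ _root_.antisym e e' ψ x = 0 := by
    intro e e' he he' hee h1 h2
    have k1 := L.antisym_nonpos P hδ hc hn hdec he he' hee h1 h2
    have k2 := L.neg.antisym_nonpos P hδ hc hn (Cd := C) (Rd := R) (by simpa using hdec) he he' hee
      h1 h2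
    have k3 : ∀ f : EuclideanSpace ℝ (Fin n) → ℝ,
        _root_.antisym e e' (fun x => -f x) x = -_root_.antisym e e' f x := fun f => by
      simp only [_root_.antisym]; ring
    rw [k3, k3] at k2
    exact ⟨by linarith [k1.1, k2.1], by linarith [k1.2, k2.2]⟩
  have hright : ∀ e e' : EuclideanSpace ℝ (Fin n), ‖e‖ = 1 → ‖e'‖ = 1 → inner ℝ e e' = 0 →
      0 < inner ℝ e x →
      _root_.antisym e e' φ x = 0 ∧ _root_.antisym e e' ψ x = 0 := by
    intro e e' he he' hee h1
    rcases lt_trichotomy (inner ℝ e' x) 0 with h | h | h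
    · have := hpos e (-e') he (by simpa using he') (by simpa using hee) h1 (by simpa using h)
      simpa only [_root_.antisym, hyperRefl_neg] using this
    · exact ⟨antisym_of_inner_right_eq_zero he' _ h, antisym_of_inner_right_eq_zero he' _ h⟩
    · exact hpos e e' he he' hee h1 h
  rcases lt_trichotomy (inner ℝ e x) 0 with h | h | h
  · have := hright (-e) e' (by simpa using he) he' (by simpa using hee) (by simpa using h)
    simpa only [_root_.antisym, hyperRefl_neg] using this
  · exact ⟨antisym_of_inner_left_eq_zero he he' hee _ h, antisym_of_inner_left_eq_zero he he' hee _ h⟩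
  · exact hright e e' he he' hee h

end QuadrantSign

section SphereAffine

variable {n : ℕ} {f : EuclideanSpace ℝ (Fin n) → ℝ}

theorem hyperRefl_smul {c : ℝ} (hc : c ≠ 0) (e : EuclideanSpace ℝ (Fin n)) :
    hyperRefl (c • e) = hyperRefl e := by
  have : Submodule.span ℝ {c • e} = Submodule.span ℝ {e} :=
    Submodule.span_singleton_smul_eq (IsUnit.mk0 c hc) e
  simp only [hyperRefl, this]

theorem hyperRefl_sub {x y : EuclideanSpace ℝ (Fin n)} (h : ‖x‖ = ‖y‖) :
    hyperRefl (x - y) x = y := Submodule.reflection_sub h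

theorem antisym_eq_zero_of_ne_zero
    (hf : ∀ e e' : EuclideanSpace ℝ (Fin n), ‖e‖ = 1 → ‖e'‖ = 1 → inner ℝ e e' = 0 →
      ∀ x, antisym e e' f x = 0)
    {d d' : EuclideanSpace ℝ (Fin n)} (hd : d ≠ 0) (hd' : d' ≠ 0) (h : inner ℝ d d' = 0)
    (x : EuclideanSpace ℝ (Fin n)) : antisym d d' f x = 0 := by
  have h1 : ‖d‖⁻¹ ≠ 0 := inv_ne_zero (norm_ne_zero_iff.2 hd)
  have h2 : ‖d'‖⁻¹ ≠ 0 := inv_ne_zero (norm_ne_zero_iff.2 hd')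
  have := hf (‖d‖⁻¹ • d) (‖d'‖⁻¹ • d') (norm_smul_inv_norm (𝕜 := ℝ) hd) (norm_smul_inv_norm (𝕜 := ℝ) hd')
    (by simp [inner_smul_left, inner_smul_right, h]) x
  simpa only [antisym, hyperRefl_smul h1, hyperRefl_smul h2] using this

theorem inner_sub_self_eq {x y : EuclideanSpace ℝ (Fin n)} (h : ‖x‖ = ‖y‖) :
    inner ℝ (x - y) x = ‖x - y‖ ^ 2 / 2 := by
  rw [@norm_sub_sq_real, inner_sub_left, real_inner_self_eq_norm_sq, real_inner_comm, ← h]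
  ring

/-- The increment along a chord of a sphere depends only on the chord vector. -/
theorem chord_increment
    (hf : ∀ e e' : EuclideanSpace ℝ (Fin n), ‖e‖ = 1 → ‖e'‖ = 1 → inner ℝ e e' = 0 →
      ∀ x, antisym e e' f x = 0)
    {x y x' y' : EuclideanSpace ℝ (Fin n)} (h1 : ‖x‖ = ‖y‖) (h2 : ‖x‖ = ‖x'‖) (h3 : ‖x'‖ = ‖y'‖)
    (h : x - y = x' - y') : f x - f y = f x' - f y' := by
  by_cases hd : x - y = 0
  · have hd' : x' - y' = 0 := h ▸ hd
    rw [sub_eq_zero.1 hd, sub_eq_zero.1 hd']; ring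
  by_cases he : x - x' = 0
  · have e1 := sub_eq_zero.1 he
    subst e1
    rw [sub_right_inj.1 h]
  have ho : inner ℝ (x - y) (x - x') = 0 := by
    rw [inner_sub_right, inner_sub_self_eq h1, h, inner_sub_self_eq h3, sub_self]
  have k := antisym_eq_zero_of_ne_zero hf hd he ho x
  rw [antisym, hyperRefl_sub h1, hyperRefl_sub h2] at k
  have k2 : hyperRefl (x - y) x' = y' := by rw [h]; exact hyperRefl_sub h3
  rw [k2] at k
  linarith

/-- The even part is radial. -/
theorem even_part_radial
    (hf : ∀ e e' : EuclideanSpace ℝ (Fin n), ‖e‖ = 1 → ‖e'‖ = 1 → inner ℝ e e' = 0 →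
      ∀ x, antisym e e' f x = 0)
    {x y : EuclideanSpace ℝ (Fin n)} (h : ‖x‖ = ‖y‖) : f x + f (-x) = f y + f (-y) := by
  by_cases hd : x - y = 0
  · rw [sub_eq_zero.1 hd]
  by_cases he : x - -y = 0
  · rw [sub_eq_zero.1 he, neg_neg, add_comm]
  have h' : ‖x‖ = ‖-y‖ := by rw [norm_neg, h]
  have ho : inner ℝ (x - y) (x - -y) = 0 := by
    rw [sub_neg_eq_add, inner_add_right, inner_sub_left, inner_sub_left, real_inner_self_eq_norm_sq,
      real_inner_self_eq_norm_sq, real_inner_comm x y, h]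
    ring
  have k := antisym_eq_zero_of_ne_zero hf hd he ho x
  rw [antisym, hyperRefl_sub h, hyperRefl_sub h'] at k
  have k2 : hyperRefl (x - y) (-y) = -x := by
    rw [map_neg, ← hyperRefl_smul (c := -1) (by norm_num) (x - y), neg_one_smul, neg_sub,
      hyperRefl_sub h.symm]
  rw [k2] at k
  linarith

theorem eq_mul_of_doubling {G : ℝ → ℝ} {r G' : ℝ} (h : ∀ t, |t| ≤ r → G t = 2 * G (t / 2))
    (hd : HasDerivAt G G' 0) (h0 : G 0 = 0) {t : ℝ} (ht : |t| ≤ r) : G t = t * G' := by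
  rcases eq_or_ne t 0 with rfl | ht0
  · simp [h0]
  have hk : ∀ k : ℕ, |t * (1 / 2) ^ k| ≤ r ∧ G t * (1 / 2) ^ k = G (t * (1 / 2) ^ k) := by
    intro k
    induction k with
    | zero => simpa using ht
    | succ k ih =>
      have e1 : t * (1 / 2) ^ (k + 1) = t * (1 / 2) ^ k / 2 := by ring
      rw [e1]
      refine ⟨?_, ?_⟩
      · rw [abs_div, abs_two]
        linarith [ih.1, abs_nonneg (t * (1 / 2) ^ k)]
      · have := h _ ih.1
        rw [← ih.2] at this
        rw [pow_succ]
        linarith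
  have hlim : Tendsto (fun k : ℕ => t * (1 / 2 : ℝ) ^ k) atTop (𝓝[≠] 0) := by
    refine tendsto_nhdsWithin_iff.2 ⟨?_, Eventually.of_forall fun k => ?_⟩
    · simpa using (tendsto_pow_atTop_nhds_zero_of_lt_one (r := (1 / 2 : ℝ)) (by norm_num)
        (by norm_num)).const_mul t
    · have : (1 / 2 : ℝ) ^ k ≠ 0 := by positivity
      exact mul_ne_zero ht0 this
  have h2 := (hasDerivAt_iff_tendsto_slope.1 hd).comp hlim
  have h3 : (slope G 0 ∘ fun k : ℕ => t * (1 / 2 : ℝ) ^ k) = fun _ => G t / t := by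
    funext k
    have : (1 / 2 : ℝ) ^ k ≠ 0 := by positivity
    rw [Function.comp, slope_def_field, ← (hk k).2, h0, sub_zero, sub_zero]
    field_simp
  rw [h3] at h2
  have h4 := tendsto_nhds_unique h2 tendsto_const_nhds
  rw [h4]
  field_simp

/-- The increment along a chord parallel to `e` is proportional to its length. -/
theorem chord_linear
    (hf : ∀ e e' : EuclideanSpace ℝ (Fin n), ‖e‖ = 1 → ‖e'‖ = 1 → inner ℝ e e' = 0 →
      ∀ x, antisym e e' f x = 0) (hd : Differentiable ℝ f)
    {e e' e'' : EuclideanSpace ℝ (Fin n)} (he : ‖e‖ = 1) (he' : ‖e'‖ = 1) (he'' : ‖e''‖ = 1)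
    (h1 : inner ℝ e e' = 0) (h2 : inner ℝ e e'' = 0) (h3 : inner ℝ e' e'' = 0)
    {r : ℝ} (hr : 0 < r) {x : EuclideanSpace ℝ (Fin n)} (hx : ‖x‖ = r) :
    f x - f (x - (2 * inner ℝ e x) • e) = inner ℝ e x * ((f (r • e) - f (-(r • e))) / r) := by
  have hnorm : ∀ a b c : ℝ, a ^ 2 + b ^ 2 + c ^ 2 = r ^ 2 → ‖a • e + b • e' + c • e''‖ = r := by
    intro a b c h
    have : ‖a • e + b • e' + c • e''‖ ^ 2 = r ^ 2 := by
      rw [← h, ← real_inner_self_eq_norm_sq]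
      simp only [inner_add_left, inner_add_right, inner_smul_left, inner_smul_right, h1, h2, h3,
        real_inner_comm e e', real_inner_comm e e'', real_inner_comm e' e'',
        real_inner_self_eq_norm_sq, he, he', he'']
      simp
      ring
    exact (sq_eq_sq₀ (norm_nonneg _) hr.le).1 this
  set G : ℝ → ℝ := fun t => f (t • e + (0 : ℝ) • e' + √(r ^ 2 - t ^ 2) • e'') -
    f ((-t) • e + (0 : ℝ) • e' + √(r ^ 2 - t ^ 2) • e'') with hG
  have hsq : ∀ t, |t| ≤ r → √(r ^ 2 - t ^ 2) ^ 2 = r ^ 2 - t ^ 2 := by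
    intro t ht
    rw [Real.sq_sqrt]
    have := abs_le.1 ht
    nlinarith
  have hchord : ∀ t, |t| ≤ r → ∀ y z : EuclideanSpace ℝ (Fin n), ‖y‖ = r → ‖z‖ = r →
      y - z = (2 * t) • e → f y - f z = G t := by
    intro t ht y z hy hz hyz
    have k1 := hnorm t 0 (√(r ^ 2 - t ^ 2)) (by rw [hsq t ht]; ring)
    have k2 := hnorm (-t) 0 (√(r ^ 2 - t ^ 2)) (by rw [hsq t ht]; ring)
    refine chord_increment hf (hy.trans hz.symm) (hy.trans k1.symm) (k1.trans k2.symm) ?_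
    rw [hyz]
    module
  have hdouble : ∀ t, |t| ≤ r → G t = 2 * G (t / 2) := by
    intro t ht
    have ht2 : |t / 2| ≤ r := by
      rw [abs_div, abs_two]; linarith [abs_nonneg t]
    have htr : t ^ 2 ≤ r ^ 2 := by
      have := abs_le.1 ht
      nlinarith
    set s := √(r ^ 2 - t ^ 2) with hs
    have hs2 : s ^ 2 = r ^ 2 - t ^ 2 := hsq t ht
    set c := √(r ^ 2 - t ^ 2 / 2) with hc
    have hc2 : c ^ 2 = r ^ 2 - t ^ 2 / 2 := Real.sq_sqrt (by nlinarith)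
    have nX := hnorm t 0 s (by rw [hs2]; ring)
    have nY := hnorm (-t) 0 s (by rw [hs2]; ring)
    have nM := hnorm 0 t s (by rw [hs2]; ring)
    have nA := hnorm (t / 2) (-(t / 2)) c (by rw [hc2]; ring)
    have nB := hnorm (-(t / 2)) (t / 2) c (by rw [hc2]; ring)
    have nA' := hnorm (t / 2) (t / 2) c (by rw [hc2]; ring)
    have nB' := hnorm (-(t / 2)) (-(t / 2)) c (by rw [hc2]; ring)
    have i1 := chord_increment hf (nX.trans nM.symm) (nX.trans nA.symm) (nA.trans nB.symm)
      (by module)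
    have i2 := chord_increment hf (nM.trans nY.symm) (nM.trans nA'.symm) (nA'.trans nB'.symm)
      (by module)
    have i3 := hchord (t / 2) ht2 _ _ nA nB' (by module)
    have i4 := hchord (t / 2) ht2 _ _ nA' nB (by module)
    have i5 : G t = f (t • e + (0 : ℝ) • e' + s • e'') - f ((-t) • e + (0 : ℝ) • e' + s • e'') := rfl
    rw [i5]
    linarith
  have hGd : DifferentiableAt ℝ G 0 := by
    have hsd : DifferentiableAt ℝ (fun t : ℝ => √(r ^ 2 - t ^ 2)) 0 := by
      apply DifferentiableAt.sqrt (by fun_prop)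
      simp [hr.ne']
    have hp : ∀ σ : ℝ, DifferentiableAt ℝ
        (fun t : ℝ => f ((σ * t) • e + (0 : ℝ) • e' + √(r ^ 2 - t ^ 2) • e'')) 0 := by
      intro σ
      refine DifferentiableAt.comp (g := f) (0 : ℝ) (hd _) ?_
      fun_prop
    have h1 := hp 1
    have h2 := hp (-1)
    simp only [one_mul, neg_mul] at h1 h2
    exact h1.sub h2
  have hG0 : G 0 = 0 := by simp [hG]
  have hlin : ∀ {t : ℝ}, |t| ≤ r → G t = t * deriv G 0 := fun ht =>
    eq_mul_of_doubling hdouble hGd.hasDerivAt hG0 ht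
  have hGr := hlin (t := r) (by rw [abs_of_pos hr])
  have hGr' : G r = f (r • e) - f (-(r • e)) := by simp [hG]
  have ht : |inner ℝ e x| ≤ r := by
    have := abs_real_inner_le_norm e x
    rwa [he, one_mul, hx] at this
  have hy : ‖x - (2 * inner ℝ e x) • e‖ = r := by
    rw [← hyperRefl_apply he, LinearIsometryEquiv.norm_map, hx]
  rw [hchord _ ht x _ hx hy (by module), hlin ht, ← hGr', hGr]
  field_simp

theorem exists_two_ne (hn : 3 ≤ n) (j : Fin n) : ∃ k l : Fin n, ¬k = j ∧ ¬l = j ∧ ¬l = k := by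
  obtain ⟨k, hk⟩ : ∃ k, k ∉ ({j} : Finset (Fin n)) := by
    by_contra! h
    have := Finset.card_le_card (fun i _ => h i : (Finset.univ : Finset (Fin n)) ⊆ {j})
    simp at this
    omega
  obtain ⟨l, hl⟩ : ∃ l, l ∉ ({j, k} : Finset (Fin n)) := by
    by_contra! h
    have := (Finset.card_le_card (fun i _ => h i : (Finset.univ : Finset (Fin n)) ⊆ {j, k})).trans
      Finset.card_le_two
    simp at this
    omega
  simp only [Finset.mem_singleton, Finset.mem_insert, not_or] at hk hl
  exact ⟨k, l, hk, hl⟩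

theorem inner_single_single_of_ne {i j : Fin n} (h : ¬j = i) :
    inner ℝ (EuclideanSpace.single i (1 : ℝ)) (EuclideanSpace.single j (1 : ℝ)) = 0 := by
  rw [EuclideanSpace.inner_single_left]; simp [Ne.symm h]

/-- The odd part is linear on each sphere. -/
theorem odd_part_eq (hn : 3 ≤ n)
    (hf : ∀ e e' : EuclideanSpace ℝ (Fin n), ‖e‖ = 1 → ‖e'‖ = 1 → inner ℝ e e' = 0 →
      ∀ x, antisym e e' f x = 0) (hd : Differentiable ℝ f)
    {x : EuclideanSpace ℝ (Fin n)} (hx : x ≠ 0) :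
    f x - f (-x) = ∑ j, x j * ((f (‖x‖ • EuclideanSpace.single j 1) -
      f (-(‖x‖ • EuclideanSpace.single j 1))) / ‖x‖) := by
  have hr := norm_pos_iff.2 hx
  have hS : ∀ S : Finset (Fin n),
      f x - f (WithLp.toLp 2 fun i => if i ∈ S then -x i else x i) =
        ∑ j ∈ S, x j * ((f (‖x‖ • EuclideanSpace.single j 1) -
          f (-(‖x‖ • EuclideanSpace.single j 1))) / ‖x‖) := by
    intro S
    induction S using Finset.induction_on with
    | empty => simp
    | insert j S hj ih =>
      obtain ⟨k, l, hk, hl⟩ := exists_two_ne hn j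
      rw [Finset.sum_insert hj, ← ih]
      set y : EuclideanSpace ℝ (Fin n) := WithLp.toLp 2 fun i => if i ∈ S then -x i else x i with hy
      have hny : ‖y‖ = ‖x‖ := by
        rw [EuclideanSpace.norm_eq, EuclideanSpace.norm_eq]
        congr 1
        refine Finset.sum_congr rfl fun i _ => ?_
        simp only [hy]
        split_ifs <;> simp
      have hin : inner ℝ (EuclideanSpace.single j (1 : ℝ)) y = x j := by
        rw [EuclideanSpace.inner_single_left]; simp [hy, hj]
      have h := chord_linear hf hd (e := EuclideanSpace.single j 1) (e' := EuclideanSpace.single k 1)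
        (e'' := EuclideanSpace.single l 1) (by simp) (by simp) (by simp)
        (inner_single_single_of_ne hk) (inner_single_single_of_ne hl.1) (inner_single_single_of_ne hl.2) hr hny
      rw [hin] at h
      have e1 : y - (2 * x j) • EuclideanSpace.single j (1 : ℝ) =
          WithLp.toLp 2 fun i => if i ∈ insert j S then -x i else x i := by
        ext i
        by_cases hij : i = j
        · subst hij
          simp [hy, hj]; ring
        · simp [hy, hij]
      rw [e1] at h
      linarith
  have := hS Finset.univ
  simp only [Finset.mem_univ, if_true] at this
  rw [← this]
  congr 2

end SphereAffine

section RegularPairs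

theorem le_limit_of_deriv_nonpos {X X' : ℝ → ℝ} {l t : ℝ} (hX : ∀ r, 0 < r → HasDerivAt X (X' r) r)
    (hl : Tendsto X (𝓝[>] 0) (𝓝 l)) (h : ∀ r, 0 < r → r < t → X' r ≤ 0) {r : ℝ} (hr : 0 < r)
    (hrt : r ≤ t) : X r ≤ l := by
  have hanti : AntitoneOn X (Set.Ioc 0 t) := by
    refine antitoneOn_of_deriv_nonpos (convex_Ioc 0 t)
      (fun x hx => (hX x hx.1).continuousAt.continuousWithinAt) ?_ ?_
    · intro x hx
      rw [interior_Ioc] at hx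
      exact (hX x hx.1).differentiableAt.differentiableWithinAt
    · intro x hx
      rw [interior_Ioc] at hx
      rw [(hX x hx.1).deriv]
      exact h x hx.1 hx.2
  refine ge_of_tendsto hl ?_
  filter_upwards [Ioo_mem_nhdsGT hr] with s hs
  exact hanti ⟨hs.1, hs.2.le.trans hrt⟩ ⟨hr, hrt⟩ hs.2.le

theorem lt_limit_of_deriv_neg {X X' : ℝ → ℝ} {l t : ℝ} (hX : ∀ r, 0 < r → HasDerivAt X (X' r) r)
    (hl : Tendsto X (𝓝[>] 0) (𝓝 l)) (h : ∀ r, 0 < r → r < t → X' r < 0) {r : ℝ} (hr : 0 < r)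
    (hrt : r ≤ t) : X r < l := by
  have hanti : StrictAntiOn X (Set.Ioc 0 t) := by
    refine strictAntiOn_of_deriv_neg (convex_Ioc 0 t)
      (fun x hx => (hX x hx.1).continuousAt.continuousWithinAt) ?_
    intro x hx
    rw [interior_Ioc] at hx
    rw [(hX x hx.1).deriv]
    exact h x hx.1 hx.2
  have h1 : X r < X (r / 2) := hanti ⟨by linarith, by linarith⟩ ⟨hr, hrt⟩ (by linarith)
  exact h1.trans_le (le_limit_of_deriv_nonpos hX hl (fun s h1 h2 => (h s h1 h2).le)
    (half_pos hr) (by linarith))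

/-- Solutions of a radial linear system that are regular at the origin. -/
structure RegularPair (m : ℝ) (a b F F1 G G1 : ℝ → ℝ) : Prop where
  hF : ∀ r, 0 < r → HasDerivAt F (F1 r) r
  hG : ∀ r, 0 < r → HasDerivAt G (G1 r) r
  hF1 : ∀ r, 0 < r → HasDerivAt F1 (-(m / r * F1 r) - a r * G r) r
  hG1 : ∀ r, 0 < r → HasDerivAt G1 (-(m / r * G1 r) - b r * F r) r
  fluxF : Tendsto (fun r => r ^ m * F1 r) (𝓝[>] 0) (𝓝 0)
  fluxG : Tendsto (fun r => r ^ m * G1 r) (𝓝[>] 0) (𝓝 0)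

namespace RegularPair

variable {m : ℝ} {a b F F1 G G1 : ℝ → ℝ}

theorem symm (P : RegularPair m a b F F1 G G1) : RegularPair m b a G G1 F F1 :=
  ⟨P.hG, P.hF, P.hG1, P.hF1, P.fluxG, P.fluxF⟩

theorem sub_const_mul {F' F1' G' G1' : ℝ → ℝ} (P : RegularPair m a b F F1 G G1)
    (P' : RegularPair m a b F' F1' G' G1') (c : ℝ) :
    RegularPair m a b (fun r => F r - c * F' r) (fun r => F1 r - c * F1' r)
      (fun r => G r - c * G' r) (fun r => G1 r - c * G1' r) := by
  refine ⟨fun r hr => (P.hF r hr).sub ((P'.hF r hr).const_mul c),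
    fun r hr => (P.hG r hr).sub ((P'.hG r hr).const_mul c),
    fun r hr => ((P.hF1 r hr).sub ((P'.hF1 r hr).const_mul c)).congr_deriv (by ring),
    fun r hr => ((P.hG1 r hr).sub ((P'.hG1 r hr).const_mul c)).congr_deriv (by ring), ?_, ?_⟩
  · have := P.fluxF.sub (P'.fluxF.const_mul c)
    simp only [mul_zero, sub_zero] at this
    exact this.congr fun r => by ring
  · have := P.fluxG.sub (P'.fluxG.const_mul c)
    simp only [mul_zero, sub_zero] at this
    exact this.congr fun r => by ring

theorem neg (P : RegularPair m a b F F1 G G1) :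
    RegularPair m a b (fun r => -F r) (fun r => -F1 r) (fun r => -G r) (fun r => -G1 r) := by
  refine ⟨fun r hr => (P.hF r hr).neg, fun r hr => (P.hG r hr).neg,
    fun r hr => (P.hF1 r hr).neg.congr_deriv (by ring),
    fun r hr => (P.hG1 r hr).neg.congr_deriv (by ring), ?_, ?_⟩
  · simpa using P.fluxF.neg
  · simpa using P.fluxG.neg

theorem hasDerivAt_flux (P : RegularPair m a b F F1 G G1) {r : ℝ} (hr : 0 < r) :
    HasDerivAt (fun r => r ^ m * F1 r) (-(r ^ m * (a r * G r))) r :=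
  ((P.hF1 r hr).rpow_mul m hr).congr_deriv (by ring)

/-- A positive second component forces the first one to decrease. -/
theorem F1_neg (P : RegularPair m a b F F1 G G1) (ha : ∀ r, 0 < a r) {t : ℝ}
    (hG : ∀ r, 0 < r → r < t → 0 < G r) {r : ℝ} (hr : 0 < r) (hrt : r ≤ t) : F1 r < 0 := by
  have h := lt_limit_of_deriv_neg (fun r hr => P.hasDerivAt_flux hr) P.fluxF (t := t)
    (fun s hs hst => by
      have := hG s hs hst
      have := ha s
      have : 0 < s ^ m * (a s * G s) := by positivity
      linarith) hr hrt
  by_contra! hc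
  have : 0 ≤ r ^ m * F1 r := by positivity
  linarith

theorem second_gt (P : RegularPair m a b F F1 G G1) (ha : ∀ r, 0 < a r) (hb : ∀ r, 0 < b r)
    {t D : ℝ} (hF0 : Tendsto F (𝓝[>] 0) (𝓝 0)) (hG0 : Tendsto G (𝓝[>] 0) (𝓝 D))
    (hG : ∀ r, 0 < r → r < t → 0 < G r) {r : ℝ} (hr : 0 < r) (hrt : r ≤ t) : D < G r := by
  have h1 : ∀ r, 0 < r → r ≤ t → F r < 0 := fun r hr hrt =>
    lt_limit_of_deriv_neg P.hF hF0 (fun s hs hst => P.F1_neg ha hG hs hst.le) hr hrt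
  have h2 : ∀ r, 0 < r → r ≤ t → -G1 r < 0 := fun r hr hrt =>
    P.symm.neg.F1_neg hb (fun s hs hst => neg_pos.2 (h1 s hs hst.le)) hr hrt
  have h3 := lt_limit_of_deriv_neg (fun r hr => (P.hG r hr).neg) hG0.neg
    (fun s hs hst => h2 s hs hst.le) hr hrt
  have h4 : -G r < -D := h3
  linarith

theorem second_pos (P : RegularPair m a b F F1 G G1) (ha : ∀ r, 0 < a r) (hb : ∀ r, 0 < b r)
    {D : ℝ} (hD : 0 < D) (hF0 : Tendsto F (𝓝[>] 0) (𝓝 0)) (hG0 : Tendsto G (𝓝[>] 0) (𝓝 D))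
    {r : ℝ} (hr : 0 < r) : 0 < G r := by
  by_contra! hc
  obtain ⟨s, hs, hs'⟩ : ∃ s > 0, ∀ x, 0 < x → x < s → 0 < G x := by
    have := hG0.eventually (lt_mem_nhds hD)
    rw [eventually_nhdsWithin_iff, Metric.eventually_nhds_iff] at this
    obtain ⟨s, hs, h⟩ := this
    refine ⟨s, hs, fun x hx hxs => h ?_ hx⟩
    rw [Real.dist_eq, sub_zero, abs_of_pos hx]; exact hxs
  set S : Set ℝ := Set.Icc s r ∩ G ⁻¹' Set.Iic 0 with hS
  have hGc : ContinuousOn G (Set.Icc s r) := fun x hx =>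
    (P.hG x (hs.trans_le hx.1)).continuousAt.continuousWithinAt
  have hScl : IsClosed S := hGc.preimage_isClosed_of_isClosed isClosed_Icc isClosed_Iic
  have hsr : s ≤ r := by
    by_contra! h
    exact absurd (hs' r hr h) (by linarith)
  have hSne : S.Nonempty := ⟨r, ⟨hsr, le_rfl⟩, hc⟩
  have hSb : BddBelow S := ⟨s, fun x hx => hx.1.1⟩
  have hmem := hScl.csInf_mem hSne hSb
  have ht0 : 0 < sInf S := hs.trans_le hmem.1.1
  have hpos : ∀ x, 0 < x → x < sInf S → 0 < G x := by
    intro x hx hxt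
    rcases lt_or_ge x s with h | h
    · exact hs' x hx h
    · by_contra! hx0
      exact absurd (csInf_le hSb (show x ∈ S from ⟨⟨h, hxt.le.trans hmem.1.2⟩, hx0⟩)) (by linarith)
  have h1 := P.second_gt ha hb hF0 hG0 hpos ht0 le_rfl
  have h2 : G (sInf S) ≤ 0 := hmem.2
  linarith

theorem not_second_pos (P : RegularPair m a b F F1 G G1) (ha : ∀ r, 0 < a r) (hb : ∀ r, 0 < b r)
    {D : ℝ} (hD : 0 < D) (hF0 : Tendsto F (𝓝[>] 0) (𝓝 0)) (hG0 : Tendsto G (𝓝[>] 0) (𝓝 D))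
    (hinf : Tendsto F atTop (𝓝 0)) : False := by
  have hG : ∀ r, 0 < r → 0 < G r := fun r hr => P.second_pos ha hb hD hF0 hG0 hr
  have h1 : ∀ r, 0 < r → F1 r < 0 := fun r hr => P.F1_neg ha (fun s hs _ => hG s hs) hr le_rfl
  have h2 : F 1 < 0 :=
    lt_limit_of_deriv_neg P.hF hF0 (fun s hs _ => h1 s hs) one_pos le_rfl
  have hanti : StrictAntiOn F (Set.Ioi 0) := by
    refine strictAntiOn_of_deriv_neg (convex_Ioi 0)
      (fun x hx => (P.hF x hx).continuousAt.continuousWithinAt) ?_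
    intro x hx
    rw [interior_Ioi] at hx
    rw [(P.hF x hx).deriv]
    exact h1 x hx
  have h3 : (0 : ℝ) ≤ F 1 := by
    refine le_of_tendsto hinf ?_
    filter_upwards [eventually_ge_atTop 1] with r hr
    exact hanti.antitoneOn (Set.mem_Ioi.2 one_pos) (Set.mem_Ioi.2 (lt_of_lt_of_le one_pos hr)) hr
  linarith

theorem F1_le (P : RegularPair m a b F F1 G G1) (hm : 0 < m) {t K : ℝ}
    (hK : ∀ r, 0 < r → r < t → -(a r * G r) ≤ K) {r : ℝ} (hr : 0 < r) (hrt : r ≤ t) :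
    F1 r ≤ K / (m + 1) * r := by
  have hd : ∀ s : ℝ, 0 < s → HasDerivAt (fun s => s ^ m * F1 s - K / (m + 1) * s ^ (m + 1))
      (-(s ^ m * (a s * G s)) - K * s ^ m) s := fun s hs =>
    ((P.hasDerivAt_flux hs).sub
      ((Real.hasDerivAt_rpow_const (p := m + 1) (Or.inl hs.ne')).const_mul _)).congr_deriv (by
        rw [add_sub_cancel_right]; field_simp)
  have hl : Tendsto (fun s => s ^ m * F1 s - K / (m + 1) * s ^ (m + 1)) (𝓝[>] 0) (𝓝 0) := by
    have h1 : Tendsto (fun s : ℝ => s ^ (m + 1)) (𝓝[>] 0) (𝓝 0) := by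
      have h2 := (Real.continuousAt_rpow_const 0 (m + 1) (Or.inr (by linarith))).tendsto
      rw [Real.zero_rpow (by linarith)] at h2
      exact h2.mono_left nhdsWithin_le_nhds
    simpa using P.fluxF.sub (h1.const_mul (K / (m + 1)))
  have h := le_limit_of_deriv_nonpos hd hl (t := t) (fun s hs hst => by
    have h1 := mul_le_mul_of_nonneg_left (hK s hs hst) (Real.rpow_nonneg hs.le m)
    linarith) hr hrt
  rw [Real.rpow_add_one hr.ne'] at h
  have hrm := Real.rpow_pos_of_pos hr m
  have h2 : r ^ m * F1 r ≤ r ^ m * (K / (m + 1) * r) := by linarith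
  exact le_of_mul_le_mul_left h2 hrm

theorem tendsto_F1 (P : RegularPair m a b F F1 G G1) (hm : 0 < m) (ha : Continuous a)
    (hG0 : Tendsto G (𝓝[>] 0) (𝓝 0)) : Tendsto F1 (𝓝[>] 0) (𝓝 0) := by
  have h1 : Tendsto (fun r => a r * G r) (𝓝[>] 0) (𝓝 0) := by
    simpa using (ha.continuousAt.tendsto.mono_left nhdsWithin_le_nhds).mul hG0
  have h2 := h1.eventually (Metric.ball_mem_nhds 0 one_pos)
  rw [eventually_nhdsWithin_iff, Metric.eventually_nhds_iff] at h2
  obtain ⟨s, hs, h⟩ := h2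
  have h3 : ∀ r, 0 < r → r < s → |a r * G r| ≤ 1 := fun x hx hxs => by
    have := h (y := x) (by rw [Real.dist_eq, sub_zero, abs_of_pos hx]; exact hxs) hx
    simpa using this.le
  have hid : Tendsto (fun r : ℝ => 1 / (m + 1) * r) (𝓝[>] 0) (𝓝 0) := by
    have : Tendsto (fun r : ℝ => 1 / (m + 1) * r) (𝓝 0) (𝓝 (1 / (m + 1) * 0)) := by
      exact (continuous_const.mul continuous_id).tendsto 0
    rw [mul_zero] at this
    exact this.mono_left nhdsWithin_le_nhds
  refine squeeze_zero_norm' ?_ hid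
  filter_upwards [Ioo_mem_nhdsGT hs] with r hr
  have k1 := P.F1_le hm (fun x hx hxs => (neg_le_abs _).trans (h3 x hx hxs)) hr.1 hr.2.le
  have k2 := P.neg.F1_le hm (t := s) (K := 1)
    (fun x hx hxs => by have := (le_abs_self _).trans (h3 x hx hxs); linarith) hr.1 hr.2.le
  rw [Real.norm_eq_abs, abs_le]
  constructor <;> linarith

theorem eq_zero_of_tendsto_zero (P : RegularPair m a b F F1 G G1) (hm : 0 < m) (ha : Continuous a)
    (hb : Continuous b) (hF0 : Tendsto F (𝓝[>] 0) (𝓝 0)) (hG0 : Tendsto G (𝓝[>] 0) (𝓝 0))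
    {r : ℝ} (hr : 0 < r) : F r = 0 := by
  obtain ⟨A, hA⟩ := isCompact_Icc.exists_bound_of_continuousOn (s := Set.Icc 0 r) ha.continuousOn
  obtain ⟨B, hB⟩ := isCompact_Icc.exists_bound_of_continuousOn (s := Set.Icc 0 r) hb.continuousOn
  have hF10 := P.tendsto_F1 hm ha hG0
  have hG10 := P.symm.tendsto_F1 hm hb hF0
  set k := 1 + A + B with hk
  set Q : ℝ → ℝ := fun s => F s ^ 2 + G s ^ 2 + F1 s ^ 2 + G1 s ^ 2 with hQ
  have hd : ∀ s, 0 < s → HasDerivAt (fun s => Real.exp (-k * s) * Q s)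
      (Real.exp (-k * s) * ((2 * F s * F1 s + 2 * G s * G1 s +
        2 * F1 s * (-(m / s * F1 s) - a s * G s) + 2 * G1 s * (-(m / s * G1 s) - b s * F s))
          - k * Q s)) s := by
    intro s hs
    have h1 := ((((P.hF s hs).pow 2).add ((P.hG s hs).pow 2)).add ((P.hF1 s hs).pow 2)).add
      ((P.hG1 s hs).pow 2)
    have h2 : HasDerivAt (fun s => Real.exp (-k * s)) (Real.exp (-k * s) * -k) s := by
      simpa using ((hasDerivAt_id s).const_mul (-k)).exp
    refine (h2.mul h1).congr_deriv ?_
    simp [hQ]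
    ring
  have hQ0 : Tendsto Q (𝓝[>] 0) (𝓝 0) := by
    simpa using (((hF0.pow 2).add (hG0.pow 2)).add (hF10.pow 2)).add (hG10.pow 2)
  have hl : Tendsto (fun s => Real.exp (-k * s) * Q s) (𝓝[>] 0) (𝓝 0) := by
    have h1 : Tendsto (fun s => Real.exp (-k * s)) (𝓝[>] 0) (𝓝 (Real.exp (-k * 0))) :=
      ((by fun_prop : Continuous fun s => Real.exp (-k * s)).tendsto 0).mono_left nhdsWithin_le_nhds
    simpa using h1.mul hQ0
  have h := le_limit_of_deriv_nonpos hd hl (t := r) (fun s hs hsr => by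
    refine mul_nonpos_of_nonneg_of_nonpos (Real.exp_pos _).le ?_
    have ha1 := abs_le.1 (hA s ⟨hs.le, hsr.le⟩)
    have hb1 := abs_le.1 (hB s ⟨hs.le, hsr.le⟩)
    have e1 : 0 ≤ m / s * F1 s ^ 2 := by positivity
    have e2 : 0 ≤ m / s * G1 s ^ 2 := by positivity
    have hA0 : 0 ≤ A := by linarith [ha1.1, ha1.2]
    have hB0 : 0 ≤ B := by linarith [hb1.1, hb1.2]
    have e3 : -(2 * F1 s * (a s * G s)) ≤ A * (F1 s ^ 2 + G s ^ 2) := by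
      nlinarith [mul_nonneg (sub_nonneg.2 ha1.2) (sq_nonneg (F1 s - G s)),
        mul_nonneg (neg_le_iff_add_nonneg.1 ha1.1) (sq_nonneg (F1 s + G s)),
        mul_nonneg (sub_nonneg.2 ha1.2) (sq_nonneg (F1 s + G s)),
        mul_nonneg (neg_le_iff_add_nonneg.1 ha1.1) (sq_nonneg (F1 s - G s))]
    have e4 : -(2 * G1 s * (b s * F s)) ≤ B * (G1 s ^ 2 + F s ^ 2) := by
      nlinarith [mul_nonneg (sub_nonneg.2 hb1.2) (sq_nonneg (G1 s - F s)),
        mul_nonneg (neg_le_iff_add_nonneg.1 hb1.1) (sq_nonneg (G1 s + F s)),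
        mul_nonneg (sub_nonneg.2 hb1.2) (sq_nonneg (G1 s + F s)),
        mul_nonneg (neg_le_iff_add_nonneg.1 hb1.1) (sq_nonneg (G1 s - F s))]
    have e5 := sq_nonneg (F s - F1 s)
    have e6 := sq_nonneg (G s - G1 s)
    have e7 : 0 ≤ A * (F s ^ 2 + G1 s ^ 2) := by positivity
    have e8 : 0 ≤ B * (G s ^ 2 + F1 s ^ 2) := by positivity
    simp only [hQ, hk]
    linarith) hr le_rfl
  have h1 := Real.exp_pos (-k * r)
  have h2 : Q r ≤ 0 := by
    by_contra! hc
    have := mul_pos h1 hc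
    linarith
  have h3 : F r ^ 2 ≤ 0 := by
    simp only [hQ] at h2
    linarith [sq_nonneg (G r), sq_nonneg (F1 r), sq_nonneg (G1 r)]
  exact pow_eq_zero_iff (two_ne_zero) |>.1 (le_antisymm h3 (sq_nonneg _))

/-- A regular solution whose first component vanishes both at the origin and at infinity is
trivial. -/
theorem eq_zero (P : RegularPair m a b F F1 G G1) (hm : 0 < m) (ha : Continuous a)
    (hb : Continuous b) (ha0 : ∀ r, 0 < a r) (hb0 : ∀ r, 0 < b r)
    (hF0 : Tendsto F (𝓝[>] 0) (𝓝 0)) {D : ℝ} (hG0 : Tendsto G (𝓝[>] 0) (𝓝 D))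
    (hinf : Tendsto F atTop (𝓝 0)) {r : ℝ} (hr : 0 < r) : F r = 0 := by
  rcases lt_trichotomy D 0 with h | h | h
  · refine (P.neg.not_second_pos ha0 hb0 (neg_pos.2 h) ?_ hG0.neg ?_).elim
    · simpa using hF0.neg
    · simpa using hinf.neg
  · subst h
    exact P.eq_zero_of_tendsto_zero hm ha hb hF0 hG0 hr
  · exact (P.not_second_pos ha0 hb0 h hF0 hG0 hinf).elim

end RegularPair

end RegularPairs

theorem tendsto_rpow_mul_zero {m : ℝ} (hm : 0 < m) {F : ℝ → ℝ} (hF : Continuous F) :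
    Tendsto (fun r => r ^ m * F r) (𝓝[>] 0) (𝓝 0) := by
  have h := ((Real.continuous_rpow_const hm.le).mul hF).tendsto 0
  simp only [Pi.mul_apply, Real.zero_rpow hm.ne', zero_mul] at h
  exact h.mono_left nhdsWithin_le_nhds

namespace RadialProfile

variable {N p q : ℝ} {u v u1 v1 : ℝ → ℝ}

theorem hasDerivAt_dilation (P : RadialProfile N p q u v u1 v1) {α : ℝ} {r : ℝ} (hr : 0 < r) :
    HasDerivAt (fun r => r * u1 r + α * u r) ((α + 2 - N) * u1 r - r * v r ^ p) r := by
  refine (((hasDerivAt_id r).mul (P.hu1 r hr)).add ((P.hu r).const_mul α)).congr_deriv ?_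
  simp only [id]
  field_simp
  ring

theorem hasDerivAt_dilation_deriv (P : RadialProfile N p q u v u1 v1) {α β : ℝ}
    (hp : β * p = α + 2) {r : ℝ} (hr : 0 < r) :
    HasDerivAt (fun r => (α + 2 - N) * u1 r - r * v r ^ p)
      (-((N - 1) / r * ((α + 2 - N) * u1 r - r * v r ^ p)) -
        p * v r ^ (p - 1) * (r * v1 r + β * v r)) r := by
  refine (((P.hu1 r hr).const_mul _).sub
    ((hasDerivAt_id r).mul (P.hasDerivAt_v_rpow p r))).congr_deriv ?_
  have h : v r ^ p = v r ^ (p - 1) * v r := by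
    rw [← Real.rpow_add_one (P.v_pos r).ne', sub_add_cancel]
  simp only [id, h]
  have hα : α = β * p - 2 := by linarith
  rw [hα]
  field_simp
  ring

/-- The generator of dilations solves the linearized radial system. -/
theorem regularPair_dilation (P : RadialProfile N p q u v u1 v1) {α β : ℝ}
    (hp : β * p = α + 2) (hq : α * q = β + 2) :
    RegularPair (N - 1) (fun r => p * v r ^ (p - 1)) (fun r => q * u r ^ (q - 1))
      (fun r => r * u1 r + α * u r) (fun r => (α + 2 - N) * u1 r - r * v r ^ p)
      (fun r => r * v1 r + β * v r) (fun r => (β + 2 - N) * v1 r - r * u r ^ q) := by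
  have hN := P.two_lt
  have := P.u1_cont
  have := P.v1_cont
  refine ⟨fun r => P.hasDerivAt_dilation, fun r => P.symm.hasDerivAt_dilation,
    fun r => P.hasDerivAt_dilation_deriv hp, fun r => P.symm.hasDerivAt_dilation_deriv hq,
    tendsto_rpow_mul_zero (by linarith) ?_, tendsto_rpow_mul_zero (by linarith) ?_⟩
  · exact (P.u1_cont.const_mul _).sub
      (continuous_id.mul (P.v_cont.rpow_const fun r => Or.inl (P.v_pos r).ne'))
  · exact (P.v1_cont.const_mul _).sub
      (continuous_id.mul (P.u_cont.rpow_const fun r => Or.inl (P.u_pos r).ne'))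

theorem flux_translation (P : RadialProfile N p q u v u1 v1) :
    Tendsto (fun r => r ^ (N + 1) * ((N * u1 r / r + v r ^ p) / r)) (𝓝[>] 0) (𝓝 0) := by
  have hN := P.two_lt
  have h : Continuous fun r => N * u1 r + r * v r ^ p :=
    (P.u1_cont.const_mul _).add
      (continuous_id.mul (P.v_cont.rpow_const fun r => Or.inl (P.v_pos r).ne'))
  refine (tendsto_rpow_mul_zero (m := N - 1) (by linarith) h).congr' ?_
  filter_upwards [self_mem_nhdsWithin] with r hr
  have hr : 0 < r := hr
  rw [show N + 1 = N - 1 + 1 + 1 by ring, Real.rpow_add_one hr.ne', Real.rpow_add_one hr.ne']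
  field_simp

/-- The generator of translations solves the linearized system in the first harmonic. -/
theorem regularPair_translation (P : RadialProfile N p q u v u1 v1) :
    RegularPair (N + 1) (fun r => p * v r ^ (p - 1)) (fun r => q * u r ^ (q - 1))
      (fun r => -u1 r / r) (fun r => (N * u1 r / r + v r ^ p) / r)
      (fun r => -v1 r / r) (fun r => (N * v1 r / r + u r ^ q) / r) :=
  ⟨fun _ hr => P.hasDerivAt_h hr, fun _ hr => P.symm.hasDerivAt_h hr,
    fun _ hr => P.hasDerivAt_h1 hr, fun _ hr => P.symm.hasDerivAt_h1 hr,
    P.flux_translation, P.symm.flux_translation⟩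

theorem tendsto_dilation_atTop (P : RadialProfile N p q u v u1 v1) (α : ℝ) :
    Tendsto (fun r => r * u1 r + α * u r) atTop (𝓝 0) := by
  have h1 : Tendsto (fun r => r * u1 r) atTop (𝓝 0) := by
    have h2 := P.u_lim.const_mul (-(N - 2))
    rw [mul_zero] at h2
    refine tendsto_of_tendsto_of_tendsto_of_le_of_le' h2 tendsto_const_nhds ?_ ?_
    · filter_upwards [eventually_gt_atTop 0] with r hr
      have := P.neg_u1_le hr
      linarith
    · filter_upwards [eventually_gt_atTop 0] with r hr
      exact (mul_neg_of_pos_of_neg hr (P.u1_neg hr)).le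
  simpa using h1.add (P.u_lim.const_mul α)

theorem tendsto_translation_atTop (P : RadialProfile N p q u v u1 v1) :
    Tendsto (fun r => -u1 r / r) atTop (𝓝 0) := by
  have h1 := P.tendsto_dilation_atTop 0
  simp only [zero_mul, add_zero] at h1
  have h2 := (h1.mul (tendsto_inv_atTop_zero.pow 2)).neg
  simp only [zero_mul, neg_zero] at h2
  refine h2.congr' ?_
  filter_upwards [eventually_gt_atTop 0] with r hr
  field_simp

end RadialProfile

theorem tendsto_div_id_of_hasDerivAt {F : ℝ → ℝ} {L : ℝ} (h : HasDerivAt F L 0) (h0 : F 0 = 0) :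
    Tendsto (fun r => F r / r) (𝓝[>] 0) (𝓝 L) := by
  have := h.tendsto_slope.mono_left (nhdsWithin_mono 0 (fun x (hx : 0 < x) => hx.ne'))
  refine this.congr fun r => ?_
  simp [slope_def_field, h0]

theorem RadialProfile.exists_tendsto_translation_zero {N p q : ℝ} {u v u1 v1 : ℝ → ℝ}
    (P : RadialProfile N p q u v u1 v1) {L : ℝ} (hL : HasDerivAt u1 L 0) :
    ∃ l, 0 < l ∧ Tendsto (fun r => -u1 r / r) (𝓝[>] 0) (𝓝 l) := by
  have h1 : Tendsto (fun r => -u1 r / r) (𝓝[>] 0) (𝓝 (-L)) :=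
    tendsto_div_id_of_hasDerivAt hL.neg (by simp [P.u1_zero])
  refine ⟨-L, ?_, h1⟩
  have h2 : Tendsto (fun r => v r ^ p / N) (𝓝[>] 0) (𝓝 (v 0 ^ p / N)) :=
    (((P.v_cont.rpow_const fun r => Or.inl (P.v_pos r).ne').div_const N).tendsto 0).mono_left
      nhdsWithin_le_nhds
  have h3 : v 0 ^ p / N ≤ -L := by
    refine le_of_tendsto_of_tendsto h2 h1 ?_
    filter_upwards [self_mem_nhdsWithin] with r hr
    exact (P.h_lower hr).le
  have := P.v_pos 0
  have := P.two_lt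
  have : 0 < v 0 ^ p / N := by positivity
  linarith

section Profiles

variable {n : ℕ} {a b : ℝ → ℝ} {φ ψ : EuclideanSpace ℝ (Fin n) → ℝ} {e : EuclideanSpace ℝ (Fin n)}

theorem LinearPair.symm (L : LinearPair a b φ ψ) : LinearPair b a ψ φ :=
  ⟨L.hψ, L.hφ, L.eψ, L.eφ⟩

theorem LinearPair.hasDerivAt_profile (L : LinearPair a b φ ψ)
    (hφr : ∀ x y, ‖x‖ = ‖y‖ → φ x = φ y) (he : ‖e‖ = 1) {r : ℝ} (hr : 0 < r) :
    HasDerivAt (deriv fun r : ℝ => φ (r • e))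
      (-(((n:ℝ) - 1) / r * deriv (fun r : ℝ => φ (r • e)) r) - a r * ψ (r • e)) r := by
  refine ((contDiff_line L.hφ e).hasDerivAt_deriv_deriv r).congr_deriv ?_
  have h1 := lap_profile L.hφ hφr he hr
  have h2 := L.eφ (r • e)
  rw [norm_smul, he, mul_one, Real.norm_eq_abs, abs_of_pos hr] at h2
  linarith

theorem LinearPair.regularPair_radial (L : LinearPair a b φ ψ) (hn : 1 < n)
    (hφr : ∀ x y, ‖x‖ = ‖y‖ → φ x = φ y) (hψr : ∀ x y, ‖x‖ = ‖y‖ → ψ x = ψ y) (he : ‖e‖ = 1) :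
    RegularPair ((n:ℝ) - 1) a b (fun r => φ (r • e)) (deriv fun r : ℝ => φ (r • e))
      (fun r => ψ (r • e)) (deriv fun r : ℝ => ψ (r • e)) := by
  have hn' : (1:ℝ) < n := by exact_mod_cast hn
  exact ⟨fun r _ => (contDiff_line L.hφ e).hasDerivAt_deriv r,
    fun r _ => (contDiff_line L.hψ e).hasDerivAt_deriv r,
    fun r hr => L.hasDerivAt_profile hφr he hr, fun r hr => L.symm.hasDerivAt_profile hψr he hr,
    tendsto_rpow_mul_zero (by linarith) (contDiff_line L.hφ e).contDiff_deriv_one.continuous,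
    tendsto_rpow_mul_zero (by linarith) (contDiff_line L.hψ e).contDiff_deriv_one.continuous⟩

theorem LinearPair.even_part (L : LinearPair a b φ ψ) :
    LinearPair a b (fun x => φ x + φ (-x)) (fun x => ψ x + ψ (-x)) := by
  have key : ∀ {f : EuclideanSpace ℝ (Fin n) → ℝ}, ContDiff ℝ 2 f → ∀ x,
      lap (fun x => f x + f (-x)) x = lap f x + lap f (-x) := fun {f} hf x => by
    have h1 : ContDiff ℝ 2 fun x => f (-x) := hf.comp contDiff_neg
    rw [lap_add hf.contDiffAt h1.contDiffAt]
    congr 1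
    exact lap_comp_linearIsometryEquiv hf (LinearIsometryEquiv.neg ℝ)
  refine ⟨L.hφ.add (L.hφ.comp contDiff_neg), L.hψ.add (L.hψ.comp contDiff_neg), ?_, ?_⟩
  · intro x
    have h1 := L.eφ x
    have h2 := L.eφ (-x)
    rw [norm_neg] at h2
    rw [key L.hφ]
    linarith
  · intro x
    have h1 := L.eψ x
    have h2 := L.eψ (-x)
    rw [norm_neg] at h2
    rw [key L.hψ]
    linarith

theorem contDiff_odd_profile (hf : ContDiff ℝ 2 φ) (e : EuclideanSpace ℝ (Fin n)) :
    ContDiff ℝ 2 fun r : ℝ => φ (r • e) - φ (-(r • e)) :=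
  (contDiff_line hf e).sub (hf.comp ((contDiff_id.smul contDiff_const).neg))

theorem hasDerivAt_div_id {O : ℝ → ℝ} (hO : ContDiff ℝ 2 O) {r : ℝ} (hr : 0 < r) :
    HasDerivAt (fun r => O r / r) ((r * deriv O r - O r) / r ^ 2) r :=
  ((hO.hasDerivAt_deriv r).div (hasDerivAt_id r) hr.ne').congr_deriv (by simp; ring)

theorem hasDerivAt_div_id_deriv {O : ℝ → ℝ} (hO : ContDiff ℝ 2 O) {r : ℝ} (hr : 0 < r) :
    HasDerivAt (fun r => (r * deriv O r - O r) / r ^ 2)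
      (deriv (fun r => (r * deriv O r - O r) / r ^ 2) r) r := by
  have h := (((hasDerivAt_id r).mul (hO.hasDerivAt_deriv_deriv r)).sub (hO.hasDerivAt_deriv r)).div
    (hasDerivAt_pow 2 r) (by positivity)
  exact h.differentiableAt.hasDerivAt

theorem LinearPair.hasDerivAt_odd_profile (L : LinearPair a b φ ψ)
    {e' e'' : EuclideanSpace ℝ (Fin n)}
    (hφ : ∀ e e' : EuclideanSpace ℝ (Fin n), ‖e‖ = 1 → ‖e'‖ = 1 → inner ℝ e e' = 0 →
      ∀ x, _root_.antisym e e' φ x = 0)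
    (he : ‖e‖ = 1) (he' : ‖e'‖ = 1) (he'' : ‖e''‖ = 1) (h1 : inner ℝ e e' = 0)
    (h2 : inner ℝ e e'' = 0) (h3 : inner ℝ e' e'' = 0) {r : ℝ} (hr : 0 < r) :
    HasDerivAt (fun r => (r * deriv (fun r : ℝ => φ (r • e) - φ (-(r • e))) r -
        (φ (r • e) - φ (-(r • e)))) / r ^ 2)
      (-(((n:ℝ) + 1) / r * ((r * deriv (fun r : ℝ => φ (r • e) - φ (-(r • e))) r -
        (φ (r • e) - φ (-(r • e)))) / r ^ 2)) - a r * ((ψ (r • e) - ψ (-(r • e))) / r)) r := by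
  have hO := contDiff_odd_profile L.hφ e
  refine (hasDerivAt_div_id_deriv hO hr).congr_deriv ?_
  set x := r • e with hx
  have hnx : ‖x‖ = r := by rw [hx, norm_smul, he, mul_one, Real.norm_eq_abs, abs_of_pos hr]
  have hx0 : x ≠ 0 := by rw [← norm_pos_iff, hnx]; exact hr
  have hin : inner ℝ e x = r := by rw [hx, inner_smul_right, real_inner_self_eq_norm_sq, he]; ring
  have hσx : hyperRefl e x = -x := by
    rw [hyperRefl_apply he, hin, hx]; module
  have e1 : lap (fun y => φ y - φ (hyperRefl e y)) x = lap φ x - lap φ (-x) := by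
    have h : ContDiff ℝ 2 fun y => φ (hyperRefl e y) :=
      L.hφ.comp (hyperRefl e).toContinuousLinearEquiv.contDiff
    rw [lap_sub L.hφ.contDiffAt h.contDiffAt, lap_comp_linearIsometryEquiv L.hφ, hσx]
  have e2 : (fun y => φ y - φ (hyperRefl e y)) =ᶠ[𝓝 x] fun y => inner ℝ e y *
      (fun r : ℝ => (φ (r • e) - φ (-(r • e))) / r) ‖y‖ := by
    filter_upwards [eventually_ne_nhds hx0] with y hy
    rw [hyperRefl_apply he]
    exact chord_linear hφ (L.hφ.differentiable (by simp)) he he' he'' h1 h2 h3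
      (norm_pos_iff.2 hy) rfl
  rw [lap_congr e2, lap_inner_mul_radial e hx0 (H := fun r : ℝ => (φ (r • e) - φ (-(r • e))) / r)
    (H1 := fun r => (r * deriv (fun r : ℝ => φ (r • e) - φ (-(r • e))) r -
        (φ (r • e) - φ (-(r • e)))) / r ^ 2) ?_ ?_
    (by rw [hnx]; exact hasDerivAt_div_id_deriv hO hr), hin, hnx] at e1
  · have e3 := L.eφ x
    have e4 := L.eφ (-x)
    rw [norm_neg] at e4
    rw [hnx] at e3 e4
    have e5 : r * (a r * ((ψ x - ψ (-x)) / r)) = a r * ψ x - a r * ψ (-x) := by field_simp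
    refine mul_left_cancel₀ hr.ne' ?_
    rw [mul_sub, e5]
    simp only [← hx] at e1
    linear_combination e1 - e3 + e4
  · rw [hnx]
    exact hO.contDiffAt.div contDiffAt_id hr.ne'
  · rw [hnx]
    filter_upwards [lt_mem_nhds hr] with s hs
    exact hasDerivAt_div_id hO hs

theorem flux_odd_profile {O : ℝ → ℝ} (hO : ContDiff ℝ 2 O) {m : ℝ} (hm : 2 < m) :
    Tendsto (fun r => r ^ m * ((r * deriv O r - O r) / r ^ 2)) (𝓝[>] 0) (𝓝 0) := by
  have h : Continuous fun r => r * deriv O r - O r :=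
    (continuous_id.mul hO.contDiff_deriv_one.continuous).sub hO.continuous
  refine (tendsto_rpow_mul_zero (m := m - 2) (by linarith) h).congr' ?_
  filter_upwards [self_mem_nhdsWithin] with r hr
  have hr : 0 < r := hr
  rw [show m = m - 2 + 1 + 1 by ring, Real.rpow_add_one hr.ne', Real.rpow_add_one hr.ne',
    show m - 2 + 1 + 1 - 2 = m - 2 by ring]
  field_simp

theorem LinearPair.regularPair_odd (L : LinearPair a b φ ψ) (hn : 1 < n)
    {e' e'' : EuclideanSpace ℝ (Fin n)}
    (hφ : ∀ e e' : EuclideanSpace ℝ (Fin n), ‖e‖ = 1 → ‖e'‖ = 1 → inner ℝ e e' = 0 →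
      ∀ x, _root_.antisym e e' φ x = 0)
    (hψ : ∀ e e' : EuclideanSpace ℝ (Fin n), ‖e‖ = 1 → ‖e'‖ = 1 → inner ℝ e e' = 0 →
      ∀ x, _root_.antisym e e' ψ x = 0)
    (he : ‖e‖ = 1) (he' : ‖e'‖ = 1) (he'' : ‖e''‖ = 1) (h1 : inner ℝ e e' = 0)
    (h2 : inner ℝ e e'' = 0) (h3 : inner ℝ e' e'' = 0) :
    RegularPair ((n:ℝ) + 1) a b (fun r => (φ (r • e) - φ (-(r • e))) / r)
      (fun r => (r * deriv (fun r : ℝ => φ (r • e) - φ (-(r • e))) r -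
        (φ (r • e) - φ (-(r • e)))) / r ^ 2)
      (fun r => (ψ (r • e) - ψ (-(r • e))) / r)
      (fun r => (r * deriv (fun r : ℝ => ψ (r • e) - ψ (-(r • e))) r -
        (ψ (r • e) - ψ (-(r • e)))) / r ^ 2) := by
  have hn' : (1:ℝ) < n := by exact_mod_cast hn
  exact ⟨fun r hr => hasDerivAt_div_id (contDiff_odd_profile L.hφ e) hr,
    fun r hr => hasDerivAt_div_id (contDiff_odd_profile L.hψ e) hr,
    fun r hr => L.hasDerivAt_odd_profile hφ he he' he'' h1 h2 h3 hr,
    fun r hr => L.symm.hasDerivAt_odd_profile hψ he he' he'' h1 h2 h3 hr,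
    flux_odd_profile (contDiff_odd_profile L.hφ e) (by linarith),
    flux_odd_profile (contDiff_odd_profile L.hψ e) (by linarith)⟩

end Profiles

section Classification

variable {n : ℕ} {p q : ℝ} {u v u1 v1 : ℝ → ℝ} {φ ψ : EuclideanSpace ℝ (Fin n) → ℝ}
  {e : EuclideanSpace ℝ (Fin n)}

theorem LinearPair.even_part_eq
    (L : LinearPair (fun r => p * v r ^ (p - 1)) (fun r => q * u r ^ (q - 1)) φ ψ)
    (P : RadialProfile n p q u v u1 v1) (hn : 1 < n) {α β : ℝ} (hα : 0 < α)
    (hp : β * p = α + 2) (hq : α * q = β + 2)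
    (hc : LinearCoeff (fun r => p * v r ^ (p - 1)) (fun r => q * u r ^ (q - 1)))
    (hφ : ∀ e e' : EuclideanSpace ℝ (Fin n), ‖e‖ = 1 → ‖e'‖ = 1 → inner ℝ e e' = 0 →
      ∀ x, _root_.antisym e e' φ x = 0)
    (hψ : ∀ e e' : EuclideanSpace ℝ (Fin n), ‖e‖ = 1 → ‖e'‖ = 1 → inner ℝ e e' = 0 →
      ∀ x, _root_.antisym e e' ψ x = 0)
    (hφ0 : Tendsto φ (cocompact _) (𝓝 0)) :
    ∃ c, ∀ x, φ x + φ (-x) = c * (‖x‖ * u1 ‖x‖ + α * u ‖x‖) := by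
  have hn' : (1 : ℝ) < n := by exact_mod_cast hn
  set e : EuclideanSpace ℝ (Fin n) := EuclideanSpace.single ⟨0, by omega⟩ 1 with he_def
  have he : ‖e‖ = 1 := by simp [he_def]
  have hφr : ∀ x y, ‖x‖ = ‖y‖ → φ x + φ (-x) = φ y + φ (-y) := fun x y => even_part_radial hφ
  have hψr : ∀ x y, ‖x‖ = ‖y‖ → ψ x + ψ (-x) = ψ y + ψ (-y) := fun x y => even_part_radial hψ
  have hu0 := P.u_pos 0
  set c := (φ 0 + φ 0) / (α * u 0) with hcdef
  have hc0 : φ 0 + φ 0 = c * (α * u 0) := by rw [hcdef]; field_simp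
  have Q := (L.even_part.regularPair_radial hn hφr hψr he).sub_const_mul
    (P.regularPair_dilation hp hq) c
  have hE := (contDiff_line L.even_part.hφ e).continuous
  have hE' := (contDiff_line L.even_part.hψ e).continuous
  have k1 : Continuous fun r => r * u1 r + α * u r :=
    (continuous_id.mul P.u1_cont).add (P.u_cont.const_mul α)
  have k2 : Continuous fun r => r * v1 r + β * v r :=
    (continuous_id.mul P.v1_cont).add (P.v_cont.const_mul β)
  have hl := tendsto_smul_cocompact he
  have hl' : Tendsto (fun r : ℝ => -(r • e)) atTop (cocompact _) := by
    simpa using tendsto_smul_cocompact (e := -e) (by simpa using he)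
  have key : ∀ r, 0 < r →
      (φ (r • e) + φ (-(r • e))) - c * (r * u1 r + α * u r) = 0 := fun r hr => by
    refine Q.eq_zero (by linarith) hc.a_cont hc.b_cont hc.a_pos hc.b_pos ?_
      (((hE'.sub (k2.const_mul c)).tendsto 0).mono_left nhdsWithin_le_nhds) ?_ hr
    · have h : Tendsto (fun r : ℝ => φ (r • e) + φ (-(r • e)) - c * (r * u1 r + α * u r)) (𝓝 0)
          (𝓝 (φ ((0:ℝ) • e) + φ (-((0:ℝ) • e)) - c * (0 * u1 0 + α * u 0))) :=
        (hE.sub (k1.const_mul c)).tendsto 0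
      have h0 : φ ((0:ℝ) • e) + φ (-((0:ℝ) • e)) - c * (0 * u1 0 + α * u 0) = 0 := by
        simp [hc0]
      rw [h0] at h
      exact h.mono_left nhdsWithin_le_nhds
    · have h1 := (hφ0.comp hl).add (hφ0.comp hl')
      simpa using h1.sub ((P.tendsto_dilation_atTop α).const_mul c)
  refine ⟨c, fun x => ?_⟩
  rcases eq_or_ne x 0 with rfl | hx
  · simp [hc0]
  · rw [hφr x (‖x‖ • e) (by simp [norm_smul, he])]
    linarith [key _ (norm_pos_iff.2 hx)]

theorem LinearPair.odd_profile_eq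
    (L : LinearPair (fun r => p * v r ^ (p - 1)) (fun r => q * u r ^ (q - 1)) φ ψ)
    (P : RadialProfile n p q u v u1 v1) (hn : 3 ≤ n)
    (hu1 : DifferentiableAt ℝ u1 0) (hv1 : DifferentiableAt ℝ v1 0)
    (hc : LinearCoeff (fun r => p * v r ^ (p - 1)) (fun r => q * u r ^ (q - 1)))
    (hφ : ∀ e e' : EuclideanSpace ℝ (Fin n), ‖e‖ = 1 → ‖e'‖ = 1 → inner ℝ e e' = 0 →
      ∀ x, _root_.antisym e e' φ x = 0)
    (hψ : ∀ e e' : EuclideanSpace ℝ (Fin n), ‖e‖ = 1 → ‖e'‖ = 1 → inner ℝ e e' = 0 →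
      ∀ x, _root_.antisym e e' ψ x = 0)
    (hφ0 : Tendsto φ (cocompact _) (𝓝 0)) (j : Fin n) :
    ∃ c, ∀ r : ℝ, 0 < r → (φ (r • EuclideanSpace.single j 1) -
      φ (-(r • EuclideanSpace.single j 1))) / r = c * (-u1 r / r) := by
  have hn' : (3 : ℝ) ≤ n := by exact_mod_cast hn
  obtain ⟨k, l, hk, hl, hlk⟩ := exists_two_ne hn j
  set e : EuclideanSpace ℝ (Fin n) := EuclideanSpace.single j 1 with he_def
  have he : ‖e‖ = 1 := by simp [he_def]
  obtain ⟨d, hd, hd0⟩ := P.exists_tendsto_translation_zero hu1.hasDerivAt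
  obtain ⟨d', -, hd0'⟩ := P.symm.exists_tendsto_translation_zero hv1.hasDerivAt
  have hO := (contDiff_odd_profile L.hφ e).hasDerivAt_deriv 0
  have hO' := (contDiff_odd_profile L.hψ e).hasDerivAt_deriv 0
  have hOt := tendsto_div_id_of_hasDerivAt hO (by simp)
  have hOt' := tendsto_div_id_of_hasDerivAt hO' (by simp)
  set D := deriv (fun r : ℝ => φ (r • e) - φ (-(r • e))) 0
  have Q := (L.regularPair_odd (e := e) (e' := EuclideanSpace.single k 1)
    (e'' := EuclideanSpace.single l 1) (by omega) hφ hψ he (by simp) (by simp)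
    (inner_single_single_of_ne hk) (inner_single_single_of_ne hl)
    (inner_single_single_of_ne hlk)).sub_const_mul P.regularPair_translation (D / d)
  refine ⟨D / d, fun r hr => sub_eq_zero.1 ?_⟩
  refine Q.eq_zero (by linarith) hc.a_cont hc.b_cont hc.a_pos hc.b_pos ?_
    (hOt'.sub (hd0'.const_mul (D / d))) ?_ hr
  · have h := hOt.sub (hd0.const_mul (D / d))
    rwa [div_mul_cancel₀ _ hd.ne', sub_self] at h
  · have h1 := (hφ0.comp (tendsto_smul_cocompact he)).sub
      (hφ0.comp (tendsto_smul_cocompact (e := -e) (by simpa using he)))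
    have h2 := (h1.mul tendsto_inv_atTop_zero).sub
      (P.tendsto_translation_atTop.const_mul (D / d))
    simpa [div_eq_mul_inv] using h2

theorem contDiff_lap (hφ : ContDiff ℝ 4 φ) : ContDiff ℝ 2 (lap φ) := by
  have h1 : ContDiff ℝ 3 (fderiv ℝ φ) := hφ.fderiv_right (by norm_num)
  have h2 : ContDiff ℝ 2 (fderiv ℝ (fderiv ℝ φ)) := h1.fderiv_right (by norm_num)
  unfold lap
  fun_prop

/-- The scalar linearized equation as a second order system. -/
theorem IsGroundState.linearPair {U V : EuclideanSpace ℝ (Fin n) → ℝ}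
    (G : IsGroundState n p q U V) (hp : 0 < p) (he : ‖e‖ = 1) (hφ : ContDiff ℝ 4 φ)
    (hEq : ∀ x, -lap (fun y => (-lap U y) ^ (1 / p - 1) * (-lap φ y)) x
      = p * q * U x ^ (q - 1) * φ x) :
    LinearPair (fun r => p * V (r • e) ^ (p - 1)) (fun r => q * U (r • e) ^ (q - 1)) φ
      (fun x => 1 / p * (V x ^ (1 - p) * (-lap φ x))) := by
  obtain ⟨-, hV, -, Vpos, eU, -, dU, dV, -⟩ := G
  have hUr := fun x => radial_eq_profile (fun x y h => le_antisymm (dU _ _ h.ge) (dU _ _ h.le)) he x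
  have hVr := fun x => radial_eq_profile (fun x y h => le_antisymm (dV _ _ h.ge) (dV _ _ h.le)) he x
  have hV2 : ContDiff ℝ 2 fun x => V x ^ (1 - p) * (-lap φ x) :=
    (hV.rpow_const_of_ne fun x => (Vpos x).ne').mul (contDiff_lap hφ).neg
  have hfun : (fun y => (-lap U y) ^ (1 / p - 1) * (-lap φ y)) =
      fun y => V y ^ (1 - p) * (-lap φ y) := by
    funext y
    rw [eU, ← Real.rpow_mul (Vpos y).le]
    congr 2
    field_simp
  rw [hfun] at hEq
  refine ⟨hφ.of_le (by norm_num), contDiff_const.mul hV2, fun x => ?_, fun x => ?_⟩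
  · have h : V x ^ (p - 1) * V x ^ (1 - p) = 1 := by
      rw [← Real.rpow_add (Vpos x)]; simp
    simp only [← hVr]
    calc -lap φ x = V x ^ (p - 1) * V x ^ (1 - p) * (-lap φ x) := by rw [h, one_mul]
      _ = _ := by field_simp
  · rw [lap_const_mul _ hV2.contDiffAt]
    simp only [← hUr]
    have := hEq x
    calc _ = 1 / p * (-lap (fun y => V y ^ (1 - p) * (-lap φ y)) x) := by ring
      _ = _ := by rw [this]; field_simp

theorem IsGroundState.exists_combination {U V : EuclideanSpace ℝ (Fin n) → ℝ}
    (G : IsGroundState n p q U V) (hn : 5 ≤ n) (hp0 : 0 < p) (hq0 : 0 < q)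
    (hδ : ((n : ℝ) - 2) * |p - 1| ≤ 1 / 100) {α β : ℝ} (hα : 0 < α) (hβ : 0 < β)
    (hαβ : α + β = n - 2) (hq : α * q = β + 2) (hp : β * p = α + 2) (hq1 : 1 < q)
    (hα4 : ((n : ℝ) - 4) / 4 < α) (hγ : p * |1 - p| * ((n : ℝ) - 2) ^ 2 ≤ 1 / 2)
    (hs : 5 ≤ 3 * ((n : ℝ) - 4) / 4 * (q - 1))
    (hφ : ContDiff ℝ 4 φ) (hφ0 : Tendsto φ (cocompact _) (𝓝 0))
    (hint : Integrable fun x => lap φ x ^ 2)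
    (hEq : ∀ x, -lap (fun y => (-lap U y) ^ (1 / p - 1) * (-lap φ y)) x
      = p * q * U x ^ (q - 1) * φ x) :
    ∃ (c : Fin n → ℝ) (c₀ : ℝ), ∀ x,
      φ x = (∑ j, c j * fderiv ℝ U x (EuclideanSpace.single j 1)) +
        c₀ * (fderiv ℝ U x x + α * U x) := by
  set e : EuclideanSpace ℝ (Fin n) := EuclideanSpace.single ⟨0, by omega⟩ 1 with he_def
  have he : ‖e‖ = 1 := by simp [he_def]
  have P := G.radialProfile hn hp0 hq0 he
  have L := G.linearPair hp0 he hφ hEq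
  obtain ⟨hU, hV, -, -, -, -, dU, -⟩ := G
  have hUr := fun x => radial_eq_profile (fun x y h => le_antisymm (dU _ _ h.ge) (dU _ _ h.le)) he x
  obtain ⟨C, R, -, hCR⟩ := P.exists_decay_u hn hα hβ hαβ hq hp hq1 hα4 hγ
  have hc := P.linearCoeff hδ hq1 hCR hs
  have hA := fun (e e' : EuclideanSpace ℝ (Fin n)) (he : ‖e‖ = 1) (he' : ‖e'‖ = 1)
    (hee : inner ℝ e e' = 0) (x : EuclideanSpace ℝ (Fin n)) =>
    L.antisym_eq_zero P hδ hc hn hφ0 hint he he' hee x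
  have hAφ := fun e e' he he' hee x => (hA e e' he he' hee x).1
  have hAψ := fun e e' he he' hee x => (hA e e' he he' hee x).2
  obtain ⟨c₀, hc₀⟩ := L.even_part_eq P (by omega) hα hp hq hc hAφ hAψ hφ0
  choose c hcj using L.odd_profile_eq P (by omega)
    ((contDiff_line hU e).hasDerivAt_deriv_deriv 0).differentiableAt
    ((contDiff_line hV e).hasDerivAt_deriv_deriv 0).differentiableAt hc hAφ hAψ hφ0
  refine ⟨fun j => -c j / 2, c₀ / 2, fun x => ?_⟩
  have h0 := hc₀ x
  rw [← hUr x] at h0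
  rcases eq_or_ne x 0 with rfl | hx
  · have hmax : IsLocalMax U 0 := Eventually.of_forall fun y => dU _ _ (by simp)
    rw [hmax.fderiv_eq_zero]
    simp at h0 ⊢
    linarith
  · have hpos := norm_pos_iff.2 hx
    have hfd : fderiv ℝ U x = (deriv (fun r : ℝ => U (r • e)) ‖x‖ / ‖x‖) • innerSL ℝ x := by
      have h := (hasFDerivAt_norm_comp hx (P.hu ‖x‖)).fderiv
      rw [← h]
      congr 1
      funext y
      exact hUr y
    have h1 := odd_part_eq (by omega) hAφ (hφ.differentiable (by simp)) hx
    rw [Finset.sum_congr rfl fun j _ => by rw [hcj j _ hpos]] at h1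
    have h2 : ∀ j, fderiv ℝ U x (EuclideanSpace.single j 1) =
        deriv (fun r : ℝ => U (r • e)) ‖x‖ / ‖x‖ * x j := fun j => by
      rw [hfd]; simp [EuclideanSpace.inner_single_right]
    have h3 : fderiv ℝ U x x = ‖x‖ * deriv (fun r : ℝ => U (r • e)) ‖x‖ := by
      rw [hfd]; simp; field_simp
    have h4 : ∑ j, -c j / 2 * fderiv ℝ U x (EuclideanSpace.single j 1) =
        (φ x - φ (-x)) / 2 := by
      rw [h1, Finset.sum_div]
      refine Finset.sum_congr rfl fun j _ => ?_
      rw [h2]; ring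
    rw [h4, h3]
    linarith

end Classification

theorem exponent_estimates {N : ℝ} (hN : 5 ≤ N) {p q : ℝ} (hp : 0 < p) (hq : 0 < q)
    (h : 1 / (p + 1) + 1 / (q + 1) = (N - 2) / N)
    (hpε : |p - 1| ≤ 1 / (100 * N ^ 2)) :
    (N - 2) * |p - 1| ≤ 1 / 100 ∧ p * |1 - p| * (N - 2) ^ 2 ≤ 1 / 2 ∧
    (N - 4) / 4 < N - 2 - N / (p + 1) ∧ 5 ≤ 3 * (N - 4) / 4 * (q - 1) := by
  set δ := |p - 1| with hδ
  have hδ0 : 0 ≤ δ := abs_nonneg _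
  have h1 : N ^ 2 * δ ≤ 1 / 100 := by
    rw [le_div_iff₀ (by positivity)] at hpε
    linarith
  have h2 : N * δ ≤ 1 / 100 := by nlinarith [mul_nonneg hδ0 (by linarith : (0:ℝ) ≤ N)]
  have h3 : δ ≤ 1 / 100 := by nlinarith
  obtain ⟨hp1, hp2⟩ := abs_le.1 hδ.ge
  set α := N - 2 - N / (p + 1) with hα
  have hαe : α - (N - 4) / 2 = N * (p - 1) / (2 * (p + 1)) := by
    rw [hα]; field_simp; ring
  have ht : |α - (N - 4) / 2| ≤ 1 / 20 := by
    rw [hαe, abs_div, abs_mul, abs_of_pos (by linarith : 0 < N),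
      abs_of_pos (by linarith : 0 < 2 * (p + 1)), div_le_iff₀ (by linarith), ← hδ]
    linarith
  obtain ⟨ht1, ht2⟩ := abs_le.1 ht
  have hα0 : 0 < α := by linarith
  have hαq : α * (q + 1) = N := by
    have : α = N * (1 / (q + 1)) := by
      have h5 : 1 / (q + 1) = (N - 2) / N - 1 / (p + 1) := by linarith
      rw [h5, hα]; field_simp
    rw [this]; field_simp
  refine ⟨?_, ?_, by linarith, ?_⟩
  · nlinarith
  · rw [abs_sub_comm, ← hδ]
    have h6 : (N - 2) ^ 2 * δ ≤ 1 / 100 := by nlinarith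
    nlinarith [mul_nonneg (sq_nonneg (N - 2)) hδ0]
  · have h7 : α * 5 ≤ α * (3 * (N - 4) / 4 * (q - 1)) := by
      have : α * (3 * (N - 4) / 4 * (q - 1)) = 3 * (N - 4) / 4 * (N - 2 * α) := by
        rw [← hαq]; ring
      rw [this]
      nlinarith
    exact le_of_mul_le_mul_left h7 hα0

theorem scalar_nondegeneracy_near_one (n : ℕ) (hn : 5 ≤ n) :
    ∃ ε₁ : ℝ, 0 < ε₁ ∧
      ∀ p q : ℝ, 0 < p → 0 < q →
        1 / (p + 1) + 1 / (q + 1) = ((n : ℝ) - 2) / n →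
        |p - 1| ≤ ε₁ →
        ∀ U V : EuclideanSpace ℝ (Fin n) → ℝ, IsGroundState n p q U V →
        ∀ φ : EuclideanSpace ℝ (Fin n) → ℝ,
          ContDiff ℝ (⊤ : ℕ∞) φ →
          Tendsto φ (cocompact _) (nhds 0) →
          Integrable (fun x => (lap φ x) ^ 2) →
          (∀ x, -lap (fun y => (-lap U y) ^ (1 / p - 1) * (-lap φ y)) x
              = p * q * U x ^ (q - 1) * φ x) →
          ∃ (c : Fin n → ℝ) (c₀ : ℝ),
            ∀ x, φ x = (∑ j, c j * fderiv ℝ U x (EuclideanSpace.single j 1)) +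
              c₀ * (fderiv ℝ U x x + ((n : ℝ) - 2 - (n : ℝ) / (p + 1)) * U x) := by
  have hn' : (5 : ℝ) ≤ n := by exact_mod_cast hn
  refine ⟨1 / (100 * (n : ℝ) ^ 2), by positivity, ?_⟩
  intro p q hp hq hpq hpε U V G φ hφ hφ0 hint hEq
  obtain ⟨hδ, hγ, hα4, hs⟩ := exponent_estimates hn' hp hq hpq hpε
  have hαq : ((n : ℝ) - 2 - n / (p + 1)) * (q + 1) = n := by
    have h5 : 1 / (q + 1) = ((n : ℝ) - 2) / n - 1 / (p + 1) := by linarith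
    have : (n : ℝ) - 2 - n / (p + 1) = n * (1 / (q + 1)) := by
      rw [h5]; field_simp
    rw [this]; field_simp
  have hβp : (n : ℝ) / (p + 1) * (p + 1) = n := by field_simp
  exact G.exists_combination hn hp hq hδ (β := n / (p + 1)) (by linarith) (by positivity)
    (by ring) (by linarith) (by linarith) (by nlinarith) hα4 hγ hs
    (hφ.of_le (mod_cast le_top : ((4 : ℕ∞) : WithTop ℕ∞) ≤ (⊤ : ℕ∞))) hφ0 hint hEq
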